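/- Let M and N be von Neumann algebras, acting on complex Hilbert spaces H₁ and H₂ respectively. If the algebraic tensor product M ⊗_ℂ N admits at least two distinct C*-norms, then the set of all C*-norms on M ⊗_ℂ N has cardinality at least 2^ℵ₀ (the cardinality of the continuum). -/

import Mathlib

set_option synthInstance.maxHeartbeats 1000000
set_option maxHeartbeats 1000000

open scoped TensorProduct

noncomputable section CStarNormDefs

namespace PaperCStarNorms

variable {A B : Type*} [Ring A] [Algebra ℂ A] [StarRing A] [StarModule ℂ A]
  [Ring B] [Algebra ℂ B] [StarRing B] [StarModule ℂ B]

/-- The canonical involution on the algebraic tensor product `A ⊗[ℂ] B` of two complex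
`*`-algebras, determined by `(a ⊗ b)* = a* ⊗ b*`. -/
def tensorStarAux : A ⊗[ℂ] B →+ A ⊗[ℂ] B :=
  TensorProduct.liftAddHom
    (AddMonoidHom.mk'
      (fun a => AddMonoidHom.mk' (fun b => star a ⊗ₜ[ℂ] star b)
        (fun b₁ b₂ => by simp [star_add, TensorProduct.tmul_add]))
      (fun a₁ a₂ => by
        ext b
        simp [star_add, TensorProduct.add_tmul]))
    (fun c a b => by
      simp [star_smul, TensorProduct.smul_tmul', TensorProduct.tmul_smul])

@[simp] lemma tensorStarAux_tmul (a : A) (b : B) :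
    tensorStarAux (a ⊗ₜ[ℂ] b) = star a ⊗ₜ[ℂ] star b :=
  TensorProduct.liftAddHom_tmul _ _ _ _

instance : StarRing (A ⊗[ℂ] B) where
  star := tensorStarAux
  star_involutive x := by
    show tensorStarAux (tensorStarAux x) = x
    induction x using TensorProduct.induction_on with
    | zero => simp
    | tmul a b => simp
    | add x y hx hy => simp only [map_add, hx, hy]
  star_mul x y := by
    show tensorStarAux (x * y) = tensorStarAux y * tensorStarAux x
    induction x using TensorProduct.induction_on with
    | zero => simp
    | tmul a b =>
      induction y using TensorProduct.induction_on with
      | zero => simp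
      | tmul c d => simp [Algebra.TensorProduct.tmul_mul_tmul]
      | add y₁ y₂ h₁ h₂ => rw [mul_add, map_add, h₁, h₂, map_add, add_mul]
    | add x₁ x₂ h₁ h₂ => rw [add_mul, map_add, h₁, h₂, map_add, mul_add]
  star_add x y := map_add tensorStarAux x y

@[simp] lemma star_tmul (a : A) (b : B) :
    star (a ⊗ₜ[ℂ] b) = star a ⊗ₜ[ℂ] star b := rfl

end PaperCStarNorms

/-- A C*-seminorm on a complex `*`-algebra `A`. -/
def IsCstarSeminorm {A : Type*} [Ring A] [Algebra ℂ A] [StarRing A] (f : A → ℝ) : Prop :=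
  (∀ x, 0 ≤ f x) ∧ (∀ x y, f (x + y) ≤ f x + f y) ∧
  (∀ (c : ℂ) (x), f (c • x) = ‖c‖ * f x) ∧ (∀ x y, f (x * y) ≤ f x * f y) ∧
  (∀ x, f (star x) = f x) ∧ (∀ x, f (star x * x) = f x ^ 2)

/-- A C*-norm on a complex `*`-algebra `A`. -/
def IsCstarNorm {A : Type*} [Ring A] [Algebra ℂ A] [StarRing A] (f : A → ℝ) : Prop :=
  IsCstarSeminorm f ∧ ∀ x, f x = 0 → x = 0

end CStarNormDefs

universe u v

set_option linter.unusedVariables false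
set_option linter.style.haveILetI false
set_option linter.unusedSimpArgs false
set_option linter.unusedSectionVars false

namespace CN

section basic
variable {A : Type*} [Ring A] [Algebra ℂ A] [StarRing A] {f g : A → ℝ}

lemma sn_zero (hf : IsCstarSeminorm f) : f 0 = 0 := by
  have := hf.2.2.1 0 0
  simpa using this

lemma sn_neg (hf : IsCstarSeminorm f) (x : A) : f (-x) = f x := by
  have := hf.2.2.1 (-1) x
  simpa using this

lemma sn_sub (hf : IsCstarSeminorm f) (x y : A) : f (x - y) ≤ f x + f y := by
  rw [sub_eq_add_neg, ← sn_neg hf y]; exact hf.2.1 _ _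

lemma sn_abs_sub (hf : IsCstarSeminorm f) (x y : A) : |f x - f y| ≤ f (x - y) := by
  have h1 := hf.2.1 (x - y) y
  have h2 := hf.2.1 (y - x) x
  have h3 := sn_neg hf (x - y)
  simp only [neg_sub, sub_add_cancel] at h1 h2 h3
  rw [abs_le]; constructor <;> linarith

lemma sn_sum (hf : IsCstarSeminorm f) {ι : Type*} (s : Finset ι) (x : ι → A) :
    f (∑ i ∈ s, x i) ≤ ∑ i ∈ s, f (x i) := by
  classical
  induction s using Finset.induction_on with
  | empty => simp [sn_zero hf]
  | insert a s ha ih =>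
    rw [Finset.sum_insert ha, Finset.sum_insert ha]
    exact (hf.2.1 _ _).trans (by linarith)

lemma sn_one (hf : IsCstarSeminorm f) : f 1 ≤ 1 := by
  have h := hf.2.2.2.2.2 1
  simp only [star_one, mul_one] at h
  have h0 := hf.1 1
  nlinarith

lemma sn_unitary (hf : IsCstarSeminorm f) {u : A} (hu : star u * u = 1) : f u ≤ 1 := by
  have h := hf.2.2.2.2.2 u
  rw [hu] at h
  have h0 := hf.1 u
  have h1 := sn_one hf
  nlinarith

lemma sn_proj (hf : IsCstarSeminorm f) {p : A} (hp : IsStarProjection p) : f p ≤ 1 := by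
  have h := hf.2.2.2.2.2 p
  rw [hp.isSelfAdjoint.star_eq, hp.isIdempotentElem.eq] at h
  have h0 := hf.1 p
  nlinarith

lemma sn_pow (hf : IsCstarSeminorm f) (x : A) (n : ℕ) : f (x ^ n) ≤ f x ^ n := by
  induction n with
  | zero => simpa using sn_one hf
  | succ n ih =>
    rw [pow_succ, pow_succ]
    exact (hf.2.2.2.1 _ _).trans (mul_le_mul_of_nonneg_right ih (hf.1 _))

lemma sn_pow_trick_aux {C a b : ℝ} (hb : 0 ≤ b)
    (h : ∀ k : ℕ, a ^ (2 ^ k) ≤ C * b ^ (2 ^ k)) : a ≤ b := by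
  by_contra hab
  push Not at hab
  rcases hb.eq_or_lt with hb0 | hb0
  · have := h 0
    rw [← hb0] at this
    simp at this
    rw [← hb0] at hab
    linarith
  · have h1 : 1 < a / b := by rwa [one_lt_div hb0]
    obtain ⟨n, hn⟩ := pow_unbounded_of_one_lt C h1
    have h2 := h n
    have h3 : (a / b) ^ n ≤ (a / b) ^ (2 ^ n) :=
      pow_le_pow_right₀ h1.le (Nat.lt_two_pow_self).le
    rw [div_pow, div_pow] at h3
    have h4 : a ^ 2 ^ n / b ^ 2 ^ n ≤ C := by
      rw [div_le_iff₀ (by positivity)]; exact h2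
    rw [div_pow] at hn
    linarith

lemma sn_pow_trick (hf : IsCstarSeminorm f) (hg : IsCstarSeminorm g) {C : ℝ} (P : A → Prop)
    (hP : ∀ x, P x → P (star x * x)) (h : ∀ x, P x → f x ≤ C * g x) :
    ∀ x, P x → f x ≤ g x := by
  intro x hx
  apply sn_pow_trick_aux (C := C) (hg.1 x)
  have key : ∀ (k : ℕ) (x : A), P x → f x ^ (2 ^ k) ≤ C * g x ^ (2 ^ k) := by
    intro k
    induction k with
    | zero => intro x hx; simpa using h x hx
    | succ k ih =>
      intro x hx
      have := ih _ (hP x hx)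
      rw [hf.2.2.2.2.2, hg.2.2.2.2.2, ← pow_mul, ← pow_mul] at this
      rwa [pow_succ, mul_comm (2 ^ k) 2]
  exact fun k => key k x hx

end basic

section cstar
variable {A : Type*} [CStarAlgebra A] {f : A → ℝ}

lemma sn_norm : IsCstarSeminorm (fun x : A => ‖x‖) :=
  ⟨fun _ => norm_nonneg _, norm_add_le, norm_smul, norm_mul_le, norm_star, fun x => by
    show ‖star x * x‖ = ‖x‖ ^ 2
    rw [CStarRing.norm_star_mul_self, sq]⟩

lemma sn_le_norm (hf : IsCstarSeminorm f) (x : A) : f x ≤ ‖x‖ := by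
  refine sn_pow_trick hf sn_norm (C := 2) (fun _ => True) (fun _ _ => trivial) ?_ x trivial
  intro x _
  obtain ⟨u, c, hx, hc⟩ := CStarAlgebra.exists_sum_four_unitary x
  have h1 : f x ≤ ∑ i, f (c i • (u i : A)) := by
    conv_lhs => rw [hx]
    exact sn_sum hf _ _
  have h2 : ∀ i, f (c i • (u i : A)) ≤ ‖x‖ / 2 := by
    intro i
    rw [hf.2.2.1]
    have := sn_unitary hf (u := (u i : A)) (by simp)
    have := hf.1 (u i : A)
    nlinarith [hc i, norm_nonneg (c i)]
  calc f x ≤ ∑ i, f (c i • (u i : A)) := h1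
    _ ≤ ∑ i : Fin 4, ‖x‖ / 2 := Finset.sum_le_sum fun i _ => h2 i
    _ = 2 * ‖x‖ := by simp; ring

lemma sn_eq_norm_aux (hf : IsCstarSeminorm f) (h0 : ∀ x, f x = 0 → x = 0) (a : A) :
    ‖star a * a‖ ≤ f (star a * a) := by
  rcases subsingleton_or_nontrivial A with hA | hA
  · simp [Subsingleton.elim a 0, sn_zero hf]
  by_contra hlt
  push Not at hlt
  set h := star a * a with hh
  have hsa : IsSelfAdjoint h := IsSelfAdjoint.star_mul_self a
  obtain ⟨c, hc1, hc2⟩ := exists_between hlt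
  have hc0 : 0 < c := lt_of_le_of_lt (hf.1 _) hc1
  have hspec : ‖h‖ ∈ spectrum ℝ h := by
    obtain ⟨⟨x, hx, hxe⟩, -⟩ := IsometricContinuousFunctionalCalculus.isGreatest_norm_spectrum (𝕜 := ℝ) h
    have : 0 ≤ x := spectrum_star_mul_self_nonneg x hx
    simp only at hxe
    rw [Real.norm_of_nonneg this] at hxe
    rwa [← hxe]
  let k := cfc (fun x : ℝ => max (x - c) 0) h
  have hk : k ≠ 0 := by
    intro hk0
    have := norm_apply_le_norm_cfc (fun x : ℝ => max (x - c) 0) h hspec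
    change _ ≤ ‖k‖ at this
    rw [hk0, norm_zero] at this
    have h2 : 0 < max (‖h‖ - c) 0 := lt_max_of_lt_left (by linarith)
    rw [Real.norm_of_nonneg h2.le] at this
    linarith
  apply hk
  apply h0
  have hcont : ∀ n : ℕ, Continuous (fun x : ℝ => max (x - c) 0 / (max x c) ^ n) := by
    intro n
    refine Continuous.div (by fun_prop) (by fun_prop) ?_
    intro x
    have : 0 < max x c := lt_max_of_lt_right hc0
    positivity
  have hb : ∀ n : ℕ, f k ≤ (f h / c) ^ n * ‖h‖ := by
    intro n
    have e1 : k = h ^ n * cfc (fun x : ℝ => max (x - c) 0 / (max x c) ^ n) h := by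
      have : h ^ n = cfc (fun x : ℝ => x ^ n) h := by rw [cfc_pow_id (R := ℝ) h n]
      rw [this, ← cfc_mul _ _ h (by fun_prop) ((hcont n).continuousOn)]
      apply cfc_congr
      intro x hx
      simp only
      rcases le_total x c with hxc | hxc
      · simp [hxc]
      · rw [max_eq_left hxc]
        have : 0 < x := by linarith
        field_simp
    have e2 : ‖cfc (fun x : ℝ => max (x - c) 0 / (max x c) ^ n) h‖ ≤ ‖h‖ / c ^ n := by
      apply norm_cfc_le (by positivity)
      intro x hx
      have hx1 : ‖x‖ ≤ ‖h‖ := spectrum.norm_le_norm_of_mem hx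
      have hm : c ≤ max x c := le_max_right _ _
      have hm0 : 0 < max x c := lt_max_of_lt_right hc0
      rw [Real.norm_of_nonneg (by positivity)]
      apply div_le_div₀ (norm_nonneg _) _ (by positivity) (pow_le_pow_left₀ hc0.le hm n)
      rw [Real.norm_eq_abs] at hx1
      have := le_abs_self x
      apply max_le <;> linarith [norm_nonneg h]
    have e3 : f (h ^ n) ≤ f h ^ n := sn_pow hf h n
    calc f k ≤ f (h ^ n) * f (cfc (fun x : ℝ => max (x - c) 0 / (max x c) ^ n) h) := by
          conv_lhs => rw [e1]
          exact hf.2.2.2.1 _ _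
      _ ≤ f h ^ n * (‖h‖ / c ^ n) :=
          mul_le_mul e3 ((sn_le_norm hf _).trans e2) (hf.1 _) (pow_nonneg (hf.1 _) _)
      _ = _ := by rw [div_pow]; ring
  have ht : Filter.Tendsto (fun n : ℕ => (f h / c) ^ n * ‖h‖) Filter.atTop (nhds (0 * ‖h‖)) := by
    apply Filter.Tendsto.mul_const
    apply tendsto_pow_atTop_nhds_zero_of_lt_one (div_nonneg (hf.1 _) hc0.le)
    rwa [div_lt_one hc0]
  rw [zero_mul] at ht
  exact le_antisymm (ge_of_tendsto' ht hb) (hf.1 _)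

lemma sn_eq_norm (hf : IsCstarSeminorm f) (h0 : ∀ x, f x = 0 → x = 0) (a : A) : f a = ‖a‖ := by
  apply le_antisymm (sn_le_norm hf a)
  have := sn_eq_norm_aux hf h0 a
  rw [CStarRing.norm_star_mul_self, hf.2.2.2.2.2] at this
  have h1 := hf.1 a
  nlinarith [norm_nonneg a]

end cstar
end CN

namespace CN

section starinst
variable {A B : Type*} [Ring A] [Algebra ℂ A] [StarRing A] [StarModule ℂ A]
  [Ring B] [Algebra ℂ B] [StarRing B] [StarModule ℂ B]

/-- the star ring structure of the statement -/
@[reducible] noncomputable def paperSR (A B : Type*) [Ring A] [Algebra ℂ A] [StarRing A] [StarModule ℂ A]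
  [Ring B] [Algebra ℂ B] [StarRing B] [StarModule ℂ B] : StarRing (A ⊗[ℂ] B) := inferInstance

noncomputable scoped instance (priority := 5000) pStarMul : StarMul (A ⊗[ℂ] B) := (paperSR A B).toStarMul
noncomputable scoped instance (priority := 5000) pStarAdd : StarAddMonoid (A ⊗[ℂ] B) :=
  (paperSR A B).toStarAddMonoid
noncomputable scoped instance (priority := 5000) pStarInv : InvolutiveStar (A ⊗[ℂ] B) :=
  (paperSR A B).toStarMul.toInvolutiveStar
noncomputable scoped instance (priority := 5000) pStar : Star (A ⊗[ℂ] B) :=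
  (paperSR A B).toStarMul.toInvolutiveStar.toStar

@[simp] lemma pstar_tmul (a : A) (b : B) : star (a ⊗ₜ[ℂ] b) = star a ⊗ₜ[ℂ] star b :=
  PaperCStarNorms.tensorStarAux_tmul a b

scoped instance (priority := 5000) pStarModule : StarModule ℂ (A ⊗[ℂ] B) where
  star_smul c x := by
    induction x using TensorProduct.induction_on with
    | zero => simp
    | tmul a b => rw [TensorProduct.smul_tmul', pstar_tmul, pstar_tmul, star_smul, TensorProduct.smul_tmul']
    | add x y hx hy => rw [smul_add, star_add, hx, hy, star_add, smul_add]

end starinst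

end CN

namespace CN

section partB
variable {A B : Type*} [CStarAlgebra A] [CStarAlgebra B] {f g : A ⊗[ℂ] B → ℝ}

/-- abelian projections -/
def AbProj {A : Type*} [Ring A] [StarRing A] (p : A) : Prop :=
  IsStarProjection p ∧ ∀ x y, (p * x * p) * (p * y * p) = (p * y * p) * (p * x * p)

def HSpan (A : Type*) [CStarAlgebra A] : Prop :=
  ∀ p : A, IsStarProjection p → ∀ x,
    p * x * p ∈ closure (Submodule.span ℂ {q : A | IsStarProjection q ∧ p * q = q} : Set A)

lemma sn_tmul_le (hf : IsCstarSeminorm f) (a : A) (b : B) : f (a ⊗ₜ b) ≤ ‖a‖ * ‖b‖ := by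
  have h1 : IsCstarSeminorm (fun a : A => f (a ⊗ₜ 1)) := by
    refine ⟨fun _ => hf.1 _, fun x y => ?_, fun c x => ?_, fun x y => ?_, fun x => ?_, fun x => ?_⟩
    · simp only [TensorProduct.add_tmul]; exact hf.2.1 _ _
    · simp only [← TensorProduct.smul_tmul']; exact hf.2.2.1 _ _
    · have := hf.2.2.2.1 (x ⊗ₜ 1) (y ⊗ₜ 1)
      simpa using this
    · have := hf.2.2.2.2.1 (x ⊗ₜ 1)
      simpa using this
    · have := hf.2.2.2.2.2 (x ⊗ₜ 1)
      simpa using this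
  have h2 : IsCstarSeminorm (fun a : B => f (1 ⊗ₜ a)) := by
    refine ⟨fun _ => hf.1 _, fun x y => ?_, fun c x => ?_, fun x y => ?_, fun x => ?_, fun x => ?_⟩
    · simp only [TensorProduct.tmul_add]; exact hf.2.1 _ _
    · simp only [TensorProduct.tmul_smul]; exact hf.2.2.1 _ _
    · have := hf.2.2.2.1 (1 ⊗ₜ x) (1 ⊗ₜ y)
      simpa using this
    · have := hf.2.2.2.2.1 (1 ⊗ₜ x)
      simpa using this
    · have := hf.2.2.2.2.2 (1 ⊗ₜ x)
      simpa using this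
  have h3 : a ⊗ₜ[ℂ] b = (a ⊗ₜ 1) * (1 ⊗ₜ b) := by simp
  rw [h3]
  exact (hf.2.2.2.1 _ _).trans (mul_le_mul (sn_le_norm h1 a) (sn_le_norm h2 b) (hf.1 _) (norm_nonneg _))

lemma cn_proj_tmul (hf : IsCstarNorm f) {p : A} (hp : IsStarProjection p) (hp0 : p ≠ 0) (y : B) :
    f (p ⊗ₜ y) = ‖y‖ := by
  obtain ⟨hf, hf0⟩ := hf
  have hpp := hp.isIdempotentElem.eq
  have hps := hp.isSelfAdjoint.star_eq
  have h2 : IsCstarSeminorm (fun a : B => f (p ⊗ₜ a)) := by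
    refine ⟨fun _ => hf.1 _, fun x y => ?_, fun c x => ?_, fun x y => ?_, fun x => ?_, fun x => ?_⟩
    · simp only [TensorProduct.tmul_add]; exact hf.2.1 _ _
    · simp only [TensorProduct.tmul_smul]; exact hf.2.2.1 _ _
    · have := hf.2.2.2.1 (p ⊗ₜ x) (p ⊗ₜ y)
      simpa [hpp] using this
    · have := hf.2.2.2.2.1 (p ⊗ₜ x)
      simpa [hps] using this
    · have := hf.2.2.2.2.2 (p ⊗ₜ x)
      simpa [hps, hpp] using this
  refine sn_eq_norm h2 (fun x hx => ?_) y
  have h3 := hf0 _ hx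
  by_contra hx0
  apply hp0
  rw [← Module.forall_dual_apply_eq_zero_iff ℂ]
  intro φ
  have h4 := congrArg (TensorProduct.lid ℂ B) (congrArg (LinearMap.rTensor B φ) h3)
  simpa [hx0] using h4

lemma sn_orth_le {R : Type*} [Ring R] [Algebra ℂ R] [StarRing R] {f : R → ℝ}
    (hf : IsCstarSeminorm f) {x y : R} (h1 : star x * y = 0) (h2 : x * star y = 0) :
    f (x + y) ≤ max (f x) (f y) := by
  apply sn_pow_trick_aux (C := 2) (le_max_of_le_left (hf.1 x))
  intro k
  induction k generalizing x y with
  | zero =>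
    have := hf.2.1 x y
    have := le_max_left (f x) (f y)
    have := le_max_right (f x) (f y)
    simp only [pow_zero, pow_one]; linarith
  | succ k ih =>
    have h1' : star y * x = 0 := by simpa using congrArg star h1
    have e : star (x + y) * (x + y) = star x * x + star y * y := by
      rw [star_add, add_mul, mul_add, mul_add, h1, h1']; simp
    have := ih (x := star x * x) (y := star y * y) (by
      simp only [star_mul, star_star]
      rw [mul_assoc, ← mul_assoc x, h2]; simp) (by
      simp only [star_mul, star_star]
      rw [mul_assoc, ← mul_assoc x, h2]; simp)
    rw [← e, hf.2.2.2.2.2, hf.2.2.2.2.2, hf.2.2.2.2.2, ← pow_mul] at this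
    have e2 : max (f x ^ 2) (f y ^ 2) = (max (f x) (f y)) ^ 2 :=
      ((pow_left_monotoneOn (M₀ := ℝ) (n := 2)).map_max (hf.1 x) (hf.1 y)).symm
    rw [e2, ← pow_mul] at this
    rwa [pow_succ, mul_comm (2 ^ k) 2]

lemma sn_orth_ge {R : Type*} [Ring R] [Algebra ℂ R] [StarRing R] {f : R → ℝ}
    (hf : IsCstarSeminorm f) {x y : R} (h1 : star x * y = 0) :
    f x ≤ f (x + y) := by
  have h := hf.2.2.2.1 (star x) (x + y)
  rw [mul_add, h1, add_zero, hf.2.2.2.2.2, hf.2.2.2.2.1] at h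
  have h0 := hf.1 x
  have h0 := hf.1 (x + y)
  nlinarith

/-- step tensors -/
noncomputable def stepT (e : A) (l : List (A × B)) : A ⊗[ℂ] B := (l.map fun q => (e * q.1) ⊗ₜ[ℂ] q.2).sum

lemma stepT_sub (e e' : A) (l : List (A × B)) : stepT (e - e') l = stepT e l - stepT e' l := by
  induction l with
  | nil => simp [stepT]
  | cons a l ih =>
    simp only [stepT, List.map_cons, List.sum_cons] at ih ⊢
    rw [ih, sub_mul, TensorProduct.sub_tmul]; abel

lemma stepT_mul (e e' : A) (b : B) (l : List (A × B)) :
    (e ⊗ₜ[ℂ] b) * stepT e' l = stepT (e * e') (l.map fun q => (q.1, b * q.2)) := by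
  induction l with
  | nil => simp [stepT]
  | cons a l ih =>
    simp only [stepT, List.map_cons, List.sum_cons] at ih ⊢
    rw [mul_add, ih]; simp [mul_assoc]

lemma stepT_zero (l : List (A × B)) : stepT (0 : A) l = 0 := by
  induction l with
  | nil => simp [stepT]
  | cons a l ih =>
    simp only [stepT, List.map_cons, List.sum_cons] at ih ⊢
    rw [ih]; simp

lemma comm_step (p e' : A) (l : List (A × B)) (h1 : ∀ q' ∈ l, Commute p q'.1) (h2 : Commute p e') :
    Commute (p ⊗ₜ[ℂ] (1 : B)) (stepT e' l) := by
  induction l with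
  | nil => simp [stepT]
  | cons a l ih =>
    have e : stepT e' (a :: l) = (e' * a.1) ⊗ₜ a.2 + stepT e' l := by simp [stepT]
    rw [e]
    apply Commute.add_right _ (ih fun q hq => h1 q (List.mem_cons_of_mem _ hq))
    have := (h2.mul_right (h1 a List.mem_cons_self)).eq
    show _ * _ = _ * _
    simp [this]

lemma step_le (hf : IsCstarNorm f) (hg : IsCstarNorm g) (l : List (A × B))
    (hl : ∀ q ∈ l, IsStarProjection q.1) (hc : ∀ q ∈ l, ∀ q' ∈ l, Commute q.1 q'.1) :
    ∀ (e : A), IsStarProjection e → (∀ q ∈ l, Commute e q.1) → ∀ y0 : B,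
      f (e ⊗ₜ y0 + stepT e l) ≤ g (e ⊗ₜ y0 + stepT e l) := by
  induction l with
  | nil =>
    intro e he _ y0
    by_cases h0 : e = 0
    · simp [h0, stepT, sn_zero hf.1, sn_zero hg.1]
    · simp only [stepT, List.map_nil, List.sum_nil, add_zero]
      rw [cn_proj_tmul hf he h0, cn_proj_tmul hg he h0]
  | cons q l ih =>
    intro e he hce y0
    have ih' := ih (fun q hq => hl q (List.mem_cons_of_mem _ hq))
      (fun q hq q' hq' => hc q (List.mem_cons_of_mem _ hq) q' (List.mem_cons_of_mem _ hq'))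
    have hq := hl q List.mem_cons_self
    have heq : Commute e q.1 := hce q List.mem_cons_self
    have hp1 : IsStarProjection (e * q.1) := he.mul hq heq
    have hee := he.isIdempotentElem.eq
    have hes := he.isSelfAdjoint.star_eq
    have hqq := hq.isIdempotentElem.eq
    have h12 : (e * q.1) * e = e * q.1 := by rw [mul_assoc, ← heq.eq, ← mul_assoc, hee]
    have h21 : e * (e * q.1) = e * q.1 := by rw [← mul_assoc, hee]
    have hp2 : IsStarProjection (e - e * q.1) := by
      refine ⟨?_, he.isSelfAdjoint.sub hp1.isSelfAdjoint⟩
      show _ * _ = _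
      rw [sub_mul, mul_sub, mul_sub, hee, h12, h21, hp1.isIdempotentElem.eq]; simp
    have hc1 : ∀ q' ∈ l, Commute (e * q.1) q'.1 := fun q' hq' =>
      (hce q' (List.mem_cons_of_mem _ hq')).mul_left
        (hc q List.mem_cons_self q' (List.mem_cons_of_mem _ hq'))
    have hc2 : ∀ q' ∈ l, Commute (e - e * q.1) q'.1 := fun q' hq' =>
      (hce q' (List.mem_cons_of_mem _ hq')).sub_left (hc1 q' hq')
    have i1 := ih' _ hp1 hc1 (y0 + q.2)
    have i2 := ih' _ hp2 hc2 y0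
    set X := (e * q.1) ⊗ₜ[ℂ] (y0 + q.2) + stepT (e * q.1) l with hX
    set Y := (e - e * q.1) ⊗ₜ[ℂ] y0 + stepT (e - e * q.1) l with hY
    have hXY : e ⊗ₜ[ℂ] y0 + stepT e (q :: l) = X + Y := by
      have : stepT e (q :: l) = (e * q.1) ⊗ₜ q.2 + stepT e l := by simp [stepT]
      rw [this, hX, hY, stepT_sub, TensorProduct.tmul_add, TensorProduct.sub_tmul]; abel
    -- X = (P ⊗ 1) X
    have hPX : ∀ (p : A) (hp : IsStarProjection p) (y : B),
        (∀ q' ∈ l, Commute p q'.1) → (p ⊗ₜ[ℂ] (1 : B)) * (p ⊗ₜ y + stepT p l) = p ⊗ₜ y + stepT p l ∧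
        (p ⊗ₜ y + stepT p l) * (p ⊗ₜ[ℂ] (1 : B)) = p ⊗ₜ y + stepT p l := by
      intro p hp y h1
      have e1 : (p ⊗ₜ[ℂ] (1 : B)) * (p ⊗ₜ y + stepT p l) = p ⊗ₜ y + stepT p l := by
        rw [mul_add, stepT_mul]; simp [hp.isIdempotentElem.eq]
      refine ⟨e1, ?_⟩
      rw [add_mul, ← (comm_step p p l h1 (Commute.refl p)).eq, stepT_mul]
      simp [hp.isIdempotentElem.eq]
    obtain ⟨x1, x2⟩ := hPX _ hp1 (y0 + q.2) hc1
    obtain ⟨y1, y2⟩ := hPX _ hp2 y0 hc2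
    rw [← hX] at x1 x2
    rw [← hY] at y1 y2
    have hPQ : (e * q.1) * (e - e * q.1) = 0 := by
      rw [mul_sub, h12, hp1.isIdempotentElem.eq, sub_self]
    have hPQ' : ((e * q.1) ⊗ₜ[ℂ] (1 : B)) * ((e - e * q.1) ⊗ₜ[ℂ] (1 : B)) = 0 := by
      rw [Algebra.TensorProduct.tmul_mul_tmul, hPQ]; simp
    have hPs : star ((e * q.1) ⊗ₜ[ℂ] (1 : B)) = (e * q.1) ⊗ₜ[ℂ] (1 : B) := by
      rw [pstar_tmul, hp1.isSelfAdjoint.star_eq, star_one]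
    have hQs : star ((e - e * q.1) ⊗ₜ[ℂ] (1 : B)) = (e - e * q.1) ⊗ₜ[ℂ] (1 : B) := by
      rw [pstar_tmul, hp2.isSelfAdjoint.star_eq, star_one]
    have o1 : star X * Y = 0 := by
      rw [← x1, ← y1, star_mul, hPs, mul_assoc, ← mul_assoc _ _ Y, hPQ']; simp
    have o2 : X * star Y = 0 := by
      rw [← x2, ← y2, star_mul, hQs, mul_assoc, ← mul_assoc _ _ (star Y), hPQ']; simp
    have o3 : star Y * X = 0 := by simpa using congrArg star o1
    rw [hXY]
    refine (sn_orth_le hf.1 o1 o2).trans (max_le (i1.trans (sn_orth_ge hg.1 o1)) (i2.trans ?_))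
    rw [add_comm]
    exact sn_orth_ge hg.1 o3

/-- every element of `pAp ⊗ B` is approximated by step tensors -/
lemma step_approx (hA : HSpan A) (hf : IsCstarSeminorm f) (hg : IsCstarSeminorm g) {p : A}
    (hp : IsStarProjection p) (X : A ⊗[ℂ] B) : ∀ ε > 0, ∃ l : List (A × B),
      (∀ q ∈ l, IsStarProjection q.1 ∧ p * q.1 = q.1) ∧
      f ((p ⊗ₜ 1) * X * (p ⊗ₜ 1) - stepT p l) ≤ ε ∧
      g ((p ⊗ₜ 1) * X * (p ⊗ₜ 1) - stepT p l) ≤ ε := by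
  induction X using TensorProduct.induction_on with
  | zero => exact fun ε hε => ⟨[], by simp, by simp [stepT, sn_zero hf, hε.le],
      by simp [stepT, sn_zero hg, hε.le]⟩
  | tmul a b =>
    intro ε hε
    have h1 := hA p hp a
    obtain ⟨w, hw, hwd⟩ := Metric.mem_closure_iff.mp h1 (ε / (‖b‖ + 1)) (by positivity)
    have h2 : ∃ l : List (A × B), (∀ q ∈ l, IsStarProjection q.1 ∧ p * q.1 = q.1) ∧
        w ⊗ₜ[ℂ] b = stepT p l := by
      clear hwd
      induction hw using Submodule.span_induction with
      | mem x h => exact ⟨[(x, b)], by simpa using h, by simp [stepT, h.2]⟩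
      | zero => exact ⟨[], by simp, by simp [stepT]⟩
      | add x y _ _ hx hy =>
        obtain ⟨l1, h1, e1⟩ := hx
        obtain ⟨l2, h2, e2⟩ := hy
        refine ⟨l1 ++ l2, ?_, ?_⟩
        · intro q hq
          rcases List.mem_append.mp hq with hq | hq
          exacts [h1 q hq, h2 q hq]
        · rw [TensorProduct.add_tmul, e1, e2]; simp [stepT]
      | smul c x _ hx =>
        obtain ⟨l, h, e⟩ := hx
        refine ⟨l.map fun q => (q.1, c • q.2), ?_, ?_⟩
        · intro q hq
          obtain ⟨q', hq', rfl⟩ := List.mem_map.mp hq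
          exact h q' hq'
        · rw [← TensorProduct.smul_tmul', e]
          simp only [stepT, List.map_map, List.smul_sum]
          congr 1
          apply List.map_congr_left
          intro q _
          simp
    obtain ⟨l, hl, hle⟩ := h2
    have e : (p ⊗ₜ[ℂ] (1 : B)) * (a ⊗ₜ b) * (p ⊗ₜ 1) - stepT p l = (p * a * p - w) ⊗ₜ b := by
      rw [← hle, TensorProduct.sub_tmul]; simp
    have hb : ‖p * a * p - w‖ * ‖b‖ ≤ ε := by
      rw [dist_eq_norm] at hwd
      have : ε / (‖b‖ + 1) * (‖b‖ + 1) = ε := by field_simp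
      nlinarith [norm_nonneg b, norm_nonneg (p * a * p - w)]
    exact ⟨l, hl, e ▸ (sn_tmul_le hf _ _).trans hb, e ▸ (sn_tmul_le hg _ _).trans hb⟩
  | add x y hx hy =>
    intro ε hε
    obtain ⟨l1, h1, f1, g1⟩ := hx (ε / 2) (by positivity)
    obtain ⟨l2, h2, f2, g2⟩ := hy (ε / 2) (by positivity)
    have e : (p ⊗ₜ[ℂ] (1 : B)) * (x + y) * (p ⊗ₜ 1) - stepT p (l1 ++ l2) =
        ((p ⊗ₜ[ℂ] (1 : B)) * x * (p ⊗ₜ 1) - stepT p l1) +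
        ((p ⊗ₜ[ℂ] (1 : B)) * y * (p ⊗ₜ 1) - stepT p l2) := by
      have : stepT p (l1 ++ l2) = stepT p l1 + stepT p l2 := by simp [stepT]
      rw [this, mul_add, add_mul]; abel
    refine ⟨l1 ++ l2, ?_, ?_, ?_⟩
    · intro q hq
      rcases List.mem_append.mp hq with hq | hq
      exacts [h1 q hq, h2 q hq]
    · rw [e]; exact (hf.2.1 _ _).trans (by linarith)
    · rw [e]; exact (hg.2.1 _ _).trans (by linarith)

lemma corner_le (hA : HSpan A) (hf : IsCstarNorm f) (hg : IsCstarNorm g) {p : A}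
    (hp : AbProj p) (X : A ⊗[ℂ] B) :
    f ((p ⊗ₜ 1) * X * (p ⊗ₜ 1)) ≤ g ((p ⊗ₜ 1) * X * (p ⊗ₜ 1)) := by
  apply le_of_forall_pos_le_add
  intro ε hε
  obtain ⟨l, hl, h1, h2⟩ := step_approx hA hf.1 hg.1 hp.1 X (ε / 2) (by positivity)
  have hr : ∀ q : A, IsStarProjection q → p * q = q → q * p = q := by
    intro q hq h
    have := congrArg star h
    rwa [star_mul, hq.isSelfAdjoint.star_eq, hp.1.isSelfAdjoint.star_eq] at this
  have h3 := step_le hf hg l (fun q hq => (hl q hq).1) (by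
    intro q hq q' hq'
    have h := hp.2 q.1 q'.1
    rwa [(hl q hq).2, (hl q' hq').2, hr _ (hl q hq).1 (hl q hq).2,
      hr _ (hl q' hq').1 (hl q' hq').2] at h) p hp.1 (by
    intro q hq
    show _ * _ = _ * _
    rw [hr _ (hl q hq).1 (hl q hq).2, (hl q hq).2]) 0
  simp only [TensorProduct.tmul_zero, zero_add] at h3
  have h4 := abs_le.mp (sn_abs_sub hf.1 ((p ⊗ₜ 1) * X * (p ⊗ₜ 1)) (stepT p l))
  have h5 := abs_le.mp (sn_abs_sub hg.1 ((p ⊗ₜ 1) * X * (p ⊗ₜ 1)) (stepT p l))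
  linarith

/-- sum of finitely many abelian projections -/
def FAOne (A : Type*) [Ring A] [StarRing A] : Prop :=
  ∃ (n : ℕ) (p : Fin n → A), (∀ i, AbProj (p i)) ∧ ∑ i, p i = 1

lemma cn_le_of_FA (hA : HSpan A) (hFA : FAOne A) (hf : IsCstarNorm f) (hg : IsCstarNorm g)
    (x : A ⊗[ℂ] B) : f x ≤ g x := by
  obtain ⟨n, p, hp, hsum⟩ := hFA
  refine sn_pow_trick hf.1 hg.1 (C := n * n) (fun _ => True) (fun _ _ => trivial) ?_ x trivial
  intro x _
  have h1 : ∑ i, (p i) ⊗ₜ[ℂ] (1 : B) = 1 := by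
    rw [← TensorProduct.sum_tmul, hsum]; rfl
  have hx : x = ∑ i, ∑ j, (p i ⊗ₜ[ℂ] (1 : B)) * x * (p j ⊗ₜ[ℂ] (1 : B)) := by
    have : x = (∑ i, (p i) ⊗ₜ[ℂ] (1 : B)) * x * (∑ i, (p i) ⊗ₜ[ℂ] (1 : B)) := by rw [h1]; simp
    conv_lhs => rw [this]
    rw [Finset.sum_mul, Finset.sum_mul]
    simp only [Finset.mul_sum]
  have hpr : ∀ i, IsStarProjection (p i ⊗ₜ[ℂ] (1 : B)) := by
    intro i
    refine ⟨?_, ?_⟩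
    · show _ * _ = _
      simp [(hp i).1.isIdempotentElem.eq]
    · show star _ = _
      rw [pstar_tmul, (hp i).1.isSelfAdjoint.star_eq, star_one]
  have hij : ∀ i j, f ((p i ⊗ₜ[ℂ] (1 : B)) * x * (p j ⊗ₜ[ℂ] (1 : B))) ≤ g x := by
    intro i j
    set P := p i ⊗ₜ[ℂ] (1 : B)
    set Q := p j ⊗ₜ[ℂ] (1 : B) with hQ
    have e : star (P * x * Q) * (P * x * Q) = Q * (star x * P * x) * Q := by
      rw [star_mul, star_mul, (hpr i).isSelfAdjoint.star_eq, (hpr j).isSelfAdjoint.star_eq]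
      have : P * P = P := (hpr i).isIdempotentElem.eq
      calc Q * (star x * P) * (P * x * Q) = Q * (star x * (P * P) * x) * Q := by
            simp only [mul_assoc]
        _ = _ := by rw [this]
    have h2 := corner_le hA hf hg (hp j) (star x * P * x)
    rw [← hQ, ← e, hf.1.2.2.2.2.2, hg.1.2.2.2.2.2] at h2
    have h3 : f (P * x * Q) ≤ g (P * x * Q) := by
      have := hf.1.1 (P * x * Q)
      have := hg.1.1 (P * x * Q)
      nlinarith
    have hP := sn_proj hg.1 (hpr i)
    have hQ' := sn_proj hg.1 (hpr j)
    have hP0 := hg.1.1 P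
    have hQ0 := hg.1.1 Q
    have h4 := hg.1.2.2.2.1 (P * x) Q
    have h5 := hg.1.2.2.2.1 P x
    have hx0 := hg.1.1 x
    have hx1 := hg.1.1 (P * x)
    have : g (P * x) ≤ g x := by nlinarith
    nlinarith
  calc f x ≤ ∑ i, ∑ j, f ((p i ⊗ₜ[ℂ] (1 : B)) * x * (p j ⊗ₜ[ℂ] (1 : B))) := by
        conv_lhs => rw [hx]
        exact (sn_sum hf.1 _ _).trans (Finset.sum_le_sum fun i _ => sn_sum hf.1 _ _)
    _ ≤ ∑ i : Fin n, ∑ j : Fin n, g x := Finset.sum_le_sum fun i _ => Finset.sum_le_sum fun j _ => hij i j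
    _ = n * n * g x := by simp; ring

lemma cn_eq_of_FA (hA : HSpan A) (hFA : FAOne A) (hf : IsCstarNorm f) (hg : IsCstarNorm g) : f = g :=
  funext fun x => le_antisymm (cn_le_of_FA hA hFA hf hg x) (cn_le_of_FA hA hFA hg hf x)

lemma cn_comm (hf : IsCstarNorm f) :
    IsCstarNorm (fun x : B ⊗[ℂ] A => f (TensorProduct.comm ℂ B A x)) := by
  have hm : ∀ x y : B ⊗[ℂ] A, TensorProduct.comm ℂ B A (x * y) =
      TensorProduct.comm ℂ B A x * TensorProduct.comm ℂ B A y :=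
    fun x y => map_mul (Algebra.TensorProduct.comm ℂ B A) x y
  have hs : ∀ x : B ⊗[ℂ] A, TensorProduct.comm ℂ B A (star x) = star (TensorProduct.comm ℂ B A x) := by
    intro x
    induction x using TensorProduct.induction_on with
    | zero => simp
    | tmul a b => simp
    | add x y hx hy => rw [star_add, map_add, hx, hy, map_add, star_add]
  obtain ⟨⟨h1, h2, h3, h4, h5, h6⟩, h7⟩ := hf
  refine ⟨⟨fun x => h1 _, fun x y => ?_, fun c x => ?_, fun x y => ?_, fun x => ?_, fun x => ?_⟩,
    fun x hx => ?_⟩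
  · simp only [map_add]; exact h2 _ _
  · simp only [map_smul]; exact h3 _ _
  · simp only [hm]; exact h4 _ _
  · show f (TensorProduct.comm ℂ B A (star x)) = _
    rw [hs]; exact h5 _
  · show f (TensorProduct.comm ℂ B A (star x * x)) = _
    rw [hm, hs]; exact h6 _
  · have := h7 _ hx
    simpa using this

lemma cn_eq_of_FA' (hB : HSpan B) (hFB : FAOne B) (hf : IsCstarNorm f) (hg : IsCstarNorm g) : f = g := by
  have := cn_eq_of_FA hB hFB (cn_comm hf) (cn_comm hg)
  funext x
  simpa using congrFun this (TensorProduct.comm ℂ A B x)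

end partB
end CN

namespace CN

section partA
variable {A : Type*} [CStarAlgebra A]

def RP (A : Type*) [CStarAlgebra A] : Prop :=
  ∀ x : A, ∃ e : A, IsStarProjection e ∧ e * x = x ∧ ∀ y, y * x = 0 → y * e = 0

lemma proj_comm_of_le {p q : A} (hp : IsStarProjection p) (hq : IsStarProjection q) (h : p * q = q) :
    q * p = q := by
  have := congrArg star h
  rwa [star_mul, hq.isSelfAdjoint.star_eq, hp.isSelfAdjoint.star_eq] at this

lemma proj_sub {p q : A} (hp : IsStarProjection p) (hq : IsStarProjection q) (h : p * q = q) :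
    IsStarProjection (p - q) := by
  refine ⟨?_, hp.isSelfAdjoint.sub hq.isSelfAdjoint⟩
  show _ * _ = _
  rw [sub_mul, mul_sub, mul_sub, h, proj_comm_of_le hp hq h, hp.isIdempotentElem.eq,
    hq.isIdempotentElem.eq]; simp

lemma proj_add {p q : A} (hp : IsStarProjection p) (hq : IsStarProjection q) (h : p * q = 0) :
    IsStarProjection (p + q) := by
  have h' : q * p = 0 := by
    have := congrArg star h
    rwa [star_mul, hq.isSelfAdjoint.star_eq, hp.isSelfAdjoint.star_eq, star_zero] at this
  refine ⟨?_, hp.isSelfAdjoint.add hq.isSelfAdjoint⟩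
  show _ * _ = _
  rw [add_mul, mul_add, mul_add, h, h', hp.isIdempotentElem.eq,
    hq.isIdempotentElem.eq]; simp

section spec
variable [PartialOrder A] [StarOrderedRing A]

lemma spec_sum_aux (s δ : ℝ) (hs : 0 ≤ s) (hδ : 0 < δ) (n : ℕ) :
    ∑ k ∈ Finset.range n, min (max (s - k * δ) 0) δ = min s (n * δ) := by
  induction n with
  | zero => simp [hs]
  | succ n ih =>
    rw [Finset.sum_range_succ, ih]
    push_cast
    rcases le_total s (n * δ) with h | h
    · rw [min_eq_left h, max_eq_right (by linarith), min_eq_left hδ.le, min_eq_left (by linarith)]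
      simp
    · rw [min_eq_right h, max_eq_left (by linarith), min_def, min_def]
      split_ifs <;> linarith

lemma spec_approx (hA : RP A) {p x : A} (hp : IsStarProjection p) (hx : 0 ≤ x) (hpx : p * x = x)
    {δ : ℝ} (hδ : 0 < δ) :
    ∃ w ∈ Submodule.span ℂ {q : A | IsStarProjection q ∧ p * q = q}, ‖x - w‖ ≤ δ := by
  rcases subsingleton_or_nontrivial A with hsub | hnt
  · exact ⟨0, zero_mem _, by simp [Subsingleton.elim x 0, hδ.le]⟩
  have hsa : IsSelfAdjoint x := IsSelfAdjoint.of_nonneg hx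
  have hsp : ∀ s ∈ spectrum ℝ x, 0 ≤ s := fun s hs => spectrum_nonneg_of_nonneg hx hs
  obtain ⟨N, hN⟩ := exists_nat_gt (‖x‖ / δ)
  rw [div_lt_iff₀ hδ] at hN
  let K : ℕ → A := fun k => cfc (fun s : ℝ => max (s - k * δ) 0) x
  let h : ℕ → A := fun k => cfc (fun s : ℝ => min (max (s - k * δ) 0) δ) x
  choose E hE1 hE2 hE3 using hA
  let f : ℕ → A := fun k => E (K k)
  have hfp : ∀ k, IsStarProjection (f k) := fun k => hE1 _
  have hsum : x = ∑ k ∈ Finset.range N, h k := by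
    have : ∑ k ∈ Finset.range N, h k =
        cfc (∑ k ∈ Finset.range N, fun s : ℝ => min (max (s - k * δ) 0) δ) x := by
      rw [cfc_sum (fun (k : ℕ) (s : ℝ) => min (max (s - k * δ) 0) δ) x (Finset.range N)
        (fun k _ => by fun_prop)]
    rw [this]
    conv_lhs => rw [← cfc_id ℝ x]
    apply cfc_congr
    intro s hs
    have h1 : s ≤ ‖x‖ := (le_abs_self s).trans (spectrum.norm_le_norm_of_mem hs)
    simp only [Finset.sum_apply, id]
    rw [spec_sum_aux s δ (hsp s hs) hδ, min_eq_left (by linarith)]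
  have hh0 : ∀ k, 0 ≤ h k := fun k => cfc_nonneg fun s _ => by positivity
  have hhs : ∀ k, IsSelfAdjoint (h k) := fun k => IsSelfAdjoint.of_nonneg (hh0 k)
  -- upper bound
  have hup : ∀ k, h k ≤ δ • f k := by
    intro k
    have e1 : h k = K k * cfc (fun s : ℝ => 1 / max 1 (max (s - k * δ) 0 / δ)) x := by
      have hc : Continuous (fun s : ℝ => 1 / max 1 (max (s - k * δ) 0 / δ)) := by
        refine Continuous.div (by fun_prop) (by fun_prop) ?_
        intro s
        have : (1 : ℝ) ≤ max 1 (max (s - k * δ) 0 / δ) := le_max_left _ _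
        linarith
      rw [← cfc_mul _ _ x (by fun_prop) hc.continuousOn]
      apply cfc_congr
      intro s _
      simp only
      set u := max (s - k * δ) 0
      rcases le_total u δ with hu | hu
      · rw [min_eq_left hu, max_eq_left (by rw [div_le_one hδ]; exact hu)]; simp
      · rw [min_eq_right hu, max_eq_right (by rw [one_le_div hδ]; exact hu)]
        have : 0 < u := by linarith
        field_simp
    have e2 : f k * h k = h k := by rw [e1, ← mul_assoc, hE2]
    have e3 : h k * f k = h k := by
      have := congrArg star e2
      rwa [star_mul, (hhs k).star_eq, (hfp k).isSelfAdjoint.star_eq] at this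
    have e4 : 0 ≤ algebraMap ℝ A δ - h k := by
      rw [← cfc_const δ x, ← cfc_sub _ _ x (by fun_prop) (by fun_prop)]
      exact cfc_nonneg fun s _ => by simp
    have e5 := (hfp k).isSelfAdjoint.conjugate_nonneg e4
    rw [← sub_nonneg]
    convert e5 using 1
    rw [mul_sub, sub_mul, e2, e3, Algebra.algebraMap_eq_smul_one]
    simp [(hfp k).isIdempotentElem.eq]
  have hlo : ∀ k, δ • f (k + 1) ≤ h k := by
    intro k
    have e1 : (algebraMap ℝ A δ - h k) * K (k + 1) = 0 := by
      rw [← cfc_const δ x, ← cfc_sub _ _ x (by fun_prop) (by fun_prop),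
        ← cfc_mul _ _ x (by fun_prop) (by fun_prop)]
      rw [← cfc_zero ℝ x]
      apply cfc_congr
      intro s _
      simp only [Pi.zero_apply]
      push_cast
      rcases le_total s ((k + 1) * δ) with h1 | h1
      · rw [max_eq_right (a := s - (k + 1) * δ) (by linarith)]; simp
      · rw [max_eq_left (a := s - k * δ) (by linarith), min_eq_right (by linarith)]; simp
    have e2 := hE3 _ _ e1
    change (algebraMap ℝ A δ - h k) * f (k + 1) = 0 at e2
    rw [sub_mul, sub_eq_zero, Algebra.algebraMap_eq_smul_one, smul_mul_assoc, one_mul] at e2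
    have e3 : f (k + 1) * h k = δ • f (k + 1) := by
      have := congrArg star e2
      rw [star_mul, (hhs k).star_eq, (hfp _).isSelfAdjoint.star_eq, star_smul,
        (hfp _).isSelfAdjoint.star_eq] at this
      simpa using this.symm
    have e5 := ((hfp (k + 1)).one_sub).isSelfAdjoint.conjugate_nonneg (hh0 k)
    rw [← sub_nonneg]
    convert e5 using 1
    rw [sub_mul, one_mul, e3, sub_mul, mul_sub, mul_sub, ← e2]
    simp [(hfp (k + 1)).isIdempotentElem.eq]
  refine ⟨∑ k ∈ Finset.range N, (δ : ℂ) • f (k + 1), ?_, ?_⟩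
  · refine Submodule.sum_mem _ fun k _ => Submodule.smul_mem _ _ (Submodule.subset_span ⟨hfp _, ?_⟩)
    have e1 : K (k + 1) = x * cfc (fun s : ℝ => max (s - (k + 1 : ℕ) * δ) 0 / max s ((k + 1 : ℕ) * δ)) x := by
      have ht : 0 < ((k + 1 : ℕ) : ℝ) * δ := by positivity
      have hc : Continuous (fun s : ℝ => max (s - (k + 1 : ℕ) * δ) 0 / max s ((k + 1 : ℕ) * δ)) := by
        refine Continuous.div (by fun_prop) (by fun_prop) ?_
        intro s
        have : 0 < max s ((k + 1 : ℕ) * δ) := lt_max_of_lt_right ht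
        exact this.ne'
      conv_rhs => enter [1]; rw [← cfc_id ℝ x]
      rw [← cfc_mul _ _ x (by fun_prop) hc.continuousOn]
      apply cfc_congr
      intro s _
      simp only [id]
      rcases le_total s ((k + 1 : ℕ) * δ) with h1 | h1
      · rw [max_eq_right (a := s - (k + 1 : ℕ) * δ) (by linarith)]; simp
      · rw [max_eq_left (a := s) h1]
        have : 0 < s := by linarith
        field_simp
    have e2 : (1 - p) * K (k + 1) = 0 := by rw [e1, ← mul_assoc, sub_mul, hpx]; simp
    have e3 := hE3 _ _ e2
    rw [sub_mul, one_mul, sub_eq_zero] at e3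
    exact e3.symm
  · have e0 : ∑ k ∈ Finset.range N, (δ : ℂ) • f (k + 1) = ∑ k ∈ Finset.range N, δ • f (k + 1) := by
      simp
    rw [e0]
    have h1 : 0 ≤ x - ∑ k ∈ Finset.range N, δ • f (k + 1) := by
      rw [sub_nonneg]
      conv_rhs => rw [hsum]
      exact Finset.sum_le_sum fun k _ => hlo k
    have h2 : x - ∑ k ∈ Finset.range N, δ • f (k + 1) ≤ algebraMap ℝ A δ := by
      have : x ≤ ∑ k ∈ Finset.range N, δ • f k := by
        conv_lhs => rw [hsum]
        exact Finset.sum_le_sum fun k _ => hup k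
      calc x - ∑ k ∈ Finset.range N, δ • f (k + 1)
          ≤ ∑ k ∈ Finset.range N, δ • f k - ∑ k ∈ Finset.range N, δ • f (k + 1) := by gcongr
        _ = δ • f 0 - δ • f N := by
            rw [← Finset.sum_sub_distrib]
            exact Finset.sum_range_sub' (fun k => δ • f k) N
        _ ≤ δ • f 0 := by
            rw [sub_le_self_iff]
            exact smul_nonneg hδ.le (hfp N).nonneg
        _ ≤ δ • 1 := smul_le_smul_of_nonneg_left (hfp 0).le_one hδ.le
        _ = _ := (Algebra.algebraMap_eq_smul_one δ).symm
    exact (CStarAlgebra.norm_le_iff_le_algebraMap _ hδ.le h1).mpr h2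

end spec

lemma hspan_of_RP (hA : RP A) : HSpan A := by
  let _ := CStarAlgebra.spectralOrder A
  have _ := CStarAlgebra.spectralOrderedRing A
  intro p hp x
  set S := Submodule.span ℂ {q : A | IsStarProjection q ∧ p * q = q}
  rw [← Submodule.topologicalClosure_coe]
  show p * x * p ∈ S.topologicalClosure
  have hx : x ∈ Submodule.span ℂ {a : A | 0 ≤ a} := by rw [CStarAlgebra.span_nonneg]; trivial
  induction hx using Submodule.span_induction with
  | mem x h =>
    show p * x * p ∈ closure (S : Set A)
    rw [Metric.mem_closure_iff]
    intro ε hε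
    have h1 : 0 ≤ p * x * p := hp.isSelfAdjoint.conjugate_nonneg h
    obtain ⟨w, hw, hd⟩ := spec_approx hA hp h1 (by rw [← mul_assoc, ← mul_assoc, hp.isIdempotentElem.eq])
      (half_pos hε)
    exact ⟨w, hw, by rw [dist_eq_norm]; linarith⟩
  | zero => simp
  | add x y _ _ hx hy => rw [mul_add, add_mul]; exact add_mem hx hy
  | smul c x _ hx =>
    rw [mul_smul_comm, smul_mul_assoc]; exact Submodule.smul_mem _ _ hx

lemma cut (hA : RP A) {p q x : A} (hx : x ≠ 0) (hxp : x * p = x) (hqx : q * x = x)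
    (hp : IsStarProjection p) :
    ∃ v e : A, IsStarProjection e ∧ e ≠ 0 ∧ star v * v = e ∧ p * e = e ∧ q * v = v ∧ v * e = v := by
  have hA0 : Nontrivial A := ⟨⟨x, 0, hx⟩⟩
  set y := star x * x with hy
  have hsa : IsSelfAdjoint y := IsSelfAdjoint.star_mul_self x
  have hy0 : 0 < ‖y‖ := by
    rw [hy, CStarRing.norm_star_mul_self]
    have := norm_pos_iff.mpr hx
    positivity
  have hsp : ∀ s ∈ spectrum ℝ y, 0 ≤ s := fun s hs => spectrum_star_mul_self_nonneg s hs
  set t := ‖y‖ / 2 with ht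
  have ht0 : 0 < t := by positivity
  have hspec : ‖y‖ ∈ spectrum ℝ y := by
    obtain ⟨⟨s, hs, hse⟩, -⟩ := IsometricContinuousFunctionalCalculus.isGreatest_norm_spectrum (𝕜 := ℝ) y
    simp only at hse
    rw [Real.norm_of_nonneg (hsp s hs)] at hse
    rwa [← hse]
  have hm : ∀ s : ℝ, 0 < max s t := fun s => lt_max_of_lt_right ht0
  set k := cfc (fun s : ℝ => max (s - t) 0) y with hk
  have hk0 : k ≠ 0 := by
    intro hk0
    have := norm_apply_le_norm_cfc (fun s : ℝ => max (s - t) 0) y hspec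
    change _ ≤ ‖k‖ at this
    rw [hk0, norm_zero] at this
    have h2 : 0 < max (‖y‖ - t) 0 := lt_max_of_lt_left (by linarith)
    rw [Real.norm_of_nonneg h2.le] at this
    linarith
  obtain ⟨e, he, hek, hee⟩ := hA k
  have hc1 : Continuous (fun s : ℝ => 1 / √(max s t)) := by
    refine Continuous.div (by fun_prop) (by fun_prop) ?_
    intro s
    exact (Real.sqrt_pos.mpr (hm s)).ne'
  have hc2 : Continuous (fun s : ℝ => max (s - t) 0 / max s t) :=
    Continuous.div (by fun_prop) (by fun_prop) fun s => (hm s).ne'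
  set r := cfc (fun s : ℝ => 1 / √(max s t)) y with hr
  have hrs : IsSelfAdjoint r := cfc_predicate _ y
  have e1 : (1 - r * y * r) * k = 0 := by
    have : r * y * r = cfc (fun s : ℝ => 1 / √(max s t) * s * (1 / √(max s t))) y := by
      rw [cfc_mul _ _ y (by fun_prop) hc1.continuousOn, cfc_mul _ _ y hc1.continuousOn (by fun_prop),
        cfc_id' ℝ y]
    rw [this, ← cfc_const_one ℝ y, ← cfc_sub _ _ y (by fun_prop) (by fun_prop),
      ← cfc_mul _ _ y (by fun_prop) (by fun_prop), ← cfc_zero ℝ y]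
    apply cfc_congr
    intro s _
    simp only [Pi.zero_apply]
    rcases le_total s t with h | h
    · rw [max_eq_right (a := s - t) (by linarith)]; simp
    · rw [max_eq_left h]
      have hs : 0 < s := by linarith
      have : √s * √s = s := Real.mul_self_sqrt hs.le
      have hs' := Real.sqrt_pos.mpr hs
      have : 1 / √s * s * (1 / √s) = 1 := by
        field_simp
        nlinarith
      rw [this]; simp
  have e2 := hee _ e1
  rw [sub_mul, one_mul, sub_eq_zero] at e2
  have e3 : (1 - p) * k = 0 := by
    have h1 : k = y * cfc (fun s : ℝ => max (s - t) 0 / max s t) y := by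
      conv_rhs => enter [1]; rw [← cfc_id ℝ y]
      rw [← cfc_mul _ _ y (by fun_prop) hc2.continuousOn]
      apply cfc_congr
      intro s _
      simp only [id]
      rcases le_total s t with h1 | h1
      · rw [max_eq_right (a := s - t) (by linarith)]; simp
      · rw [max_eq_left (a := s) h1]
        have : 0 < s := by linarith
        field_simp
    have h2 : p * y = y := by
      have := congrArg star hxp
      rw [star_mul, hp.isSelfAdjoint.star_eq] at this
      rw [hy, ← mul_assoc, this]
    rw [h1, ← mul_assoc, sub_mul, h2]; simp
  have e4 := hee _ e3
  rw [sub_mul, one_mul, sub_eq_zero] at e4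
  refine ⟨x * r * e, e, he, ?_, ?_, e4.symm, ?_, ?_⟩
  · rintro rfl
    rw [zero_mul] at hek
    exact hk0 hek.symm
  · rw [star_mul, star_mul, he.isSelfAdjoint.star_eq, hrs.star_eq]
    calc e * (r * star x) * (x * r * e) = e * (r * (star x * x) * r * e) := by simp only [mul_assoc]
      _ = e := by rw [← hy, ← e2, he.isIdempotentElem.eq]
  · rw [← mul_assoc, ← mul_assoc, hqx]
  · rw [mul_assoc, he.isIdempotentElem.eq]

lemma nonab (hA : RP A) {e : A} (he : IsStarProjection e) (hna : ¬ AbProj e) :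
    ∃ w a : A, IsStarProjection a ∧ a ≠ 0 ∧ star w * w = a ∧ e * a = a ∧ e * w = w ∧ w * a = w ∧
      a * w = 0 := by
  have hS := hspan_of_RP hA
  have h1 : ∃ f y : A, IsStarProjection f ∧ e * f = f ∧ f * (e * y * e) ≠ (e * y * e) * f := by
    by_contra hcon
    push Not at hcon
    apply hna
    refine ⟨he, fun x y => ?_⟩
    have hx := hS e he x
    have hcl : IsClosed {z : A | z * (e * y * e) = (e * y * e) * z} :=
      isClosed_eq (by fun_prop) (by fun_prop)
    refine closure_minimal ?_ hcl hx
    intro z hz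
    show z * (e * y * e) = (e * y * e) * z
    have hz' : z ∈ Submodule.span ℂ {q : A | IsStarProjection q ∧ e * q = q} := hz
    induction hz' using Submodule.span_induction with
    | mem q hq => exact hcon q y hq.1 hq.2
    | zero => simp
    | add a b ha' hb' ha hb => rw [add_mul, mul_add, ha ha', hb hb']
    | smul c a ha' ha => rw [smul_mul_assoc, mul_smul_comm, ha ha']
  obtain ⟨f, y, hf, hef, hne⟩ := h1
  have hfe := proj_comm_of_le he hf hef
  have hg : IsStarProjection (e - f) := proj_sub he hf hef
  set z := e * y * e with hz
  have hez : e * z = z := by rw [hz, ← mul_assoc, ← mul_assoc, he.isIdempotentElem.eq]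
  have hze : z * e = z := by rw [hz, mul_assoc, he.isIdempotentElem.eq]
  have hff := hf.isIdempotentElem.eq
  have hee := he.isIdempotentElem.eq
  have key : ∀ p q : A, IsStarProjection p → IsStarProjection q → p * q = 0 → e * p = p → e * q = q →
      q * z * p ≠ 0 → ∃ w a : A, IsStarProjection a ∧ a ≠ 0 ∧ star w * w = a ∧ e * a = a ∧ e * w = w ∧
      w * a = w ∧ a * w = 0 := by
    intro p q hp hq hpq hep heq hne
    obtain ⟨w, a, ha, ha0, hw, hpa, hqw, hwa⟩ := cut hA hne (by rw [mul_assoc, hp.isIdempotentElem.eq])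
      (q := q) (by rw [← mul_assoc, ← mul_assoc, hq.isIdempotentElem.eq]) hp
    refine ⟨w, a, ha, ha0, hw, ?_, ?_, hwa, ?_⟩
    · rw [← hpa, ← mul_assoc, hep]
    · rw [← hqw, ← mul_assoc, heq]
    · have : a * p = a := proj_comm_of_le hp ha hpa
      rw [← hqw, ← mul_assoc, ← this, mul_assoc a, hpq]; simp
  by_cases h2 : f * z * (e - f) = 0
  · by_cases h3 : (e - f) * z * f = 0
    · exfalso
      apply hne
      rw [mul_sub, mul_assoc f z e, hze, sub_eq_zero] at h2
      rw [sub_mul, sub_mul, hez, sub_eq_zero] at h3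
      rw [h2, h3]
    · exact key f (e - f) hf hg (by rw [mul_sub, hfe, hff, sub_self]) hef
        (by rw [mul_sub, hee, hef]) h3
  · exact key (e - f) f hg hf (by rw [sub_mul, hef, hff, sub_self]) (by rw [mul_sub, hee, hef]) hef h2

/-- `n` equivalent orthogonal non-zero projections under `p` -/
def BIG (p : A) (n : ℕ) : Prop := ∃ (e : A) (v : Fin n → A), IsStarProjection e ∧ e ≠ 0 ∧
  (∀ i j, star (v i) * v j = if i = j then e else 0) ∧ (∀ i, p * v i = v i) ∧ ∀ i, v i * e = v i

lemma BIG.mono {p q : A} {n : ℕ} (h : BIG p n) (hqp : q * p = p) : BIG q n := by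
  obtain ⟨e, v, h1, h2, h3, h4, h5⟩ := h
  exact ⟨e, v, h1, h2, h3, fun i => by rw [← h4 i, ← mul_assoc, hqp], h5⟩

lemma big_add {p e a w : A} {n : ℕ} {v : Fin n → A} (he : IsStarProjection e) (ha : IsStarProjection a)
    (ha0 : a ≠ 0) (hea : e * a = a) (hv : ∀ i j, star (v i) * v j = if i = j then e else 0)
    (hpv : ∀ i, p * v i = v i) (hpw : p * w = w) (hw : star w * w = a) (hwa : w * a = w)
    (hvw : ∀ i, a * star (v i) * w = 0) : BIG p (n + 1) := by
  have has := ha.isSelfAdjoint.star_eq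
  have hwv : ∀ i, star w * (v i * a) = 0 := by
    intro i
    have := congrArg star (hvw i)
    simpa [has, mul_assoc] using this
  refine ⟨a, Fin.cons w (fun i => v i * a), ha, ha0, ?_, ?_, ?_⟩
  · intro i j
    refine Fin.cases ?_ (fun i => ?_) i <;> refine Fin.cases ?_ (fun j => ?_) j
    · simp [hw]
    · simp [hwv, (Fin.succ_ne_zero j).symm]
    · simp [hvw, has, Fin.succ_ne_zero i]
    · simp only [Fin.cons_succ, star_mul, has, Fin.succ_inj]
      calc a * star (v i) * (v j * a) = a * (star (v i) * v j) * a := by simp only [mul_assoc]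
        _ = _ := by
          rw [hv]
          split_ifs
          · rw [mul_assoc, hea, ha.isIdempotentElem.eq]
          · simp
  · intro i
    refine Fin.cases ?_ (fun i => ?_) i
    · simpa using hpw
    · simp only [Fin.cons_succ]; rw [← mul_assoc, hpv]
  · intro i
    refine Fin.cases ?_ (fun i => ?_) i
    · simpa using hwa
    · simp only [Fin.cons_succ]; rw [mul_assoc, ha.isIdempotentElem.eq]

lemma big_normalize {p : A} {n : ℕ} (h : BIG p (n + 1)) : ∃ (e : A) (v : Fin (n + 1) → A),
    IsStarProjection e ∧ e ≠ 0 ∧ p * e = e ∧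
    (∀ i j, star (v i) * v j = if i = j then e else 0) ∧ (∀ i, p * v i = v i) ∧ ∀ i, v i * e = v i := by
  obtain ⟨e, v, he, he0, hv, hpv, hve⟩ := h
  have h00 : star (v 0) * v 0 = e := by simpa using hv 0 0
  have hev : e * star (v 0) = star (v 0) := by
    have := congrArg star (hve 0)
    rwa [star_mul, he.isSelfAdjoint.star_eq] at this
  have hid : v 0 * star (v 0) * (v 0 * star (v 0)) = v 0 * star (v 0) := by
    calc v 0 * star (v 0) * (v 0 * star (v 0)) = v 0 * (star (v 0) * v 0 * star (v 0)) := by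
          simp only [mul_assoc]
      _ = _ := by rw [h00, hev]
  refine ⟨v 0 * star (v 0), fun i => v i * star (v 0), ⟨hid, by simp [IsSelfAdjoint]⟩, ?_, ?_, ?_, ?_, ?_⟩
  · intro h0
    apply he0
    have : e = star (v 0) * (v 0 * star (v 0)) * v 0 := by
      calc e = e * e := he.isIdempotentElem.eq.symm
        _ = _ := by nth_rw 1 2 [← h00]; simp only [mul_assoc]
    rw [this, h0]; simp
  · rw [← mul_assoc, hpv]
  · intro i j
    simp only [star_mul, star_star]
    calc v 0 * star (v i) * (v j * star (v 0)) = v 0 * (star (v i) * v j) * star (v 0) := by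
          simp only [mul_assoc]
      _ = _ := by
        rw [hv]
        split_ifs
        · rw [hve]
        · simp
  · intro i
    rw [← mul_assoc, hpv]
  · intro i
    calc v i * star (v 0) * (v 0 * star (v 0)) = v i * (star (v 0) * v 0 * star (v 0)) := by
          simp only [mul_assoc]
      _ = _ := by rw [h00, hev]

lemma big_one {p : A} (hp : IsStarProjection p) (h0 : p ≠ 0) : BIG p 1 :=
  ⟨p, fun _ => p, hp, h0, fun i j => by
    rw [if_pos (Subsingleton.elim i j), hp.isSelfAdjoint.star_eq, hp.isIdempotentElem.eq],
    fun _ => hp.isIdempotentElem.eq, fun _ => hp.isIdempotentElem.eq⟩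

lemma halve (hA : RP A) {p : A} (hp : IsStarProjection p) (h0 : p ≠ 0)
    (hn : ∀ q : A, IsStarProjection q → p * q = q → q ≠ 0 → ¬ AbProj q) : ∀ n, BIG p (n + 1) := by
  intro n
  induction n with
  | zero => exact big_one hp h0
  | succ n ih =>
    obtain ⟨e, v, he, he0, hpe, hv, hpv, hve⟩ := big_normalize ih
    obtain ⟨w, a, ha, ha0, hw, hea, hew, hwa, haw⟩ := nonab hA he (hn e he hpe he0)
    refine big_add he ha ha0 hea hv hpv (w := v 0 * w) ?_ ?_ ?_ ?_
    · rw [← mul_assoc, hpv]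
    · rw [star_mul]
      calc star w * star (v 0) * (v 0 * w) = star w * (star (v 0) * v 0) * w := by simp only [mul_assoc]
        _ = a := by rw [hv]; simp [mul_assoc, hew, hw]
    · rw [mul_assoc, hwa]
    · intro i
      calc a * star (v i) * (v 0 * w) = a * (star (v i) * v 0) * w := by simp only [mul_assoc]
        _ = 0 := by
          rw [hv]
          split_ifs
          · rw [mul_assoc, hew, haw]
          · simp

/-- chains of abelian projections are bounded -/
def CHab (A : Type*) [CStarAlgebra A] : Prop :=
  ∀ p : A, IsStarProjection p → ∀ C : Set A, (∀ q ∈ C, AbProj q ∧ p * q = q) →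
    IsChain (fun q q' => q' * q = q) C → ∃ s, AbProj s ∧ p * s = s ∧ ∀ q ∈ C, s * q = q

/-- finite sums of abelian projections -/
def FA (p : A) : Prop := ∃ (n : ℕ) (q : Fin n → A), (∀ i, AbProj (q i)) ∧ ∑ i, q i = p

lemma FA.add {p q : A} (hp : FA p) (hq : FA q) : FA (p + q) := by
  obtain ⟨n, a, ha, rfl⟩ := hp
  obtain ⟨m, b, hb, rfl⟩ := hq
  refine ⟨n + m, Fin.append a b, ?_, by simp [Fin.sum_univ_add]⟩
  intro i
  refine Fin.addCases (fun i => ?_) (fun i => ?_) i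
  · simpa using ha i
  · simpa using hb i

lemma FA_of_ab {p : A} (hp : AbProj p) : FA p := ⟨1, fun _ => p, fun _ => hp, by simp⟩

lemma exists_max_ab (hC : CHab A) {p : A} (hp : IsStarProjection p) :
    ∃ m, AbProj m ∧ p * m = m ∧ ∀ q, AbProj q → p * q = q → q * m = m → q = m := by
  obtain ⟨m, hm⟩ := exists_maximal_of_chains_bounded
    (α := {q : A // AbProj q ∧ p * q = q}) (r := fun q q' => q'.1 * q.1 = q.1) (by
      intro C hCc
      obtain ⟨s, hs, hps, hsC⟩ := hC p hp (Subtype.val '' C) (by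
        rintro _ ⟨q, _, rfl⟩
        exact q.2) (by
        rintro _ ⟨q, hq, rfl⟩ _ ⟨q', hq', rfl⟩ hne
        exact hCc hq hq' (fun h => hne (by rw [h])))
      exact ⟨⟨s, hs, hps⟩, fun q hq => hsC _ ⟨q, hq, rfl⟩⟩) (by
      intro a b c hab hbc
      rw [← hab, ← mul_assoc, hbc])
  refine ⟨m.1, m.2.1, m.2.2, fun q hq hpq hqm => ?_⟩
  have h1 := hm ⟨q, hq, hpq⟩ hqm
  simp only at h1
  rw [← proj_comm_of_le m.2.1.1 hq.1 h1]
  exact hqm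

lemma FA_of_not_big (hA : RP A) (hC : CHab A) : ∀ (n : ℕ) (p : A), IsStarProjection p →
    ¬ BIG p (n + 1) → FA p := by
  intro n
  induction n with
  | zero =>
    intro p hp h
    by_cases h0 : p = 0
    · exact ⟨0, fun _ => 0, fun i => i.elim0, by simp [h0]⟩
    · exact absurd (big_one hp h0) h
  | succ n ih =>
    intro p hp h
    obtain ⟨m, hm, hpm, hmax⟩ := exists_max_ab hC hp
    have hmp := proj_comm_of_le hp hm.1 hpm
    have hr : IsStarProjection (p - m) := proj_sub hp hm.1 hpm
    have hpr : p * (p - m) = p - m := by rw [mul_sub, hp.isIdempotentElem.eq, hpm]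
    have hmr : m * (p - m) = 0 := by rw [mul_sub, hmp, hm.1.isIdempotentElem.eq, sub_self]
    have hrm : (p - m) * m = 0 := by rw [sub_mul, hpm, hm.1.isIdempotentElem.eq, sub_self]
    have key : FA (p - m) := by
      apply ih _ hr
      intro hbig
      obtain ⟨e, v, he, he0, hre, hv, hrv, hve⟩ := big_normalize hbig
      have hpe : p * e = e := by rw [← hre, ← mul_assoc, hpr]
      by_cases hx : ∃ x, m * x * e ≠ 0
      · obtain ⟨x, hx⟩ := hx
        obtain ⟨w, a, ha, ha0, hw, hea, hmw, hwa⟩ := cut hA hx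
          (by rw [mul_assoc, he.isIdempotentElem.eq]) (q := m)
          (by rw [← mul_assoc, ← mul_assoc, hm.1.isIdempotentElem.eq]) he
        apply h
        refine big_add he ha ha0 hea hv (p := p) (w := w) ?_ ?_ hw hwa ?_
        · intro i
          rw [← hrv i, ← mul_assoc, hpr]
        · rw [← hmw, ← mul_assoc, hpm]
        · intro i
          rw [← hmw, ← hrv i, star_mul, hr.isSelfAdjoint.star_eq]
          calc a * (star (v i) * (p - m)) * (m * w) = a * star (v i) * ((p - m) * m) * w := by
                simp only [mul_assoc]
            _ = 0 := by rw [hrm]; simp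
      · push Not at hx
        apply h
        refine BIG.mono (halve hA he he0 ?_ (n + 1)) hpe
        intro q hq heq hq0 hqab
        have hqe := proj_comm_of_le he hq heq
        have hmxq : ∀ x, m * x * q = 0 := by
          intro x
          rw [← heq, ← mul_assoc, hx x, zero_mul]
        have hqxm : ∀ x, q * x * m = 0 := by
          intro x
          have := congrArg star (hmxq (star x))
          simpa [mul_assoc, hq.isSelfAdjoint.star_eq, hm.1.isSelfAdjoint.star_eq] using this
        have hmq : m * q = 0 := by simpa using hmxq 1
        have hqm : q * m = 0 := by simpa using hqxm 1
        have hqp : p * q = q := by rw [← heq, ← mul_assoc, hpe]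
        have h1 : AbProj (m + q) := by
          refine ⟨proj_add hm.1 hq hmq, fun x y => ?_⟩
          have e1 : ∀ x, (m + q) * x * (m + q) = m * x * m + q * x * q := by
            intro x
            rw [add_mul, add_mul, mul_add, mul_add, hmxq, hqxm]; simp
          have e2 : ∀ x y, (m * x * m) * (q * y * q) = 0 := by
            intro x y
            calc (m * x * m) * (q * y * q) = m * x * (m * q) * y * q := by simp only [mul_assoc]
              _ = 0 := by rw [hmq]; simp
          have e3 : ∀ x y, (q * x * q) * (m * y * m) = 0 := by
            intro x y
            calc (q * x * q) * (m * y * m) = q * x * (q * m) * y * m := by simp only [mul_assoc]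
              _ = 0 := by rw [hqm]; simp
          rw [e1, e1, add_mul, mul_add, mul_add, add_mul, mul_add, mul_add, e2, e3, e2, e3,
            hm.2 x y, hqab.2 x y]
        have h2 := hmax (m + q) h1 (by rw [mul_add, hpm, hqp]) (by
          rw [add_mul, hm.1.isIdempotentElem.eq, hqm, add_zero])
        exact hq0 (by simpa using h2)
    have := key.add (FA_of_ab hm)
    simpa using this

lemma big_of_not_FA (hA : RP A) (hC : CHab A) {p : A} (hp : IsStarProjection p) (h : ¬ FA p) (n : ℕ) :
    BIG p (n + 1) := by
  by_contra hb
  exact h (FA_of_not_big hA hC n p hp hb)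

lemma split_not_FA (hA : RP A) (hC : CHab A) {p : A} (hp : IsStarProjection p) (h : ¬ FA p) (n : ℕ) :
    ∃ p', IsStarProjection p' ∧ p * p' = p' ∧ ¬ FA p' ∧ BIG (p - p') (n + 1) := by
  obtain ⟨e, v, he, he0, hv, hpv, hve⟩ := big_of_not_FA hA hC hp h ((n + 1) + n)
  change Fin ((n + 1) + (n + 1)) → A at v
  have hes := he.isSelfAdjoint.star_eq
  set q := ∑ i : Fin (n + 1), v (Fin.castAdd (n + 1) i) * star (v (Fin.castAdd (n + 1) i)) with hq
  have hqv1 : ∀ i, q * v (Fin.castAdd (n + 1) i) = v (Fin.castAdd (n + 1) i) := by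
    intro i
    rw [hq, Finset.sum_mul, Finset.sum_eq_single i]
    · rw [mul_assoc, hv]; simp [hve]
    · intro j _ hj
      rw [mul_assoc, hv, if_neg (by simpa using hj), mul_zero]
    · simp
  have hqv2 : ∀ i, q * v (Fin.natAdd (n + 1) i) = 0 := by
    intro i
    rw [hq, Finset.sum_mul]
    apply Finset.sum_eq_zero
    intro j _
    rw [mul_assoc, hv, if_neg (by simp [Fin.ext_iff]; omega), mul_zero]
  have hqp : IsStarProjection q := by
    refine ⟨?_, ?_⟩
    · show q * q = q
      conv_lhs => enter [2]; rw [hq]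
      rw [Finset.mul_sum, hq]
      exact Finset.sum_congr rfl fun i _ => by rw [← mul_assoc, ← hq, hqv1]
    · show star q = q
      rw [hq]; simp
  have hpq : p * q = q := by
    rw [hq, Finset.mul_sum]
    exact Finset.sum_congr rfl fun i _ => by rw [← mul_assoc, hpv]
  have hr : IsStarProjection (p - q) := proj_sub hp hqp hpq
  by_cases hF : FA q
  · refine ⟨p - q, hr, by rw [mul_sub, hp.isIdempotentElem.eq, hpq], ?_, ?_⟩
    · intro h2
      exact h (by simpa using h2.add hF)
    · rw [sub_sub_cancel]
      exact ⟨e, fun i => v (Fin.castAdd (n + 1) i), he, he0, fun i j => by simp [hv], hqv1, fun i => hve _⟩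
  · refine ⟨q, hqp, hpq, hF, ?_⟩
    refine ⟨e, fun i => v (Fin.natAdd (n + 1) i), he, he0, fun i j => by simp [hv], fun i => ?_, fun i => hve _⟩
    rw [sub_mul, hpv, hqv2, sub_zero]

lemma blocks_of_not_FA (hA : RP A) (hC : CHab A) (h : ¬ FAOne A) (n : ℕ → ℕ) :
    ∃ (e : ℕ → A) (v : (k : ℕ) → Fin (n k + 1) → A), (∀ k, IsStarProjection (e k)) ∧ (∀ k, e k ≠ 0) ∧
      (∀ k i j, star (v k i) * v k j = if i = j then e k else 0) ∧
      (∀ k l i j, k ≠ l → star (v k i) * v l j = 0) ∧ ∀ k i, v k i * e k = v k i := by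
  choose! nxt h1 h2 h3 h4 using fun (p : {p : A // IsStarProjection p ∧ ¬ FA p}) (n : ℕ) =>
    split_not_FA hA hC p.2.1 p.2.2 n
  let P : ℕ → {p : A // IsStarProjection p ∧ ¬ FA p} := fun k =>
    Nat.rec ⟨1, IsStarProjection.one A, h⟩ (fun k p => ⟨nxt p (n k), h1 p (n k), h3 p (n k)⟩) k
  have hP : ∀ k, (P (k + 1)).1 = nxt (P k) (n k) := fun k => rfl
  have hle : ∀ k l, k ≤ l → (P k).1 * (P l).1 = (P l).1 := by
    intro k l hkl
    induction l, hkl using Nat.le_induction with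
    | base => exact (P k).2.1.isIdempotentElem.eq
    | succ l hl ih =>
      have := h2 (P l) (n l)
      rw [← hP] at this
      rw [← this, ← mul_assoc, ih]
  have hb : ∀ k, BIG ((P k).1 - (P (k + 1)).1) (n k + 1) := fun k => by rw [hP]; exact h4 _ _
  choose e v hv1 hv2 hv3 hv4 hv5 using hb
  have hlt : ∀ k l i j, k < l → star (v k i) * v l j = 0 := by
    intro k l i j hkl
    have a1 : (P l).1 * v l j = v l j := by
      rw [← hv4 l j, ← mul_assoc, mul_sub, hle l l le_rfl, hle l (l + 1) (by omega)]
    have a2 : star (v k i) * ((P k).1 - (P (k + 1)).1) = star (v k i) := by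
      have := congrArg star (hv4 k i)
      rwa [star_mul, ((P k).2.1.isSelfAdjoint.sub (P (k + 1)).2.1.isSelfAdjoint).star_eq] at this
    rw [← a1, ← a2, ← mul_assoc, mul_assoc (star (v k i)), sub_mul, hle k l hkl.le, hle (k + 1) l hkl]
    simp
  refine ⟨e, v, hv1, hv2, hv3, ?_, hv5⟩
  intro k l i j hkl
  rcases lt_or_gt_of_ne hkl with hlt' | hlt'
  · exact hlt k l i j hlt'
  · have := congrArg star (hlt l k j i hlt')
    simpa using this

end partA
end CN

namespace CN

section vn
variable {H : Type*} [NormedAddCommGroup H] [InnerProductSpace ℂ H] [CompleteSpace H]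

lemma vn_isClosed (M : VonNeumannAlgebra H) :
    IsClosed (M.toStarSubalgebra : Set (H →L[ℂ] H)) := by
  have h := M.centralizer_centralizer
  have : (M.toStarSubalgebra : Set (H →L[ℂ] H)) = Set.centralizer (Set.centralizer (M : Set (H →L[ℂ] H))) := by
    rw [h]; rfl
  rw [this]
  exact Set.isClosed_centralizer _

/-- the C*-algebra structure of a von Neumann algebra -/
noncomputable scoped instance vnC (M : VonNeumannAlgebra H) : CStarAlgebra ↥M.toStarSubalgebra :=
  StarSubalgebra.cstarAlgebra M.toStarSubalgebra (h_closed := vn_isClosed M)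

lemma mem_of_comm (M : VonNeumannAlgebra H) (x : H →L[ℂ] H) (h : ∀ y ∈ M.commutant, y * x = x * y) :
    x ∈ M.toStarSubalgebra := by
  have : x ∈ M.commutant.commutant := VonNeumannAlgebra.mem_commutant_iff.2 h
  rw [VonNeumannAlgebra.commutant_commutant] at this
  exact this

/-- range projections for sets of elements -/
def RPF (A : Type*) [Ring A] [StarRing A] : Prop :=
  ∀ X : Set A, ∃ e : A, IsStarProjection e ∧ (∀ x ∈ X, e * x = x) ∧ ∀ y, (∀ x ∈ X, y * x = 0) → y * e = 0

lemma vn_RPF (M : VonNeumannAlgebra H) : RPF ↥M.toStarSubalgebra := by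
  intro X
  set K0 : Submodule ℂ H := Submodule.span ℂ {w | ∃ x ∈ X, ∃ ξ, w = (x : H →L[ℂ] H) ξ} with hK0
  set K : Submodule ℂ H := K0.topologicalClosure with hK
  have : CompleteSpace K := (Submodule.isClosed_topologicalClosure K0).completeSpace_coe
  have hp : IsStarProjection K.starProjection := isStarProjection_starProjection
  have hmem : K.starProjection ∈ M := by
    rw [VonNeumannAlgebra.IsStarProjection.mem_iff hp]
    intro y hy
    have h1 : K0 ≤ K0.comap (y : H →ₗ[ℂ] H) := by
      rw [hK0, Submodule.span_le]
      rintro w ⟨x, hx, ξ, rfl⟩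
      apply Submodule.subset_span
      refine ⟨x, hx, y ξ, ?_⟩
      have := VonNeumannAlgebra.mem_commutant_iff.1 hy x x.2
      exact (DFunLike.congr_fun this ξ).symm
    have h2 : K ≤ K.comap (y : H →ₗ[ℂ] H) := by
      intro w hw
      have : Set.MapsTo y (K0 : Set H) (K0 : Set H) := fun z hz => h1 hz
      exact this.closure y.continuous hw
    rw [Submodule.range_starProjection]
    exact h2
  have hK1 : ∀ x ∈ X, ∀ ξ, (x : H →L[ℂ] H) ξ ∈ K := fun x hx ξ =>
    Submodule.le_topologicalClosure _ (Submodule.subset_span ⟨x, hx, ξ, rfl⟩)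
  refine ⟨⟨K.starProjection, hmem⟩, ⟨?_, ?_⟩, ?_, ?_⟩
  · exact Subtype.ext hp.1
  · exact Subtype.ext hp.2
  · intro x hx
    ext ξ
    exact Submodule.starProjection_eq_self_iff.2 (hK1 x hx ξ)
  · intro y hy
    have h1 : K ≤ LinearMap.ker ((y : H →L[ℂ] H) : H →ₗ[ℂ] H) := by
      apply Submodule.topologicalClosure_minimal
      · rw [hK0, Submodule.span_le]
        rintro w ⟨x, hx, ξ, rfl⟩
        have := congrArg Subtype.val (hy x hx)
        exact DFunLike.congr_fun this ξ
      · exact ContinuousLinearMap.isClosed_ker (y : H →L[ℂ] H)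
    ext ξ
    exact h1 (Submodule.starProjection_apply_mem K ξ)

lemma RP_of_RPF {A : Type*} [CStarAlgebra A] (h : RPF A) : RP A := by
  intro x
  obtain ⟨e, he, h1, h2⟩ := h {x}
  exact ⟨e, he, h1 x rfl, fun y hy => h2 y (by simpa using hy)⟩

lemma CHab_of_RPF {A : Type*} [CStarAlgebra A] (h : RPF A) : CHab A := by
  intro p hp C hC hch
  obtain ⟨s, hs, h1, h2⟩ := h C
  have hps : p * s = s := by
    have := h2 (1 - p) (fun q hq => by rw [sub_mul, one_mul, (hC q hq).2, sub_self])
    rw [sub_mul, one_mul, sub_eq_zero] at this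
    exact this.symm
  have h3 : ∀ y, (∀ q ∈ C, q * y = 0) → s * y = 0 := by
    intro y hy
    have := h2 (star y) (fun q hq => by
      have := congrArg star (hy q hq)
      rwa [star_mul, (hC q hq).1.1.2.star_eq, star_zero] at this)
    have := congrArg star this
    rwa [star_mul, star_star, hs.2.star_eq, star_zero] at this
  have key : ∀ q ∈ C, ∀ r ∈ C, r * q = q → ∀ y, r * y * q = q * y * q := by
    intro q hq r hr hrq y
    have hqr : q * r = q := by
      have := congrArg star hrq
      rwa [star_mul, (hC q hq).1.1.2.star_eq, (hC r hr).1.1.2.star_eq] at this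
    have := (hC r hr).1.2 y q
    have e1 : r * q * r = q := by rw [hrq, hqr]
    rw [e1] at this
    have := congrArg (· * q) this
    simp only [mul_assoc, (hC q hq).1.1.1.eq, hrq] at this
    simp only [← mul_assoc, hqr] at this
    exact this
  have key2 : ∀ q ∈ C, ∀ y, s * y * q = q * y * q := by
    intro q hq y
    have := h3 (y * q - q * y * q) (fun r hr => by
      by_cases hrq : r = q
      · subst hrq
        rw [mul_sub, ← mul_assoc, ← mul_assoc, ← mul_assoc, (hC r hr).1.1.1.eq, sub_self]
      · rcases hch hr hq hrq with h | h
        · -- q * r = r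
          have hqr : r * q = r := by
            have := congrArg star h
            rwa [star_mul, (hC q hq).1.1.2.star_eq, (hC r hr).1.1.2.star_eq] at this
          rw [mul_sub, ← mul_assoc, ← mul_assoc, ← mul_assoc, hqr, sub_self]
        · rw [mul_sub, ← mul_assoc, key q hq r hr h, ← mul_assoc, ← mul_assoc, h, sub_self])
    rw [mul_sub, sub_eq_zero, ← mul_assoc, ← mul_assoc, ← mul_assoc, h1 q hq] at this
    exact this
  have key3 : ∀ x y q, q ∈ C → s * x * s * y * q = q * x * q * y * q := by
    intro x y q hq
    calc s * x * s * y * q = s * x * (s * y * q) := by simp only [mul_assoc]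
      _ = (s * x * q) * (y * q) := by rw [key2 q hq]; simp only [mul_assoc]
      _ = _ := by rw [key2 q hq]; simp only [mul_assoc]
  refine ⟨s, ⟨hs, fun x y => ?_⟩, hps, h1⟩
  have hz := h2 (s * x * s * y - s * y * s * x) (fun q hq => by
    rw [sub_mul, key3 x y q hq, key3 y x q hq]
    have := (hC q hq).1.2 x y
    have hqq : ∀ z, q * (q * z) = q * z := fun z => by rw [← mul_assoc, (hC q hq).1.1.1.eq]
    simp only [mul_assoc, hqq] at this ⊢
    rw [this, sub_self])
  have hss : ∀ z, s * (s * z) = s * z := fun z => by rw [← mul_assoc, hs.1.eq]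
  rw [sub_mul, sub_eq_zero] at hz
  simp only [mul_assoc, hss] at hz ⊢
  exact hz

/-- block sums -/
def BS (A : Type*) [CStarAlgebra A] : Prop :=
  ∀ f : ℕ → A, (∀ k, IsStarProjection (f k)) → (∀ k l, k ≠ l → f k * f l = 0) →
    ∃ F : A, IsStarProjection F ∧ (∀ k, F * f k = f k) ∧ (∀ y, (∀ k, y * f k = 0) → y * F = 0) ∧
      ∀ T : ℕ → A, (∀ k, f k * T k = T k) → (∀ k, T k * f k = T k) → (∀ k, ‖T k‖ ≤ 1) →
        ∃ S : A, S * F = S ∧ ∀ k, S * f k = T k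

lemma bs_op (f T : ℕ → (H →L[ℂ] H)) (hf : ∀ k, IsStarProjection (f k))
    (hfo : ∀ k l, k ≠ l → f k * f l = 0) (h1 : ∀ k, f k * T k = T k)
    (h2 : ∀ k, T k * f k = T k) (hT : ∀ k, ‖T k‖ ≤ 1) :
    ∃ S : H →L[ℂ] H, ∀ ξ, HasSum (fun k => T k ξ) (S ξ) := by
  have hsa : ∀ k x y, inner ℂ (f k x) y = inner ℂ x (f k y) := fun k x y => by
    have := (hf k).2.star_eq
    conv_rhs => rw [← this, ContinuousLinearMap.star_eq_adjoint]
    rw [ContinuousLinearMap.adjoint_inner_right]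
  have hP : ∀ s : Finset ℕ, IsStarProjection (∑ k ∈ s, f k) := by
    intro s
    induction s using Finset.cons_induction with
    | empty => simp [IsStarProjection.zero]
    | cons a s has ih =>
      rw [Finset.sum_cons]
      apply proj_add (hf a) ih
      rw [Finset.mul_sum]
      exact Finset.sum_eq_zero fun k hk => hfo _ _ (by rintro rfl; exact has hk)
  have hnf : ∀ (s : Finset ℕ) ξ, ∑ k ∈ s, ‖f k ξ‖ ^ 2 ≤ ‖ξ‖ ^ 2 := by
    intro s ξ
    have e1 : ∀ k, ‖f k ξ‖ ^ 2 = (inner ℂ ξ (f k ξ)).re := by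
      intro k
      have := inner_self_eq_norm_sq (𝕜 := ℂ) (f k ξ)
      rw [← this, hsa]
      change (inner ℂ ξ ((f k * f k) ξ)).re = _
      rw [(hf k).1.eq]
    have e2 : ∑ k ∈ s, ‖f k ξ‖ ^ 2 = (inner ℂ ξ ((∑ k ∈ s, f k) ξ)).re := by
      simp only [e1, ContinuousLinearMap.sum_apply, inner_sum, Complex.re_sum]
    rw [e2]
    calc _ ≤ ‖ξ‖ * ‖(∑ k ∈ s, f k) ξ‖ := (Complex.re_le_norm _).trans (norm_inner_le_norm _ _)
      _ ≤ ‖ξ‖ * (1 * ‖ξ‖) := by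
        gcongr
        refine (ContinuousLinearMap.le_opNorm _ _).trans ?_
        gcongr
        exact IsStarProjection.norm_le _ (hP s)
      _ = _ := by ring
  have hTf : ∀ k ξ, ‖T k ξ‖ ≤ ‖f k ξ‖ := by
    intro k ξ
    have : T k ξ = T k (f k ξ) := by
      conv_lhs => rw [← h2 k]
      rfl
    rw [this]
    exact (ContinuousLinearMap.le_of_opNorm_le _ (hT k) _).trans (by rw [one_mul])
  have horth : OrthogonalFamily ℂ (fun k => LinearMap.range ((f k : H →L[ℂ] H) : H →ₗ[ℂ] H))
      (fun k => (LinearMap.range ((f k : H →L[ℂ] H) : H →ₗ[ℂ] H)).subtypeₗᵢ) := by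
    intro k l hkl
    rintro ⟨_, x, rfl⟩ ⟨_, y, rfl⟩
    change inner ℂ (f k x) (f l y) = 0
    rw [hsa]
    change inner ℂ x ((f k * f l) y) = 0
    rw [hfo _ _ hkl]
    simp
  have hmem : ∀ k ξ, T k ξ ∈ LinearMap.range ((f k : H →L[ℂ] H) : H →ₗ[ℂ] H) := fun k ξ =>
    ⟨T k ξ, by
      conv_rhs => rw [← h1 k]
      rfl⟩
  have hsm2 : ∀ ξ, Summable (fun k => ‖T k ξ‖ ^ 2) := fun ξ =>
    summable_of_sum_le (fun _ => by positivity) (c := ‖ξ‖ ^ 2) fun s =>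
      (Finset.sum_le_sum fun k _ => by gcongr; exact hTf k ξ).trans (hnf s ξ)
  have hsm : ∀ ξ, Summable (fun k => T k ξ) := fun ξ =>
    (horth.summable_iff_norm_sq_summable (fun k => ⟨T k ξ, hmem k ξ⟩)).2 (hsm2 ξ)
  have hb : ∀ (s : Finset ℕ) ξ, ‖∑ k ∈ s, T k ξ‖ ≤ ‖ξ‖ := by
    intro s ξ
    have := horth.norm_sum (fun k => ⟨T k ξ, hmem k ξ⟩) s
    have h3 : ‖∑ k ∈ s, T k ξ‖ ^ 2 ≤ ‖ξ‖ ^ 2 := by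
      refine (le_of_eq this).trans ?_
      exact (Finset.sum_le_sum fun k _ => by gcongr; exact hTf k ξ).trans (hnf s ξ)
    exact abs_le_of_sq_le_sq' h3 (norm_nonneg _) |>.2
  let L : H →ₗ[ℂ] H :=
    { toFun := fun ξ => ∑' k, T k ξ
      map_add' := fun x y => by
        simp only [map_add]
        exact (hsm x).tsum_add (hsm y)
      map_smul' := fun c x => by
        simp only [map_smul, RingHom.id_apply]
        exact (hsm x).tsum_const_smul c }
  refine ⟨L.mkContinuous 1 fun ξ => ?_, fun ξ => (hsm ξ).hasSum⟩
  rw [one_mul]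
  exact le_of_tendsto ((hsm ξ).hasSum.norm) (Filter.Eventually.of_forall fun s => hb s ξ)

lemma vn_BS (M : VonNeumannAlgebra H) : BS ↥M.toStarSubalgebra := by
  intro f hf hfo
  obtain ⟨F, hF, h1, h2⟩ := vn_RPF M (Set.range f)
  refine ⟨F, hF, fun k => h1 _ ⟨k, rfl⟩, fun y hy => h2 y (by rintro _ ⟨k, rfl⟩; exact hy k), ?_⟩
  intro T hT1 hT2 hT3
  obtain ⟨S, hS⟩ := bs_op (fun k => (f k : H →L[ℂ] H)) (fun k => (T k : H →L[ℂ] H))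
    (fun k => ⟨congrArg Subtype.val (hf k).1, congrArg Subtype.val (hf k).2⟩)
    (fun k l hkl => congrArg Subtype.val (hfo k l hkl))
    (fun k => congrArg Subtype.val (hT1 k)) (fun k => congrArg Subtype.val (hT2 k)) hT3
  have hSM : S ∈ M.toStarSubalgebra := by
    apply mem_of_comm
    intro y hy
    ext ξ
    have e1 : HasSum (fun k => y ((T k : H →L[ℂ] H) ξ)) (y (S ξ)) := (hS ξ).mapL y
    have e2 := hS (y ξ)
    have e3 : (fun k => y ((T k : H →L[ℂ] H) ξ)) = fun k => (T k : H →L[ℂ] H) (y ξ) := by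
      funext k
      have := VonNeumannAlgebra.mem_commutant_iff.1 hy (T k) (T k).2
      exact (DFunLike.congr_fun this ξ).symm
    rw [e3] at e1
    exact e1.unique e2
  have hTF : ∀ k, T k * F = T k := by
    intro k
    have e1 : f k * F = f k := by
      have := congrArg star (h1 (f k) ⟨k, rfl⟩)
      rwa [star_mul, (hf k).2.star_eq, hF.2.star_eq] at this
    rw [← hT2 k, mul_assoc, e1]
  refine ⟨⟨S, hSM⟩, ?_, fun k => ?_⟩
  · ext ξ
    have e1 := hS ((F : H →L[ℂ] H) ξ)
    have e3 : (fun k => (T k : H →L[ℂ] H) ((F : H →L[ℂ] H) ξ)) = fun k => (T k : H →L[ℂ] H) ξ := by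
      funext k
      exact DFunLike.congr_fun (congrArg Subtype.val (hTF k)) ξ
    rw [e3] at e1
    exact e1.unique (hS ξ)
  · ext ξ
    have e1 := hS ((f k : H →L[ℂ] H) ξ)
    refine e1.unique ?_
    have e2 : ∀ l, (T l : H →L[ℂ] H) ((f k : H →L[ℂ] H) ξ) = if l = k then (T k : H →L[ℂ] H) ξ else 0 := by
      intro l
      have : T l * f k = if l = k then T k else 0 := by
        split_ifs with h
        · rw [h, hT2]
        · rw [← hT2 l, mul_assoc, hfo l k h, mul_zero]
      have := DFunLike.congr_fun (congrArg Subtype.val this) ξ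
      refine this.trans ?_
      split_ifs <;> rfl
    simp only [e2]
    exact hasSum_ite_eq k _

end vn
end CN

namespace CN

section posf
open ComplexOrder

variable {R : Type*} [Ring R] [StarRing R] [Algebra ℂ R] [StarModule ℂ R]

/-- positive functionals -/
def PosF (Φ : R →ₗ[ℂ] ℂ) : Prop := ∀ X, 0 ≤ Φ (star X * X)

lemma PosF.herm {Φ : R →ₗ[ℂ] ℂ} (h : PosF Φ) (X : R) : Φ (star X) = star (Φ X) := by
  have h1 := (Complex.nonneg_iff.1 (h (X + 1))).2
  have h2 := (Complex.nonneg_iff.1 (h (X + Complex.I • 1))).2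
  have h3 := (Complex.nonneg_iff.1 (h X)).2
  have h4 := (Complex.nonneg_iff.1 (h 1)).2
  simp only [star_add, star_one, add_mul, mul_add, map_add, mul_one, one_mul, star_smul,
    smul_mul_assoc, mul_smul_comm, map_smul, smul_eq_mul, Complex.add_im] at h1 h2 h3 h4
  simp only [RCLike.star_def, Complex.conj_I] at h2
  simp at h2 h4
  apply Complex.ext
  · simp; linarith
  · simp; linarith

/-- the seminorm of a positive functional -/
noncomputable def nrm (Φ : R →ₗ[ℂ] ℂ) (X : R) : ℝ := √(Φ (star X * X)).re

/-- the semi-inner product core -/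
noncomputable def pcore {Φ : R →ₗ[ℂ] ℂ} (h : PosF Φ) : PreInnerProductSpace.Core ℂ R where
  inner X Y := Φ (star X * Y)
  conj_inner_symm X Y := by
    have := h.herm (star Y * X)
    rw [star_mul, star_star] at this
    exact this.symm
  re_inner_nonneg X := (Complex.nonneg_iff.1 (h X)).1
  add_left X Y Z := by rw [star_add, add_mul, map_add]
  smul_left X Y c := by
    rw [star_smul, smul_mul_assoc, map_smul]; rfl

variable {Φ : R →ₗ[ℂ] ℂ}

lemma nrm_nonneg (X : R) : 0 ≤ nrm Φ X := Real.sqrt_nonneg _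

lemma nrm_sq (h : PosF Φ) (X : R) : nrm Φ X ^ 2 = (Φ (star X * X)).re :=
  Real.sq_sqrt (Complex.nonneg_iff.1 (h X)).1

lemma posF_cs (h : PosF Φ) (X Y : R) : ‖Φ (star X * Y)‖ ≤ nrm Φ X * nrm Φ Y :=
  InnerProductSpace.Core.norm_inner_le_norm (c := pcore h) X Y

lemma posF_cs1 (h : PosF Φ) (Y : R) : ‖Φ Y‖ ≤ nrm Φ 1 * nrm Φ Y := by
  have := posF_cs h 1 Y
  rwa [star_one, one_mul] at this

lemma nrm_add (h : PosF Φ) (X Y : R) : nrm Φ (X + Y) ≤ nrm Φ X + nrm Φ Y :=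
  letI := InnerProductSpace.Core.toSeminormedAddCommGroup (c := pcore h)
  norm_add_le X Y

lemma nrm_neg (X : R) : nrm Φ (-X) = nrm Φ X := by
  simp [nrm]

lemma nrm_zero : nrm Φ 0 = 0 := by
  simp [nrm]

lemma nrm_sub (h : PosF Φ) (X Y : R) : nrm Φ (X - Y) ≤ nrm Φ X + nrm Φ Y := by
  rw [sub_eq_add_neg, ← nrm_neg Y]; exact nrm_add h _ _

lemma nrm_sub_comm (X Y : R) : nrm Φ (X - Y) = nrm Φ (Y - X) := by
  rw [← nrm_neg, neg_sub]

lemma nrm_smul (c : ℂ) (X : R) : nrm Φ (c • X) = ‖c‖ * nrm Φ X := by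
  have : star (c • X) * (c • X) = ((‖c‖ ^ 2 : ℝ) : ℂ) • (star X * X) := by
    rw [star_smul, smul_mul_smul_comm]
    congr 1
    rw [RCLike.star_def, Complex.conj_mul']; norm_cast
  rw [nrm, this, map_smul, smul_eq_mul, Complex.re_ofReal_mul, Real.sqrt_mul (by positivity), Real.sqrt_sq (norm_nonneg _)]
  rfl

lemma nrm_sum (h : PosF Φ) {ι : Type*} (s : Finset ι) (x : ι → R) :
    nrm Φ (∑ i ∈ s, x i) ≤ ∑ i ∈ s, nrm Φ (x i) := by
  induction s using Finset.cons_induction with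
  | empty => simp [nrm_zero]
  | cons a s ha ih =>
    rw [Finset.sum_cons, Finset.sum_cons]
    exact (nrm_add h _ _).trans (by gcongr)

lemma nrm_unitary_mul {U : R} (hU : star U * U = 1) (X : R) : nrm Φ (U * X) = nrm Φ X := by
  have : star (U * X) * (U * X) = star X * X := by
    rw [star_mul, mul_assoc, ← mul_assoc (star U), hU, one_mul]
  rw [nrm, this]; rfl

lemma nrm_proj_sq (h : PosF Φ) {p : R} (hp : IsStarProjection p) (X : R) :
    nrm Φ (p * X) ^ 2 + nrm Φ ((1 - p) * X) ^ 2 = nrm Φ X ^ 2 := by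
  rw [nrm_sq h, nrm_sq h, nrm_sq h, ← Complex.add_re, ← map_add]
  congr 2
  have e1 : star (p * X) * (p * X) = star X * p * X := by
    rw [star_mul, hp.2.star_eq, mul_assoc, ← mul_assoc p, hp.1.eq, mul_assoc]
  have e2 : star ((1 - p) * X) * ((1 - p) * X) = star X * (1 - p) * X := by
    rw [star_mul, hp.one_sub.2.star_eq, mul_assoc, ← mul_assoc (1 - p), hp.one_sub.1.eq, mul_assoc]
  rw [e1, e2]
  noncomm_ring

lemma nrm_proj_le (h : PosF Φ) {p : R} (hp : IsStarProjection p) (X : R) :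
    nrm Φ (p * X) ≤ nrm Φ X := by
  have := nrm_proj_sq h hp X
  exact abs_le_of_sq_le_sq' (by nlinarith [sq_nonneg (nrm Φ ((1 - p) * X))]) (nrm_nonneg _) |>.2

/-- conjugated functional -/
noncomputable def conjF (Φ : R →ₗ[ℂ] ℂ) (b : R) : R →ₗ[ℂ] ℂ :=
  Φ ∘ₗ LinearMap.mulLeft ℂ (star b) ∘ₗ LinearMap.mulRight ℂ b

lemma conjF_apply (b X : R) : conjF Φ b X = Φ (star b * (X * b)) := rfl

lemma conjF_star_mul (b X : R) : conjF Φ b (star X * X) = Φ (star (X * b) * (X * b)) := by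
  rw [conjF_apply, star_mul]; simp only [mul_assoc]

lemma PosF.conjF (h : PosF Φ) (b : R) : PosF (conjF Φ b) := fun X => by
  rw [conjF_star_mul]; exact h _

lemma nrm_conjF (b X : R) : nrm (conjF Φ b) X = nrm Φ (X * b) := by
  rw [nrm, conjF_star_mul]; rfl

lemma nrm_one_sq (h : PosF Φ) : nrm Φ 1 ^ 2 = (Φ 1).re := by
  rw [nrm_sq h]; simp

/-- every element is bounded in all positive functionals -/
def PBdd (R : Type*) [Ring R] [StarRing R] [Algebra ℂ R] : Prop :=
  ∀ X : R, ∃ C : ℝ, 0 ≤ C ∧ ∀ Φ : R →ₗ[ℂ] ℂ, PosF Φ → nrm Φ X ≤ C * nrm Φ 1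

/-- sup seminorm -/
noncomputable def NF (F : Set (R →ₗ[ℂ] ℂ)) (X : R) : ℝ :=
  sSup {c | ∃ Φ ∈ F, nrm Φ 1 ≤ 1 ∧ c = nrm Φ X}

variable {F : Set (R →ₗ[ℂ] ℂ)}

lemma NF_nonneg (X : R) : 0 ≤ NF F X := by
  apply Real.sSup_nonneg
  rintro _ ⟨Φ, _, _, rfl⟩
  exact nrm_nonneg _

lemma le_NF (hB : PBdd R) (hF : ∀ Φ ∈ F, PosF Φ) (hΦ : Φ ∈ F) (h1 : nrm Φ 1 ≤ 1) (X : R) :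
    nrm Φ X ≤ NF F X := by
  obtain ⟨C, hC0, hC⟩ := hB X
  refine le_csSup ⟨C, ?_⟩ ⟨Φ, hΦ, h1, rfl⟩
  rintro _ ⟨Ψ, hΨ, h2, rfl⟩
  exact (hC Ψ (hF Ψ hΨ)).trans (mul_le_of_le_one_right hC0 h2)

lemma NF_le {c : ℝ} (hc : 0 ≤ c) {X : R} (h : ∀ Φ ∈ F, nrm Φ 1 ≤ 1 → nrm Φ X ≤ c) : NF F X ≤ c := by
  apply Real.sSup_le _ hc
  rintro _ ⟨Φ, hΦ, h1, rfl⟩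
  exact h Φ hΦ h1

lemma nrm_le_NF (hB : PBdd R) (hF : ∀ Φ ∈ F, PosF Φ) (hcl : ∀ Φ ∈ F, ∀ b, conjF Φ b ∈ F)
    (hΦ : Φ ∈ F) (X : R) : nrm Φ X ≤ NF F X * nrm Φ 1 := by
  by_cases h0 : nrm Φ 1 = 0
  · obtain ⟨C, hC0, hC⟩ := hB X
    have := hC Φ (hF Φ hΦ)
    rw [h0, mul_zero] at this ⊢
    exact this
  · have hpos : 0 < nrm Φ 1 := lt_of_le_of_ne (nrm_nonneg _) (Ne.symm h0)
    have key : ∀ Y, nrm (conjF Φ (((nrm Φ 1)⁻¹ : ℂ) • 1)) Y = (nrm Φ 1)⁻¹ * nrm Φ Y := by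
      intro Y
      rw [nrm_conjF, mul_smul_comm, mul_one, nrm_smul, ← Complex.ofReal_inv, Complex.norm_real,
        Real.norm_of_nonneg (by positivity)]
    have := le_NF hB hF (hcl Φ hΦ (((nrm Φ 1)⁻¹ : ℂ) • 1)) (by rw [key, inv_mul_cancel₀ h0]) X
    rw [key, inv_mul_eq_div, div_le_iff₀ hpos] at this
    exact this

lemma NF_seminorm (hB : PBdd R) (hF : ∀ Φ ∈ F, PosF Φ) (hcl : ∀ Φ ∈ F, ∀ b, conjF Φ b ∈ F) :
    IsCstarSeminorm (NF F) := by
  have hadd : ∀ x y, NF F (x + y) ≤ NF F x + NF F y := fun x y =>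
    NF_le (add_nonneg (NF_nonneg _) (NF_nonneg _)) fun Φ hΦ h1 =>
      (nrm_add (hF Φ hΦ) x y).trans (add_le_add (le_NF hB hF hΦ h1 x) (le_NF hB hF hΦ h1 y))
  have hmul : ∀ x y, NF F (x * y) ≤ NF F x * NF F y := fun x y =>
    NF_le (mul_nonneg (NF_nonneg _) (NF_nonneg _)) fun Φ hΦ h1 => by
      rw [← nrm_conjF]
      refine (nrm_le_NF hB hF hcl (hcl Φ hΦ y) x).trans ?_
      rw [nrm_conjF, one_mul]
      exact mul_le_mul_of_nonneg_left (le_NF hB hF hΦ h1 y) (NF_nonneg _)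
  have hsq : ∀ x, NF F x ^ 2 ≤ NF F (star x * x) := by
    intro x
    have : NF F x ≤ √(NF F (star x * x)) := by
      refine NF_le (Real.sqrt_nonneg _) fun Φ hΦ h1 => ?_
      apply Real.le_sqrt_of_sq_le
      rw [nrm_sq (hF Φ hΦ)]
      refine (Complex.re_le_norm _).trans ((posF_cs1 (hF Φ hΦ) _).trans ?_)
      exact (mul_le_of_le_one_left (nrm_nonneg _) h1).trans (le_NF hB hF hΦ h1 _)
    calc _ ≤ √(NF F (star x * x)) ^ 2 := by gcongr; exact NF_nonneg _
      _ = _ := Real.sq_sqrt (NF_nonneg _)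
  have hst : ∀ x, NF F x ≤ NF F (star x) := by
    intro x
    have h1 := (hsq x).trans (hmul (star x) x)
    by_cases h0 : NF F x = 0
    · rw [h0]; exact NF_nonneg _
    · have hp : 0 < NF F x := lt_of_le_of_ne (NF_nonneg _) (Ne.symm h0)
      nlinarith
  have hst' : ∀ x, NF F (star x) = NF F x := fun x => le_antisymm
    (by have := hst (star x); rwa [star_star] at this) (hst x)
  have hsm : ∀ (c : ℂ) (x), NF F (c • x) ≤ ‖c‖ * NF F x := fun c x =>
    NF_le (mul_nonneg (norm_nonneg _) (NF_nonneg _)) fun Φ hΦ h1 => by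
      rw [nrm_smul]
      exact mul_le_mul_of_nonneg_left (le_NF hB hF hΦ h1 x) (norm_nonneg _)
  refine ⟨NF_nonneg, hadd, fun c x => le_antisymm (hsm c x) ?_, hmul, hst', fun x => ?_⟩
  · by_cases h0 : c = 0
    · simp [h0, NF_nonneg]
    · have := hsm c⁻¹ (c • x)
      rw [smul_smul, inv_mul_cancel₀ h0, one_smul, norm_inv, inv_mul_eq_div, le_div_iff₀ (norm_pos_iff.2 h0)] at this
      linarith
  · refine le_antisymm ?_ (hsq x)
    have := hmul (star x) x
    rw [hst'] at this
    nlinarith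

lemma max_seminorm {f g : R → ℝ} (hf : IsCstarSeminorm f) (hg : IsCstarSeminorm g) :
    IsCstarSeminorm (fun x => max (f x) (g x)) := by
  obtain ⟨f1, f2, f3, f4, f5, f6⟩ := hf
  obtain ⟨g1, g2, g3, g4, g5, g6⟩ := hg
  refine ⟨fun x => le_max_of_le_left (f1 x), fun x y => ?_, fun c x => ?_, fun x y => ?_, fun x => ?_, fun x => ?_⟩
  · exact max_le ((f2 x y).trans (add_le_add (le_max_left _ _) (le_max_left _ _)))
      ((g2 x y).trans (add_le_add (le_max_right _ _) (le_max_right _ _)))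
  · simp only [f3, g3, mul_max_of_nonneg _ _ (norm_nonneg c)]
  · exact max_le ((f4 x y).trans (mul_le_mul (le_max_left _ _) (le_max_left _ _) (f1 _) (le_max_of_le_left (f1 x))))
      ((g4 x y).trans (mul_le_mul (le_max_right _ _) (le_max_right _ _) (g1 _) (le_max_of_le_left (f1 x))))
  · simp only [f5, g5]
  · simp only [f6, g6]
    rcases le_total (f x) (g x) with h | h
    · rw [max_eq_right h, max_eq_right (by gcongr; exact f1 x)]
    · rw [max_eq_left h, max_eq_left (by gcongr; exact g1 x)]

end posf

section bdd
variable {A B : Type*} [CStarAlgebra A] [CStarAlgebra B]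

lemma pbdd_tensor : PBdd (A ⊗[ℂ] B) := by
  intro X
  have hadd : ∀ x y : A ⊗[ℂ] B, (∃ C : ℝ, 0 ≤ C ∧ ∀ Φ : A ⊗[ℂ] B →ₗ[ℂ] ℂ, PosF Φ → nrm Φ x ≤ C * nrm Φ 1) →
      (∃ C : ℝ, 0 ≤ C ∧ ∀ Φ : A ⊗[ℂ] B →ₗ[ℂ] ℂ, PosF Φ → nrm Φ y ≤ C * nrm Φ 1) →
      (∃ C : ℝ, 0 ≤ C ∧ ∀ Φ : A ⊗[ℂ] B →ₗ[ℂ] ℂ, PosF Φ → nrm Φ (x + y) ≤ C * nrm Φ 1) := by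
    rintro x y ⟨C, hC0, hC⟩ ⟨D, hD0, hD⟩
    exact ⟨C + D, add_nonneg hC0 hD0, fun Φ hΦ => (nrm_add hΦ _ _).trans (by linarith [hC Φ hΦ, hD Φ hΦ])⟩
  have hsmul : ∀ (c : ℂ) (x : A ⊗[ℂ] B), (∃ C : ℝ, 0 ≤ C ∧ ∀ Φ : A ⊗[ℂ] B →ₗ[ℂ] ℂ, PosF Φ → nrm Φ x ≤ C * nrm Φ 1) →
      (∃ C : ℝ, 0 ≤ C ∧ ∀ Φ : A ⊗[ℂ] B →ₗ[ℂ] ℂ, PosF Φ → nrm Φ (c • x) ≤ C * nrm Φ 1) := by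
    rintro c x ⟨C, hC0, hC⟩
    refine ⟨‖c‖ * C, by positivity, fun Φ hΦ => ?_⟩
    rw [nrm_smul, mul_assoc]
    exact mul_le_mul_of_nonneg_left (hC Φ hΦ) (norm_nonneg _)
  have hzero : ∃ C : ℝ, 0 ≤ C ∧ ∀ Φ : A ⊗[ℂ] B →ₗ[ℂ] ℂ, PosF Φ → nrm Φ (0 : A ⊗[ℂ] B) ≤ C * nrm Φ 1 :=
    ⟨0, le_rfl, fun Φ _ => by rw [nrm_zero, zero_mul]⟩
  induction X using TensorProduct.induction_on with
  | zero => exact hzero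
  | add x y hx hy => exact hadd x y hx hy
  | tmul a b =>
    have ha : a ∈ Submodule.span ℂ (unitary A : Set A) := by rw [CStarAlgebra.span_unitary]; trivial
    have hb : b ∈ Submodule.span ℂ (unitary B : Set B) := by rw [CStarAlgebra.span_unitary]; trivial
    induction ha using Submodule.span_induction with
    | zero => rw [TensorProduct.zero_tmul]; exact hzero
    | add x y _ _ hx hy => rw [TensorProduct.add_tmul]; exact hadd _ _ hx hy
    | smul c x _ hx => rw [← TensorProduct.smul_tmul']; exact hsmul _ _ hx
    | mem u hu =>
      induction hb using Submodule.span_induction with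
      | zero => rw [TensorProduct.tmul_zero]; exact hzero
      | add x y _ _ hx hy => rw [TensorProduct.tmul_add]; exact hadd _ _ hx hy
      | smul c x _ hx => rw [TensorProduct.tmul_smul]; exact hsmul _ _ hx
      | mem v hv =>
        refine ⟨1, zero_le_one, fun Φ hΦ => ?_⟩
        have := nrm_unitary_mul (Φ := Φ) (U := u ⊗ₜ[ℂ] v) (by
          rw [pstar_tmul, Algebra.TensorProduct.tmul_mul_tmul, Unitary.star_mul_self_of_mem hu,
            Unitary.star_mul_self_of_mem hv]; rfl) 1
        rw [mul_one] at this
        rw [this, one_mul]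

end bdd
end CN

namespace CN

section counting
open ComplexOrder

variable {A B : Type*} [CStarAlgebra A] [CStarAlgebra B]

lemma exists_fin_sum (b : A ⊗[ℂ] B) : ∃ (m : ℕ) (α : Fin m → A) (β : Fin m → B), b = ∑ k, α k ⊗ₜ[ℂ] β k := by
  induction b using TensorProduct.induction_on with
  | zero => exact ⟨0, Fin.elim0, Fin.elim0, by simp⟩
  | tmul a b => exact ⟨1, fun _ => a, fun _ => b, by simp⟩
  | add x y hx hy =>
    obtain ⟨m, α, β, rfl⟩ := hx
    obtain ⟨n, α', β', rfl⟩ := hy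
    exact ⟨m + n, Fin.append α α', Fin.append β β', by simp [Fin.sum_univ_add]⟩

variable {ℋ : Type*} [NormedAddCommGroup ℋ] [InnerProductSpace ℂ ℋ]

/-- elements whose data matter -/
def zz {A S : Type*} [Ring A] [StarRing A] (u : S → A) : Option (S × S) → A
  | none => 1
  | some p => star (u p.1) * u p.2

/-- data of a functional -/
def dat {A S : Type*} [Ring A] [StarRing A] (P : A → ℋ) (u : S → A) {m : ℕ} (α : Fin m → A) :
    Fin m → Fin m → Option (S × S) → ℋ :=
  fun k l t => P (star (α k) * (zz u t * α l))

lemma dat_eval {S : Type*} {P : A → ℋ} {Q : B → ℋ} {φ : A ⊗[ℂ] B →ₗ[ℂ] ℂ}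
    (hφ : ∀ x y, φ (x ⊗ₜ y) = inner ℂ (P x) (Q y)) (u : S → A) (v : S → B) {m : ℕ} (α : Fin m → A)
    (β : Fin m → B) (t : Option (S × S)) :
    conjF φ (∑ k, α k ⊗ₜ[ℂ] β k) (zz u t ⊗ₜ zz v t) = ∑ k, ∑ l, inner ℂ (dat P u α k l t) (dat Q v β k l t) := by
  rw [conjF_apply, star_sum, Finset.mul_sum, Finset.sum_mul_sum, map_sum]
  refine Finset.sum_congr rfl fun k _ => ?_
  rw [map_sum]
  refine Finset.sum_congr rfl fun l _ => ?_
  rw [pstar_tmul, Algebra.TensorProduct.tmul_mul_tmul, Algebra.TensorProduct.tmul_mul_tmul, hφ]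
  rfl

lemma nrm_dat {S : Type*} [Fintype S] {Φ : A ⊗[ℂ] B →ₗ[ℂ] ℂ} (h : PosF Φ) (u : S → A) (v : S → B) :
    nrm Φ 1 ^ 2 = (Φ (zz u none ⊗ₜ zz v none)).re ∧
    nrm Φ (∑ s, u s ⊗ₜ v s) ^ 2 = ∑ s, ∑ s', (Φ (zz u (some (s, s')) ⊗ₜ zz v (some (s, s')))).re := by
  constructor
  · rw [nrm_one_sq h]; rfl
  · rw [nrm_sq h, star_sum, Finset.sum_mul_sum, map_sum, Complex.re_sum]
    refine Finset.sum_congr rfl fun s _ => ?_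
    rw [map_sum, Complex.re_sum]
    refine Finset.sum_congr rfl fun s' _ => ?_
    rw [pstar_tmul, Algebra.TensorProduct.tmul_mul_tmul]
    rfl

lemma inner_close {S : Type*} [Fintype S] {m : ℕ} {r : ℝ} (hr : 0 ≤ r) {ε : ℝ} (hε : 0 ≤ ε)
    (X Y Z : Fin m → Fin m → Option (S × S) → ℋ) (hXY : ∀ k l t, ‖X k l t - Y k l t‖ ≤ ε)
    (hZ : ∀ k l t, ‖Z k l t‖ ≤ r) (t : Option (S × S)) :
    |(∑ k, ∑ l, inner ℂ (X k l t) (Z k l t) : ℂ).re - (∑ k, ∑ l, inner ℂ (Y k l t) (Z k l t) : ℂ).re| ≤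
      m ^ 2 * (ε * r) := by
  rw [← Complex.sub_re, ← Finset.sum_sub_distrib]
  refine (Complex.abs_re_le_norm _).trans ((norm_sum_le _ _).trans ?_)
  calc _ ≤ ∑ k : Fin m, ∑ l : Fin m, ε * r := by
        refine Finset.sum_le_sum fun k _ => ?_
        rw [← Finset.sum_sub_distrib]
        refine (norm_sum_le _ _).trans (Finset.sum_le_sum fun l _ => ?_)
        rw [← inner_sub_left]
        exact (norm_inner_le_norm _ _).trans (mul_le_mul (hXY k l t) (hZ k l t) (norm_nonneg _) hε)
    _ = _ := by simp; ring

lemma counting [TopologicalSpace.SeparableSpace ℋ] {IA IC J S : Type*} [Fintype S]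
    (P : IA → A → ℋ) (Q : IC → B → ℋ) (φ : IA → IC → (A ⊗[ℂ] B →ₗ[ℂ] ℂ))
    (hφ : ∀ a c x y, φ a c (x ⊗ₜ y) = inner ℂ (P a x) (Q c y)) (hpos : ∀ a c, PosF (φ a c))
    (u : J → S → A) (v : J → S → B) (D δ : ℝ) (hδ : 0 < δ) (hD : δ ≤ D)
    (hsep : ∀ i j, i ≠ j → ∀ Φ : A ⊗[ℂ] B →ₗ[ℂ] ℂ, PosF Φ →
      nrm Φ (∑ s, u i s ⊗ₜ v j s) ^ 2 ≤ (D - δ) * nrm Φ 1 ^ 2) :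
    {j | D ≤ NF {Ψ | ∃ a c b, Ψ = conjF (φ a c) b} (∑ s, u j s ⊗ₜ v j s) ^ 2}.Countable := by
  classical
  set η : ℝ := δ / (3 * (D + 1)) with hη
  have hD1 : 0 < D + 1 := by linarith
  have hη0 : 0 < η := div_pos hδ (by positivity)
  have hηD : η * (D - δ + 1) < 2 * δ / 3 := by
    have : η * (D + 1) = δ / 3 := by rw [hη]; have := hD1.ne'; field_simp
    nlinarith
  set ε : ℕ → ℕ → ℝ := fun m r => η / (2 * (m ^ 2 * (Fintype.card S ^ 2 + 1) * r + 1)) with hε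
  have hε0 : ∀ m r, 0 < ε m r := fun m r => by rw [hε]; positivity
  have hε1 : ∀ m r : ℕ, (m : ℝ) ^ 2 * (2 * ε m r * r) ≤ η ∧
      (Fintype.card S : ℝ) ^ 2 * ((m : ℝ) ^ 2 * (2 * ε m r * r)) ≤ η := by
    intro m r
    have h1 : ε m r * (2 * (m ^ 2 * (Fintype.card S ^ 2 + 1) * r + 1)) = η := by
      rw [hε]; field_simp
    have h2 := hε0 m r
    have h3 : (0 : ℝ) ≤ (m : ℝ) ^ 2 * (ε m r * r) := by positivity
    have h4 : (0 : ℝ) ≤ (Fintype.card S : ℝ) ^ 2 * ((m : ℝ) ^ 2 * (ε m r * r)) := by positivity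
    constructor <;> nlinarith
  let G : ℕ → ℕ → ℕ → Set J := fun m r n => {j | ∃ (a : IA) (c : IC) (α : Fin m → A) (β : Fin m → B),
    nrm (conjF (φ a c) (∑ k, α k ⊗ₜ[ℂ] β k)) 1 ≤ 1 ∧
    D - δ / 3 ≤ nrm (conjF (φ a c) (∑ k, α k ⊗ₜ[ℂ] β k)) (∑ s, u j s ⊗ₜ v j s) ^ 2 ∧
    (∀ k l t, ‖dat (Q c) (v j) β k l t‖ ≤ r) ∧
    dist (dat (P a) (u j) α) (TopologicalSpace.denseSeq (Fin m → Fin m → Option (S × S) → ℋ) n) < ε m r}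
  have hG : ∀ m r n, (G m r n).Subsingleton := by
    rintro m r n i ⟨a, c, α, β, -, -, -, h4⟩ j ⟨a', c', α', β', k1, k2, k3, k4⟩
    by_contra hij
    have hd : dist (dat (P a) (u i) α) (dat (P a') (u j) α') ≤ 2 * ε m r := by
      have := dist_triangle_right (dat (P a) (u i) α) (dat (P a') (u j) α')
        (TopologicalSpace.denseSeq (Fin m → Fin m → Option (S × S) → ℋ) n)
      linarith
    have hd' : ∀ k l t, ‖dat (P a) (u i) α k l t - dat (P a') (u j) α' k l t‖ ≤ 2 * ε m r := by
      intro k l t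
      rw [← dist_eq_norm]
      exact (((dist_le_pi_dist _ _ t).trans (dist_le_pi_dist _ _ l)).trans (dist_le_pi_dist _ _ k)).trans hd
    have hcl := inner_close (Nat.cast_nonneg r) (by have := hε0 m r; positivity) _ _ _ hd' k3
    set Φ := conjF (φ a c') (∑ k, α k ⊗ₜ[ℂ] β' k) with hΦ
    set Ψ := conjF (φ a' c') (∑ k, α' k ⊗ₜ[ℂ] β' k) with hΨ
    have hΦp : PosF Φ := (hpos a c').conjF _
    have hΨp : PosF Ψ := (hpos a' c').conjF _
    have hs := hsep i j hij Φ hΦp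
    have e1 := nrm_dat hΦp (u i) (v j)
    have e2 := nrm_dat hΨp (u j) (v j)
    simp only [hΦ, hΨ, dat_eval (hφ _ _)] at e1 e2
    have f1 := (abs_le.1 (hcl none)).2
    have f2 : ∀ s s', _ := fun s s' => (abs_le.1 (hcl (some (s, s')))).1
    have f3 : nrm Ψ (∑ s, u j s ⊗ₜ v j s) ^ 2 - (Fintype.card S : ℝ) ^ 2 * ((m : ℝ) ^ 2 * (2 * ε m r * r)) ≤
        nrm Φ (∑ s, u i s ⊗ₜ v j s) ^ 2 := by
      rw [hΦ, hΨ, e1.2, e2.2]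
      have : (Fintype.card S : ℝ) ^ 2 * ((m : ℝ) ^ 2 * (2 * ε m r * r)) =
          ∑ s : S, ∑ s' : S, ((m : ℝ) ^ 2 * (2 * ε m r * r)) := by
        simp; ring
      rw [this, ← Finset.sum_sub_distrib]
      refine Finset.sum_le_sum fun s _ => ?_
      rw [← Finset.sum_sub_distrib]
      refine Finset.sum_le_sum fun s' _ => ?_
      have := f2 s s'
      linarith
    have f4 : nrm Φ 1 ^ 2 ≤ nrm Ψ 1 ^ 2 + (m : ℝ) ^ 2 * (2 * ε m r * r) := by
      rw [hΦ, hΨ, e1.1, e2.1]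
      linarith
    have f5 : nrm Ψ 1 ^ 2 ≤ 1 := by
      have := nrm_nonneg (Φ := Ψ) (1 : A ⊗[ℂ] B)
      nlinarith
    obtain ⟨g1, g2⟩ := hε1 m r
    have : (D - δ) * nrm Φ 1 ^ 2 ≤ (D - δ) * (1 + η) :=
      mul_le_mul_of_nonneg_left (by linarith) (by linarith)
    nlinarith
  refine Set.Countable.mono ?_ (Set.countable_iUnion fun m => Set.countable_iUnion fun r =>
    Set.countable_iUnion fun n => (hG m r n).countable)
  intro j hj
  have h1 : ∃ a c b, nrm (conjF (φ a c) b) 1 ≤ 1 ∧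
      D - δ / 3 ≤ nrm (conjF (φ a c) b) (∑ s, u j s ⊗ₜ v j s) ^ 2 := by
    by_contra hcon
    push Not at hcon
    have h0 : 0 ≤ D - δ / 3 := by linarith
    have : NF {Ψ | ∃ a c b, Ψ = conjF (φ a c) b} (∑ s, u j s ⊗ₜ v j s) ≤ √(D - δ / 3) := by
      apply NF_le (Real.sqrt_nonneg _)
      rintro _ ⟨a, c, b, rfl⟩ h1
      exact Real.le_sqrt_of_sq_le (hcon a c b h1).le
    have h2 : D ≤ NF {Ψ | ∃ a c b, Ψ = conjF (φ a c) b} (∑ s, u j s ⊗ₜ v j s) ^ 2 := hj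
    have h3 : NF {Ψ | ∃ a c b, Ψ = conjF (φ a c) b} (∑ s, u j s ⊗ₜ v j s) ^ 2 ≤ √(D - δ / 3) ^ 2 := by
      gcongr; exact NF_nonneg _
    rw [Real.sq_sqrt h0] at h3
    linarith
  obtain ⟨a, c, b, h1, h2⟩ := h1
  obtain ⟨m, α, β, rfl⟩ := exists_fin_sum b
  obtain ⟨r, hr⟩ : ∃ r : ℕ, ∀ p : Fin m × Fin m × Option (S × S), ‖dat (Q c) (v j) β p.1 p.2.1 p.2.2‖ ≤ r := by
    obtain ⟨r, hr⟩ := exists_nat_ge (∑ p : Fin m × Fin m × Option (S × S), ‖dat (Q c) (v j) β p.1 p.2.1 p.2.2‖)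
    exact ⟨r, fun p => (Finset.single_le_sum (f := fun p : Fin m × Fin m × Option (S × S) =>
      ‖dat (Q c) (v j) β p.1 p.2.1 p.2.2‖) (fun _ _ => norm_nonneg _) (Finset.mem_univ p)).trans hr⟩
  obtain ⟨n, hn⟩ := (TopologicalSpace.denseRange_denseSeq (Fin m → Fin m → Option (S × S) → ℋ)).exists_dist_lt
    (dat (P a) (u j) α) (hε0 m r)
  simp only [Set.mem_iUnion]
  exact ⟨m, r, n, a, c, α, β, h1, h2, fun k l t => hr (k, l, t), hn⟩

end counting
end CN

namespace CN

section relT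
open ComplexOrder

variable {R : Type*} [Ring R] [StarRing R] [Algebra ℂ R] [StarModule ℂ R] {Φ : R →ₗ[ℂ] ℂ}

lemma nrm_shift (h : PosF Φ) {P Q W : R} (hP : IsStarProjection P) (hQ : IsStarProjection Q)
    (hW : star W * W = 1) (hW' : W * star W = 1) (hE : Q * (W * P) = W * P) :
    nrm Φ P ≤ nrm Φ Q + nrm Φ (W - 1) := by
  have e1 : (W * P * star W) * Q = W * P * star W := by
    have := congrArg star (show Q * (W * P * star W) = W * P * star W by rw [← mul_assoc, hE])
    simp only [star_mul, star_star, hP.2.star_eq, hQ.2.star_eq] at this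
    simp only [mul_assoc] at this ⊢
    exact this
  have hpr : IsStarProjection (W * P * star W) := by
    refine ⟨?_, ?_⟩
    · show W * P * star W * (W * P * star W) = _
      calc _ = W * P * (star W * W) * P * star W := by simp only [mul_assoc]
        _ = W * (P * P) * star W := by rw [hW]; simp only [mul_assoc, mul_one, one_mul]
        _ = _ := by rw [hP.1.eq]
    · show star _ = _
      simp only [star_mul, star_star, hP.2.star_eq, mul_assoc]
  have e2 : nrm Φ P = nrm Φ (W * P * star W * (Q * W)) := by
    rw [← mul_assoc _ Q, e1, mul_assoc (W * P), hW, mul_one, nrm_unitary_mul hW]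
  rw [e2]
  refine (nrm_proj_le h hpr _).trans ?_
  have e3 : Q * W = Q + Q * (W - 1) := by rw [mul_sub, mul_one]; abel
  rw [e3]
  refine (nrm_add h _ _).trans ?_
  gcongr
  exact nrm_proj_le h hQ _

lemma nrm_orth (h : PosF Φ) {P Q : R} (hP : IsStarProjection P) (hPQ : P * Q = 0) :
    nrm Φ (P + Q) ^ 2 = nrm Φ P ^ 2 + nrm Φ Q ^ 2 := by
  have := nrm_proj_sq h hP (P + Q)
  have e1 : P * (P + Q) = P := by rw [mul_add, hPQ, hP.1.eq, add_zero]
  have e2 : (1 - P) * (P + Q) = Q := by rw [sub_mul, e1, one_mul]; abel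
  rw [e1, e2] at this
  exact this.symm

variable {C : Type*} [CommRing C] [Algebra ℂ C] (π : C →ₐ[ℂ] R)

/-- commutative projections -/
def SP (e : C) : Prop := e * e = e ∧ star (π e) = π e

variable {π}

lemma SP.proj {e : C} (h : SP π e) : IsStarProjection (π e) :=
  ⟨show π e * π e = π e by rw [← map_mul, h.1], h.2⟩

lemma SP.mul {e f : C} (h : SP π e) (h' : SP π f) : SP π (e * f) := by
  refine ⟨by rw [mul_mul_mul_comm, h.1, h'.1], ?_⟩
  rw [map_mul, star_mul, h.2, h'.2, ← map_mul, mul_comm, map_mul]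

lemma SP.one_sub {e : C} (h : SP π e) : SP π (1 - e) := by
  refine ⟨by linear_combination h.1, ?_⟩
  rw [map_sub, star_sub, h.2, map_one, star_one]

lemma SP.zero : SP π 0 := ⟨by simp, by simp⟩
lemma SP.one : SP π 1 := ⟨by simp, by simp⟩

lemma SP.prod {s : Finset ℕ} {f : ℕ → C} (h : ∀ k, SP π (f k)) : SP π (∏ k ∈ s, f k) := by
  classical
  induction s using Finset.induction_on with
  | empty => simpa using SP.one
  | insert a s ha ih => rw [Finset.prod_insert ha]; exact (h a).mul ih

lemma SP.sum_mul {f : ℕ → C} (h : ∀ k, SP π (f k)) (ho : ∀ k l, k ≠ l → f k * f l = 0) (K : ℕ)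
    (k : ℕ) (hk : k < K) : (∑ l ∈ Finset.range K, f l) * f k = f k := by
  rw [Finset.sum_mul, Finset.sum_eq_single k]
  · exact (h k).1
  · intro l _ hl; exact ho l k hl
  · intro h; simp at h; omega

lemma SP.sum {f : ℕ → C} (h : ∀ k, SP π (f k)) (ho : ∀ k l, k ≠ l → f k * f l = 0) (K : ℕ) :
    SP π (∑ l ∈ Finset.range K, f l) := by
  refine ⟨?_, ?_⟩
  · rw [Finset.mul_sum]
    exact Finset.sum_congr rfl fun k hk => SP.sum_mul h ho K k (by simpa using hk)
  · rw [map_sum, star_sum]; exact Finset.sum_congr rfl fun k _ => (h k).2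

variable {x y : ℕ → C}

/-- the product projection -/
def pp (x y : ℕ → C) (k : ℕ) : C := ∏ i ∈ Finset.range k, (x i * y i)

lemma pp_swap (k : ℕ) : pp y x k = pp x y k := by
  unfold pp; exact Finset.prod_congr rfl fun i _ => mul_comm _ _

lemma pp_SP (hx : ∀ k, SP π (x k)) (hy : ∀ k, SP π (y k)) (k : ℕ) : SP π (pp x y k) :=
  SP.prod fun k => (hx k).mul (hy k)

lemma pp_x (hx : ∀ k, SP π (x k)) {k i : ℕ} (hi : i < k) : pp x y k * x i = pp x y k := by
  unfold pp
  rw [← Finset.mul_prod_erase _ _ (Finset.mem_range.2 hi)]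
  linear_combination (y i * ∏ x_1 ∈ (Finset.range k).erase i, x x_1 * y x_1) * (hx i).1

lemma pp_y (hy : ∀ k, SP π (y k)) {k i : ℕ} (hi : i < k) : pp x y k * y i = pp x y k := by
  rw [← pp_swap]; exact pp_x hy hi

lemma pp_succ (k : ℕ) : pp x y (k + 1) = pp x y k * (x k * y k) := Finset.prod_range_succ _ _

lemma pp_orth (hx : ∀ k, SP π (x k)) (hy : ∀ k, SP π (y k)) {f : ℕ → C}
    (hf : ∀ k, f k * (1 - x k * y k) = f k) (hf' : ∀ k, f k * pp x y k = f k) (k l : ℕ) (hkl : k ≠ l) :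
    f k * f l = 0 := by
  have key : ∀ k l, k < l → f k * f l = 0 := by
    intro k l h
    have h1 := pp_x (y := y) hx h
    have h2 := pp_y (x := x) hy h
    have : f k * f l = f k * ((1 - x k * y k)) * (f l * pp x y l) := by rw [hf, hf']
    rw [this]
    linear_combination -f k * f l * y k * h1 - f k * f l * h2
  rcases lt_or_gt_of_ne hkl with h | h
  · exact key _ _ h
  · rw [mul_comm]; exact key _ _ h

lemma sumW (Q W : R) (s : Finset ℕ) (f : ℕ → C) (hf : ∀ k ∈ s, Q * (W * π (f k)) = W * π (f k)) :
    Q * (W * π (∑ k ∈ s, f k)) = W * π (∑ k ∈ s, f k) := by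
  rw [map_sum, Finset.mul_sum, Finset.mul_sum]
  exact Finset.sum_congr rfl hf

lemma relT_half (h : PosF Φ) (hx : ∀ k, SP π (x k)) (hy : ∀ k, SP π (y k)) (W1 W2 : R)
    (u1 : star W1 * W1 = 1) (u1' : W1 * star W1 = 1) (u2 : star W2 * W2 = 1) (u2' : W2 * star W2 = 1)
    (r1x : ∀ i, π (2 * x i - 1) * W1 = W1 * π ((2 * x i - 1) * (2 * y i - 1)))
    (r1y : ∀ i, π (y i) * W1 = W1 * π (y i))
    (r2x : ∀ i, π (2 * x i - 1) * W2 = W2 * π ((2 * x i - 1) * (2 * y (i+1) - 1)))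
    (r2y : ∀ i, π (y i) * W2 = W2 * π (y i))
    (ε : ℝ) (e1 : nrm Φ (W1 - 1) ≤ ε) (e2 : nrm Φ (W2 - 1) ≤ ε) (e3 : nrm Φ (1 - π (y 0)) ≤ ε) (K : ℕ) :
    nrm Φ (π (∑ k ∈ Finset.range K, pp x y k * (x k * (1 - y k)))) ^ 2 +
      nrm Φ (π (∑ k ∈ Finset.range K, pp x y k * ((1 - x k) * (1 - y k)))) ^ 2
      ≤ (nrm Φ (π (∑ k ∈ Finset.range K, pp x y k * ((1 - x k) * y k))) + ε) ^ 2 + ε ^ 2 ∧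
    nrm Φ (π (∑ k ∈ Finset.range K, pp x y k * (x k * (1 - y k)))) ≤
      nrm Φ (π (∑ k ∈ Finset.range K, pp x y k * ((1 - x k) * (1 - y k)))) + ε := by
  have hx1 := fun k => (hx k).1
  have hy1 := fun k => (hy k).1
  have hp := pp_SP hx hy
  have hp1 := fun k => (hp k).1
  have hε : 0 ≤ ε := (nrm_nonneg _).trans e1
  set p := pp x y with hpdef
  have sA : ∀ k, SP π (p k * (x k * (1 - y k))) := fun k => (hp k).mul ((hx k).mul (hy k).one_sub)
  have sB : ∀ k, SP π (p k * ((1 - x k) * y k)) := fun k => (hp k).mul ((hx k).one_sub.mul (hy k))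
  have sC : ∀ k, SP π (p k * ((1 - x k) * (1 - y k))) := fun k =>
    (hp k).mul ((hx k).one_sub.mul (hy k).one_sub)
  have sD : ∀ k, SP π (p k * (1 - y k)) := fun k => (hp k).mul (hy k).one_sub
  have oA := pp_orth (f := fun k => p k * (x k * (1 - y k))) hx hy
    (fun k => by linear_combination p k * x k ^ 2 * hy1 k) (fun k => by linear_combination x k * (1 - y k) * hp1 k)
  have oB := pp_orth (f := fun k => p k * ((1 - x k) * y k)) hx hy
    (fun k => by linear_combination p k * y k ^ 2 * hx1 k) (fun k => by linear_combination (1 - x k) * y k * hp1 k)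
  have oC := pp_orth (f := fun k => p k * ((1 - x k) * (1 - y k))) hx hy
    (fun k => by linear_combination p k * (y k - y k ^ 2) * hx1 k) (fun k => by linear_combination (1 - x k) * (1 - y k) * hp1 k)
  have oD := pp_orth (f := fun k => p k * (1 - y k)) hx hy
    (fun k => by linear_combination p k * x k * hy1 k) (fun k => by linear_combination (1 - y k) * hp1 k)
  set a := ∑ k ∈ Finset.range K, p k * (x k * (1 - y k)) with ha
  set b := ∑ k ∈ Finset.range K, p k * ((1 - x k) * y k) with hb
  set c := ∑ k ∈ Finset.range K, p k * ((1 - x k) * (1 - y k)) with hc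
  have saK : SP π a := SP.sum sA oA K
  have sbK : SP π b := SP.sum sB oB K
  have scK : SP π c := SP.sum sC oC K
  -- eigen transfer
  have tW : ∀ (W : R) (s q z : C), π s * W = W * π q → q * z = z → π s * (W * π z) = W * π z := by
    intro W s q z h1 h2
    rw [← mul_assoc, h1, mul_assoc, ← map_mul, h2]
  have tx : ∀ (W : R) (e f g z : C), π (2 * e - 1) * W = W * π ((2 * f - 1) * (2 * g - 1)) →
      f * z = z → g * z = z → π e * (W * π z) = W * π z := by
    intro W e f g z h1 h2 h3
    have h4 := tW W (2 * e - 1) _ z h1 (by linear_combination (4 * g - 2) * h2 + h3 + h3 - 2 * h3 + (2:C) * h3)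
    have h5 : π (2 * e - 1) = (2 : ℂ) • π e - 1 := by
      rw [map_sub, map_one, ← map_smul, Algebra.smul_def, map_ofNat]
    rw [h5, sub_mul, one_mul, sub_eq_iff_eq_add, ← two_smul ℂ, smul_mul_assoc] at h4
    exact smul_right_injective R (two_ne_zero' ℂ) h4
  have tx' : ∀ (W : R) (e f g z : C), π (2 * e - 1) * W = W * π ((2 * f - 1) * (2 * g - 1)) →
      f * z = z → g * z = 0 → π (1 - e) * (W * π z) = W * π z := by
    intro W e f g z h1 h2 h3
    refine tx W (1 - e) f (1 - g) z ?_ h2 (by linear_combination -h3)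
    have e1 : 2 * (1 - e) - 1 = -(2 * e - 1) := by ring
    have e2 : (2 * f - 1) * (2 * (1 - g) - 1) = -((2 * f - 1) * (2 * g - 1)) := by ring
    rw [e1, e2, map_neg, map_neg, neg_mul, h1, mul_neg]
  have pW : ∀ (W : R) (z : C) (n : ℕ), (∀ i < n, π (x i) * (W * π z) = W * π z) →
      (∀ i < n, π (y i) * (W * π z) = W * π z) → π (p n) * (W * π z) = W * π z := by
    intro W z n h1 h2
    induction n with
    | zero => simp [hpdef, pp]
    | succ n ih =>
      rw [hpdef, pp_succ, map_mul, map_mul, mul_assoc, mul_assoc, h2 n (by omega), h1 n (by omega)]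
      exact ih (fun i hi => h1 i (by omega)) (fun i hi => h2 i (by omega))
  constructor
  · -- first
    have hac : nrm Φ (π a) ^ 2 + nrm Φ (π c) ^ 2 = nrm Φ (π (∑ k ∈ Finset.range K, p k * (1 - y k))) ^ 2 := by
      have : ∑ k ∈ Finset.range K, p k * (1 - y k) = a + c := by
        rw [ha, hc, ← Finset.sum_add_distrib]; exact Finset.sum_congr rfl fun k _ => by ring
      rw [this, map_add, nrm_orth h saK.proj]
      rw [← map_mul, ha, hc, Finset.sum_mul_sum]
      rw [Finset.sum_eq_zero, map_zero]
      intro k _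
      apply Finset.sum_eq_zero
      intro l _
      by_cases hkl : k = l
      · subst hkl; linear_combination -(p k ^ 2 * (1 - y k)^2) * hx1 k
      · have := oD k l hkl
        linear_combination x k * (1 - x l) * this
    rw [hac]
    rcases K with _ | K
    · simp [nrm_zero]; positivity
    rw [Finset.sum_range_succ', map_add, add_comm, nrm_orth h (sD 0).proj]
    · have h0 : nrm Φ (π (p 0 * (1 - y 0))) ≤ ε := by
        simpa [hpdef, pp] using e3
      have h1 : nrm Φ (π (∑ k ∈ Finset.range K, p (k+1) * (1 - y (k+1)))) ≤ nrm Φ (π b) + ε := by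
        refine (nrm_shift h (SP.sum (fun k => sD (k+1)) (fun k l hkl => oD _ _ (by omega)) K).proj
          sbK.proj u2 u2' ?_).trans (by gcongr)
        refine sumW _ _ _ _ fun k hk => ?_
        have hk : k < K := by simpa using hk
        have hyk : ∀ i ≤ k, y i * (p (k+1) * (1 - y (k+1))) = p (k+1) * (1 - y (k+1)) := by
          intro i hi
          linear_combination (1 - y (k+1)) * pp_y (x := x) hy (show i < k + 1 by omega)
        have hxk : ∀ i ≤ k, x i * (p (k+1) * (1 - y (k+1))) = p (k+1) * (1 - y (k+1)) := by
          intro i hi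
          linear_combination (1 - y (k+1)) * pp_x (y := y) hx (show i < k + 1 by omega)
        have hB : π (p k * ((1 - x k) * y k)) * (W2 * π (p (k+1) * (1 - y (k+1)))) =
            W2 * π (p (k+1) * (1 - y (k+1))) := by
          rw [map_mul, map_mul, mul_assoc, mul_assoc, tW W2 _ _ _ (r2y k) (hyk k le_rfl),
            tx' W2 _ _ _ _ (r2x k) (hxk k le_rfl) (by linear_combination -p (k+1) * hy1 (k+1))]
          exact pW W2 _ k (fun i hi => tx W2 _ _ _ _ (r2x i) (hxk i hi.le) (hyk (i+1) hi))
            (fun i hi => tW W2 _ _ _ (r2y i) (hyk i hi.le))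
        have hQ : b * (p k * ((1 - x k) * y k)) = p k * ((1 - x k) * y k) :=
          SP.sum_mul sB oB (K+1) k (by omega)
        rw [← hB, ← mul_assoc, ← map_mul, hQ]
      have h2 := nrm_nonneg (Φ := Φ) (π (p 0 * (1 - y 0)))
      have h3 := nrm_nonneg (Φ := Φ) (π (∑ k ∈ Finset.range K, p (k+1) * (1 - y (k+1))))
      rw [add_comm]
      gcongr
    · rw [← map_mul, Finset.mul_sum, Finset.sum_eq_zero, map_zero]
      intro k _; exact oD 0 (k+1) (by omega)
  · refine (nrm_shift h saK.proj scK.proj u1 u1' ?_).trans (by gcongr)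
    refine sumW _ _ _ _ fun k hk => ?_
    have hk : k < K := by simpa using hk
    have hyk : ∀ i < k, y i * (p k * (x k * (1 - y k))) = p k * (x k * (1 - y k)) := by
      intro i hi
      linear_combination (x k * (1 - y k)) * pp_y (x := x) hy hi
    have hxk : ∀ i < k, x i * (p k * (x k * (1 - y k))) = p k * (x k * (1 - y k)) := by
      intro i hi
      linear_combination (x k * (1 - y k)) * pp_x (y := y) hx hi
    have ryk : π (1 - y k) * W1 = W1 * π (1 - y k) := by
      rw [map_sub, map_one, sub_mul, mul_sub, r1y]; simp
    have hB : π (p k * ((1 - x k) * (1 - y k))) * (W1 * π (p k * (x k * (1 - y k)))) =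
        W1 * π (p k * (x k * (1 - y k))) := by
      rw [map_mul, map_mul, mul_assoc, mul_assoc,
        tW W1 _ _ _ ryk (by linear_combination p k * x k * hy1 k),
        tx' W1 _ _ _ _ (r1x k) (by linear_combination p k * (1 - y k) * hx1 k)
          (by linear_combination -p k * x k * hy1 k)]
      exact pW W1 _ k (fun i hi => tx W1 _ _ _ _ (r1x i) (hxk i hi) (hyk i hi))
        (fun i hi => tW W1 _ _ _ (r1y i) (hyk i hi))
    have hQ : c * (p k * ((1 - x k) * (1 - y k))) = p k * ((1 - x k) * (1 - y k)) :=
      SP.sum_mul sC oC K k hk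
    rw [← hB, ← mul_assoc, ← map_mul, hQ]

lemma relT_p (h : PosF Φ) (hx : ∀ k, SP π (x k)) (hy : ∀ k, SP π (y k)) (W1 W2 W3 W4 : R)
    (u1 : star W1 * W1 = 1) (u1' : W1 * star W1 = 1) (u2 : star W2 * W2 = 1) (u2' : W2 * star W2 = 1)
    (u3 : star W3 * W3 = 1) (u3' : W3 * star W3 = 1) (u4 : star W4 * W4 = 1) (u4' : W4 * star W4 = 1)
    (r1x : ∀ i, π (2 * x i - 1) * W1 = W1 * π ((2 * x i - 1) * (2 * y i - 1)))
    (r1y : ∀ i, π (y i) * W1 = W1 * π (y i))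
    (r2x : ∀ i, π (2 * x i - 1) * W2 = W2 * π ((2 * x i - 1) * (2 * y (i+1) - 1)))
    (r2y : ∀ i, π (y i) * W2 = W2 * π (y i))
    (r3x : ∀ i, π (2 * y i - 1) * W3 = W3 * π ((2 * y i - 1) * (2 * x i - 1)))
    (r3y : ∀ i, π (x i) * W3 = W3 * π (x i))
    (r4x : ∀ i, π (2 * y i - 1) * W4 = W4 * π ((2 * y i - 1) * (2 * x (i+1) - 1)))
    (r4y : ∀ i, π (x i) * W4 = W4 * π (x i))
    (ε : ℝ) (e1 : nrm Φ (W1 - 1) ≤ ε) (e2 : nrm Φ (W2 - 1) ≤ ε) (e3 : nrm Φ (1 - π (y 0)) ≤ ε)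
    (f1 : nrm Φ (W3 - 1) ≤ ε) (f2 : nrm Φ (W4 - 1) ≤ ε) (f3 : nrm Φ (1 - π (x 0)) ≤ ε) (K : ℕ) :
    nrm Φ (1 - π (pp x y K)) ^ 2 ≤ 66 * ε ^ 2 := by
  obtain ⟨g1, g2⟩ := relT_half h hx hy W1 W2 u1 u1' u2 u2' r1x r1y r2x r2y ε e1 e2 e3 K
  obtain ⟨g3, g4⟩ := relT_half h hy hx W3 W4 u3 u3' u4 u4' r3x r3y r4x r4y ε f1 f2 f3 K
  simp only [pp_swap] at g3 g4
  simp only [mul_comm (y _) (1 - x _), mul_comm (1 - y _) (x _), mul_comm (1 - y _) (1 - x _)] at g3 g4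
  have hε : 0 ≤ ε := (nrm_nonneg _).trans e1
  have hp := pp_SP hx hy
  have hx1 := fun k => (hx k).1
  have hy1 := fun k => (hy k).1
  have hp1 := fun k => (hp k).1
  set p := pp x y with hpdef
  have hsum : 1 - p K = ∑ k ∈ Finset.range K, p k * (x k * (1 - y k)) +
      (∑ k ∈ Finset.range K, p k * ((1 - x k) * y k) + ∑ k ∈ Finset.range K, p k * ((1 - x k) * (1 - y k))) := by
    rw [← Finset.sum_add_distrib, ← Finset.sum_add_distrib]
    have : ∀ k ∈ Finset.range K, p k * (x k * (1 - y k)) + (p k * ((1 - x k) * y k) + p k * ((1 - x k) * (1 - y k)))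
        = p k - p (k+1) := fun k _ => by rw [hpdef, pp_succ]; ring
    rw [Finset.sum_congr rfl this, Finset.sum_range_sub']
    simp [hpdef, pp]
  have htri := nrm_add h
  set a := ∑ k ∈ Finset.range K, p k * (x k * (1 - y k)) with ha
  set b := ∑ k ∈ Finset.range K, p k * ((1 - x k) * y k) with hb
  set c := ∑ k ∈ Finset.range K, p k * ((1 - x k) * (1 - y k)) with hc
  have oF : ∀ k l, k ≠ l → p k * (1 - x k * y k) * (p l * (1 - x l * y l)) = 0 := by
    refine pp_orth (f := fun k => p k * (1 - x k * y k)) hx hy ?_ ?_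
    · intro k; linear_combination p k * x k ^ 2 * hy1 k + p k * y k * hx1 k
    · intro k; linear_combination (1 - x k * y k) * hp1 k
  have sA : ∀ k, SP π (p k * (x k * (1 - y k))) := fun k => (hp k).mul ((hx k).mul (hy k).one_sub)
  have sB : ∀ k, SP π (p k * ((1 - x k) * y k)) := fun k => (hp k).mul ((hx k).one_sub.mul (hy k))
  have oA := pp_orth (f := fun k => p k * (x k * (1 - y k))) hx hy
    (fun k => by linear_combination p k * x k ^ 2 * hy1 k) (fun k => by linear_combination x k * (1 - y k) * hp1 k)
  have oB := pp_orth (f := fun k => p k * ((1 - x k) * y k)) hx hy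
    (fun k => by linear_combination p k * y k ^ 2 * hx1 k) (fun k => by linear_combination (1 - x k) * y k * hp1 k)
  have saK : SP π a := SP.sum sA oA K
  have sbK : SP π b := SP.sum sB oB K
  have hz : ∀ f g : ℕ → C, (∀ k, f k * (1 - x k * y k) = f k) → (∀ k, g k * (1 - x k * y k) = g k) →
      (∀ k, f k * g k = 0) → (∑ k ∈ Finset.range K, p k * f k) * (∑ k ∈ Finset.range K, p k * g k) = 0 := by
    intro f g hf hg hfg
    rw [Finset.sum_mul_sum]
    refine Finset.sum_eq_zero fun k _ => Finset.sum_eq_zero fun l _ => ?_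
    by_cases hkl : k = l
    · subst hkl; linear_combination p k ^ 2 * hfg k
    · rw [← hf, ← hg]
      linear_combination f k * g l * oF k l hkl
  have fA : ∀ k, x k * (1 - y k) * (1 - x k * y k) = x k * (1 - y k) := fun k => by
    linear_combination x k ^ 2 * hy1 k
  have fB : ∀ k, (1 - x k) * y k * (1 - x k * y k) = (1 - x k) * y k := fun k => by
    linear_combination y k ^ 2 * hx1 k
  have fC : ∀ k, (1 - x k) * (1 - y k) * (1 - x k * y k) = (1 - x k) * (1 - y k) := fun k => by
    linear_combination (y k - y k ^ 2) * hx1 k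
  have zab : a * b = 0 := hz _ _ fA fB (fun k => by linear_combination -(y k * (1 - y k)) * hx1 k)
  have zac : a * c = 0 := hz _ _ fA fC (fun k => by linear_combination -((1 - y k)^2) * hx1 k)
  have zbc : b * c = 0 := hz _ _ fB fC (fun k => by linear_combination -((1 - x k)^2) * hy1 k)
  have htot : nrm Φ (1 - π (p K)) ^ 2 = nrm Φ (π a) ^ 2 + (nrm Φ (π b) ^ 2 + nrm Φ (π c) ^ 2) := by
    rw [← map_one π, ← map_sub, hsum, map_add, nrm_orth h saK.proj, map_add, nrm_orth h sbK.proj]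
    · rw [← map_mul, zbc, map_zero]
    · rw [← map_mul, mul_add, zab, zac]; simp
  rw [htot]
  have na := nrm_nonneg (Φ := Φ) (π a)
  have nb := nrm_nonneg (Φ := Φ) (π b)
  have nc := nrm_nonneg (Φ := Φ) (π c)
  have hc4 : nrm Φ (π c) ≤ 4 * ε := by
    by_contra hcon
    push Not at hcon
    nlinarith
  nlinarith

end relT
end CN

namespace CN

section relT
open ComplexOrder Polynomial

variable {R : Type*} [Ring R] [StarRing R] [Algebra ℂ R] [StarModule ℂ R] {Φ : R →ₗ[ℂ] ℂ}

/-- the coefficient ring -/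
abbrev F2 := (ZMod 2)[X]

lemma f2_add_self (x : F2) : x + x = 0 := CharTwo.add_self_eq_zero x

lemma gap_bound (h : PosF Φ) {ι : Type*} [Fintype ι] [DecidableEq ι] (x : ι → R) (a δ : ℝ)
    (hx : ∀ i, nrm Φ (x i) ^ 2 ≤ a) (hg : (Fintype.card ι ^ 2) * a - δ ≤ nrm Φ (∑ i, x i) ^ 2) (i j : ι) :
    a - δ ≤ (Φ (star (x i) * x j)).re := by
  have ha : 0 ≤ a := (sq_nonneg _).trans (hx i)
  have h1 : nrm Φ (∑ i, x i) ^ 2 = ∑ q : ι × ι, (Φ (star (x q.1) * x q.2)).re := by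
    rw [nrm_sq h, star_sum, Finset.sum_mul_sum, Fintype.sum_prod_type, map_sum, Complex.re_sum]
    refine Finset.sum_congr rfl fun i _ => ?_
    rw [map_sum, Complex.re_sum]
  have h2 : ∀ q : ι × ι, (Φ (star (x q.1) * x q.2)).re ≤ a := by
    intro q
    refine ((Complex.re_le_norm _).trans (posF_cs h _ _)).trans ?_
    nlinarith [hx q.1, hx q.2, nrm_nonneg (Φ := Φ) (x q.1), nrm_nonneg (Φ := Φ) (x q.2),
      sq_nonneg (nrm Φ (x q.1) - nrm Φ (x q.2))]
  have h3 : ∑ q : ι × ι, (a - (Φ (star (x q.1) * x q.2)).re) ≤ δ := by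
    rw [Finset.sum_sub_distrib, ← h1]
    simp only [Finset.sum_const, Finset.card_univ, Fintype.card_prod, nsmul_eq_mul]
    push_cast
    nlinarith
  have h4 := Finset.single_le_sum (f := fun q : ι × ι => (a - (Φ (star (x q.1) * x q.2)).re))
    (fun q _ => sub_nonneg.2 (h2 q)) (Finset.mem_univ (i, j))
  simp only at h4
  linarith

theorem relT_main (h : PosF Φ) {Γ : Type*} [Group Γ] (U : Γ → R) (hU : ∀ g k, U g * U k = U (g * k))
    (hUs : ∀ g, star (U g) = U g⁻¹) (α : Multiplicative (F2 × F2) →* Γ) (w1 w2 w3 w4 b : Γ)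
    (c : F2 → Γ)
    (r1 : ∀ x y, α (.ofAdd (x, y)) * w1 = w1 * α (.ofAdd (x, x + y)))
    (r2 : ∀ x y, α (.ofAdd (x, y)) * w2 = w2 * α (.ofAdd (x, X * x + y)))
    (r3 : ∀ x y, α (.ofAdd (x, y)) * w3 = w3 * α (.ofAdd (x + y, y)))
    (r4 : ∀ x y, α (.ofAdd (x, y)) * w4 = w4 * α (.ofAdd (x + X * y, y)))
    (hc : ∀ r, c r = α (.ofAdd (r, 0)) * b * (α (.ofAdd (r, 0)))⁻¹ * b⁻¹)
    (hgap : (64 - 1 / 10368) * nrm Φ 1 ^ 2 <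
      nrm Φ (∑ j : Fin 8, U (![1, α (.ofAdd (1, 0)), α (.ofAdd (0, 1)), b, w1, w2, w3, w4] j)) ^ 2) (r : F2) :
    0 < (Φ (U (c r))).re := by
  classical
  set s : Fin 8 → Γ := ![1, α (.ofAdd (1, 0)), α (.ofAdd (0, 1)), b, w1, w2, w3, w4] with hs
  have hU1 : IsStarProjection (U 1) := ⟨show U 1 * U 1 = U 1 by rw [hU, mul_one], by
    show star (U 1) = U 1; rw [hUs, inv_one]⟩
  have hle : ∀ g, nrm Φ (U g) ^ 2 ≤ nrm Φ 1 ^ 2 := by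
    intro g
    have : nrm Φ (U g) ^ 2 = nrm Φ (U 1) ^ 2 := by
      rw [nrm_sq h, nrm_sq h, hUs, hUs, hU, hU]; simp
    rw [this]
    have := nrm_proj_le h hU1 (1 : R)
    rw [mul_one] at this
    have h0 := nrm_nonneg (Φ := Φ) (U 1)
    gcongr
  set m := nrm Φ 1 with hm
  have hm0 : 0 ≤ m := nrm_nonneg _
  have hgb := gap_bound h (fun j => U (s j)) (m ^ 2) (1 / 10368 * m ^ 2) (fun j => hle _)
    (by simp only [Fintype.card_fin]; norm_num; norm_num at hgap; linarith)
  have hmpos : 0 < m := by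
    rcases hm0.eq_or_lt with h0 | h0
    · exfalso
      have : nrm Φ (∑ j, U (s j)) ≤ 0 := by
        refine (nrm_sum h _ _).trans (Finset.sum_nonpos fun j _ => ?_)
        have := hle (s j)
        rw [← h0] at this
        nlinarith [nrm_nonneg (Φ := Φ) (U (s j))]
      have h' := nrm_nonneg (Φ := Φ) (∑ j, U (s j))
      have : nrm Φ (∑ j, U (s j)) = 0 := le_antisymm this h'
      rw [this, ← h0] at hgap
      norm_num at hgap
    · exact h0
  set ε := m / 72 with hε
  have hε0 : 0 ≤ ε := by positivity
  -- closeness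
  have hs0 : s 0 = 1 := rfl
  have hclose : ∀ j, nrm Φ (U (s j) - U 1) ≤ ε := by
    intro j
    refine (le_abs_self _).trans (abs_le_of_sq_le_sq ?_ hε0)
    rw [nrm_sq h, star_sub, sub_mul, mul_sub, mul_sub, map_sub, map_sub, map_sub, Complex.sub_re, Complex.sub_re,
      Complex.sub_re, ← nrm_sq h, ← nrm_sq h]
    have g1 := hgb 0 j
    have g2 := hgb j 0
    simp only [hs0] at g1 g2
    have g3 := hle (s j)
    have g4 := hle 1
    rw [hε]
    nlinarith
  have hone : (Φ (1 - U 1)).re ≤ 1 / 10368 * m ^ 2 := by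
    have g1 := hgb 0 0
    simp only [hs0, hU1.2.star_eq, hU1.1.eq] at g1
    rw [map_sub, Complex.sub_re, ← nrm_one_sq h]
    linarith
  -- the unitary representation
  let V : Γ →* R :=
    { toFun := fun g => U g + (1 - U 1)
      map_one' := by abel
      map_mul' := by
        intro g k
        have e1 : U g * U 1 = U g := by rw [hU, mul_one]
        have e2 : U 1 * U k = U k := by rw [hU, one_mul]
        have e3 : U 1 * U 1 = U 1 := hU1.1.eq
        have e4 : (U g + (1 - U 1)) * (U k + (1 - U 1)) = U g * U k + (U g - U g * U 1) + (U k - U 1 * U k)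
          + (1 - U 1 - U 1 + U 1 * U 1) := by noncomm_ring
        rw [e4, hU, e1, e2, e3]
        abel }
  have hV : ∀ g, V g = U g + (1 - U 1) := fun g => rfl
  have hVs : ∀ g, star (V g) = V g⁻¹ := by
    intro g; rw [hV, hV, star_add, star_sub, star_one, hUs, hU1.2.star_eq]
  have hVu : ∀ g, star (V g) * V g = 1 := by intro g; rw [hVs, ← map_mul]; simp
  have hVu' : ∀ g, V g * star (V g) = 1 := by intro g; rw [hVs, ← map_mul]; simp
  have hVc : ∀ j, nrm Φ (V (s j) - 1) ≤ ε := by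
    intro j
    have : V (s j) - 1 = U (s j) - U 1 := by rw [hV]; abel
    rw [this]; exact hclose j
  let C := MonoidAlgebra ℂ (Multiplicative (F2 × F2))
  let π : C →ₐ[ℂ] R := MonoidAlgebra.lift ℂ R _ (V.comp α)
  let o : Multiplicative (F2 × F2) →* C := MonoidAlgebra.of ℂ _
  have hπ : ∀ g, π (o g) = V (α g) := fun g => by
    show MonoidAlgebra.lift ℂ R _ (V.comp α) (MonoidAlgebra.of ℂ _ g) = _
    rw [MonoidAlgebra.lift_of]; rfl
  have hoo : ∀ z : F2 × F2, o (.ofAdd z) * o (.ofAdd z) = 1 := by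
    intro z
    rw [← map_mul, ← ofAdd_add, show z + z = 0 from Prod.ext (f2_add_self _) (f2_add_self _)]
    simp
  have hself : ∀ z : F2 × F2, star (π (o (.ofAdd z))) = π (o (.ofAdd z)) := by
    intro z
    have e : V (α (.ofAdd z)) * V (α (.ofAdd z)) = 1 := by rw [← hπ, ← map_mul, hoo, map_one]
    rw [hπ]
    calc star (V (α (.ofAdd z))) = star (V (α (.ofAdd z))) * (V (α (.ofAdd z)) * V (α (.ofAdd z))) := by
          rw [e, mul_one]
      _ = _ := by rw [← mul_assoc, hVu, one_mul]
  let hf : F2 × F2 → C := fun z => (1 / 2 : ℂ) • (1 + o (.ofAdd z))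
  have htwo : ∀ z, 2 * hf z - 1 = o (.ofAdd z) := by
    intro z
    have : (2 : C) * hf z = (2 : ℂ) • hf z := by rw [Algebra.smul_def, map_ofNat]
    rw [this]; simp only [hf]; rw [smul_smul]; norm_num
  have hfSP : ∀ z, SP π (hf z) := by
    intro z
    refine ⟨?_, ?_⟩
    · simp only [hf]
      rw [smul_mul_smul_comm, show (1 + o (.ofAdd z)) * (1 + o (.ofAdd z)) = (2 : ℂ) • (1 + o (.ofAdd z)) by
        rw [two_smul]; linear_combination hoo z, smul_smul]
      norm_num
    · simp only [hf]
      rw [map_smul, star_smul, map_add, star_add, hself, map_one, star_one]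
      simp
  have hfclose : ∀ z j, s j = α (.ofAdd z) → nrm Φ (1 - π (hf z)) ≤ ε := by
    intro z j hj
    have e : 1 - π (hf z) = (-(1 / 2 : ℂ)) • (V (s j) - 1) := by
      simp only [hf]
      rw [hj, map_smul, map_add, map_one, hπ, smul_sub, smul_add]
      module
    rw [e, nrm_smul]
    have := hVc j
    have h0 := nrm_nonneg (Φ := Φ) (V (s j) - 1)
    norm_num
    linarith
  let x : ℕ → C := fun k => hf (X ^ k, 0)
  let y : ℕ → C := fun k => hf (0, X ^ k)
  have rel : ∀ (z z' : F2 × F2) (w : Γ), α (.ofAdd z) * w = w * α (.ofAdd z') →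
      π (2 * hf z - 1) * V w = V w * π (2 * hf z' - 1) := by
    intro z z' w hw
    rw [htwo, htwo, hπ, hπ, ← map_mul, hw, map_mul]
  have rel1 : ∀ (z z' z'' : F2 × F2) (w : Γ), α (.ofAdd z) * w = w * α (.ofAdd (z' + z'')) →
      π (2 * hf z - 1) * V w = V w * π ((2 * hf z' - 1) * (2 * hf z'' - 1)) := by
    intro z z' z'' w hw
    rw [rel z _ w hw, htwo, htwo, htwo, ofAdd_add, map_mul o]
  have rel2 : ∀ (z : F2 × F2) (w : Γ), α (.ofAdd z) * w = w * α (.ofAdd z) →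
      π (hf z) * V w = V w * π (hf z) := by
    intro z w hw
    simp only [hf, map_smul, map_add, map_one, hπ]
    rw [smul_mul_assoc, mul_smul_comm, add_mul, mul_add, ← map_mul, hw, map_mul]
    simp
  have key := relT_p (x := x) (y := y) h (fun k => hfSP _) (fun k => hfSP _) (V w1) (V w2) (V w3) (V w4)
    (hVu _) (hVu' _) (hVu _) (hVu' _) (hVu _) (hVu' _) (hVu _) (hVu' _)
    (fun i => rel1 _ _ _ _ (by rw [r1]; simp))
    (fun i => rel2 _ _ (by rw [r1]; simp))
    (fun i => rel1 _ _ _ _ (by rw [r2]; simp [pow_succ']))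
    (fun i => rel2 _ _ (by rw [r2]; simp))
    (fun i => rel1 _ _ _ _ (by rw [r3]; simp))
    (fun i => rel2 _ _ (by rw [r3]; simp))
    (fun i => rel1 _ _ _ _ (by rw [r4]; simp [pow_succ']))
    (fun i => rel2 _ _ (by rw [r4]; simp))
    ε (hVc 4) (hVc 5) (hfclose _ 2 (by simp [hs]))
    (hVc 6) (hVc 7) (hfclose _ 1 (by simp [hs]))
  -- fixed vectors
  have hfix : ∀ K, ∀ q : F2, q.natDegree < K → pp x y K * o (.ofAdd (q, 0)) = pp x y K := by
    intro K q hq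
    have hX : ∀ i < K, pp x y K * o (.ofAdd (X ^ i, 0)) = pp x y K := by
      intro i hi
      have := pp_x (π := π) (x := x) (y := y) (fun k => hfSP _) hi
      have h2 : (2 * x i - 1) = o (.ofAdd (X ^ i, 0)) := htwo _
      rw [← h2]; linear_combination 2 * this
    have hsum : ∀ n ≤ K, pp x y K * o (.ofAdd (∑ i ∈ Finset.range n, Polynomial.C (q.coeff i) * X ^ i, 0)) = pp x y K := by
      intro n hn
      induction n with
      | zero => simp only [Finset.range_zero, Finset.sum_empty]; rw [show ((0 : F2), (0 : F2)) = 0 from rfl]; simp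
      | succ n ih =>
        rw [Finset.sum_range_succ, show ∀ a b : F2, (a + b, (0:F2)) = (a, 0) + (b, 0) by intro a b; simp,
          ofAdd_add, map_mul, ← mul_assoc, ih (by omega)]
        have : q.coeff n = 0 ∨ q.coeff n = 1 := by
          generalize q.coeff n = z; revert z; decide
        rcases this with h0 | h0
        · rw [h0, map_zero, zero_mul, show ((0 : F2), (0 : F2)) = 0 from rfl]; simp
        · rw [h0, map_one, one_mul]; exact hX n (by omega)
    have := hsum K le_rfl
    rwa [← Polynomial.as_sum_range_C_mul_X_pow' q hq] at this
  have hα : ∀ q : F2, nrm Φ (V (α (.ofAdd (q, 0))) - 1) ≤ 17 * ε := by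
    intro q
    set K := q.natDegree + 1
    have e1 := key K
    set p := π (pp x y K) with hp
    have e2 : V (α (.ofAdd (q, 0))) * p = p := by
      rw [← hπ, hp, ← map_mul, mul_comm, hfix K q (by omega)]
    have e3 : V (α (.ofAdd (q, 0))) - 1 = V (α (.ofAdd (q, 0))) * (1 - p) - (1 - p) := by
      rw [mul_sub, e2, mul_one]; abel
    rw [e3]
    refine (nrm_sub h _ _).trans ?_
    rw [nrm_unitary_mul (hVu _)]
    have : nrm Φ (1 - p) ≤ 8.5 * ε := by
      refine (le_abs_self _).trans (abs_le_of_sq_le_sq ?_ (by positivity))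
      nlinarith [sq_nonneg ε]
    linarith
  have hcr : nrm Φ (V (c r) - 1) ≤ 36 * ε := by
    have hmul : ∀ g k, nrm Φ (V (g * k) - 1) ≤ nrm Φ (V g - 1) + nrm Φ (V k - 1) := by
      intro g k
      have : V (g * k) - 1 = V g * (V k - 1) + (V g - 1) := by rw [map_mul, mul_sub, mul_one]; abel
      rw [this]
      refine (nrm_add h _ _).trans ?_
      rw [nrm_unitary_mul (hVu _)]; linarith
    have hinv : ∀ g, nrm Φ (V g⁻¹ - 1) = nrm Φ (V g - 1) := by
      intro g
      rw [← nrm_unitary_mul (hVu g), mul_sub, ← map_mul, mul_inv_cancel, map_one, mul_one, nrm_sub_comm]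
    rw [hc]
    have h1 := hmul (α (.ofAdd (r, 0)) * b * (α (.ofAdd (r, 0)))⁻¹) b⁻¹
    have h2 := hmul (α (.ofAdd (r, 0)) * b) (α (.ofAdd (r, 0)))⁻¹
    have h3 := hmul (α (.ofAdd (r, 0))) b
    rw [hinv] at h1 h2
    have h4 := hα r
    have h5 : nrm Φ (V b - 1) ≤ ε := hVc 3
    linarith
  have hfin : ‖Φ (V (c r) - 1)‖ ≤ m * (36 * ε) := (posF_cs1 h _).trans (by gcongr)
  have hre : |(Φ (V (c r) - 1)).re| ≤ m * (36 * ε) := (Complex.abs_re_le_norm _).trans hfin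
  have e : U (c r) = (V (c r) - 1) + 1 - (1 - U 1) := by rw [hV]; abel
  rw [e, map_sub, map_add, Complex.sub_re, Complex.add_re, ← nrm_one_sq h]
  have := (abs_le.1 hre).1
  have hm2 : 0 < m ^ 2 := by positivity
  have : m * (36 * ε) = m ^ 2 / 2 := by rw [hε]; ring
  nlinarith

end relT
end CN

namespace CN

section comm
open ComplexOrder ContinuousLinearMap

variable {ℋ : Type*} [NormedAddCommGroup ℋ] [InnerProductSpace ℂ ℋ] [CompleteSpace ℋ]

lemma hmulA {H : Type*} [NormedAddCommGroup H] [InnerProductSpace ℂ H] (f g : H →L[ℂ] H) (x : H) : (f * g) x = f (g x) := rfl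

lemma comm_S_bound {Γ : Type*} [Group Γ] (e : Γ → ℋ) (htot : Dense (Submodule.span ℂ (Set.range e) : Set ℋ))
    (L Rr : Γ → (ℋ →L[ℂ] ℋ)) (hL : ∀ k g, L k (e g) = e (k * g)) (hR : ∀ k g, Rr k (e g) = e (g * k))
    (hLa : ∀ k x y, inner ℂ (L k x) y = inner ℂ x (L k⁻¹ y))
    (hRa : ∀ k x y, inner ℂ (Rr k x) y = inner ℂ x (Rr k⁻¹ y))
    (S : ℋ →L[ℂ] ℋ) (hS : ∀ k x, S (L k x) = L k (S x)) : ‖adjoint S (e 1)‖ ≤ ‖S (e 1)‖ := by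
  have hgram : ∀ a b, inner ℂ (e b⁻¹) (e a⁻¹) = inner ℂ (e a) (e b) := by
    intro a b
    have h1 : inner ℂ (e a) (e b) = inner ℂ (e (b⁻¹ * a)) (e 1) := by
      rw [← hL, hLa, hL]; simp
    rw [h1, ← hR, hRa, hR, one_mul]
  have hkey : ∀ f ∈ Submodule.span ℂ (Set.range e), ‖inner ℂ f (adjoint S (e 1))‖ ≤ ‖S (e 1)‖ * ‖f‖ := by
    intro f hf
    obtain ⟨c, rfl⟩ := Finsupp.mem_span_range_iff_exists_finsupp.1 hf
    set f' := c.sum fun i a => star a • e i⁻¹ with hf'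
    have e1 : inner ℂ (c.sum fun i a => a • e i) (adjoint S (e 1)) = inner ℂ (S (e 1)) f' := by
      rw [adjoint_inner_right, hf', Finsupp.sum, Finsupp.sum, map_sum, sum_inner, inner_sum]
      refine Finset.sum_congr rfl fun b _ => ?_
      rw [map_smul, inner_smul_left, inner_smul_right]
      congr 1
      have : e b = L b (e 1) := by rw [hL, mul_one]
      rw [this, hS, hLa, hL, mul_one]
    have e2 : ‖f'‖ = ‖c.sum fun i a => a • e i‖ := by
      have : (inner ℂ f' f' : ℂ) = inner ℂ (c.sum fun i a => a • e i) (c.sum fun i a => a • e i) := by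
        simp only [hf', Finsupp.sum, sum_inner, inner_sum, inner_smul_left, inner_smul_right, Finset.mul_sum]
        rw [Finset.sum_comm]
        refine Finset.sum_congr rfl fun a _ => Finset.sum_congr rfl fun b _ => ?_
        rw [hgram]
        simp
        ring
      rw [@norm_eq_sqrt_re_inner ℂ, @norm_eq_sqrt_re_inner ℂ, this]
    rw [e1, ← e2]
    exact norm_inner_le_norm _ _
  have hkey2 : ∀ f, ‖inner ℂ f (adjoint S (e 1))‖ ≤ ‖S (e 1)‖ * ‖f‖ := by
    intro f
    refine htot.induction (P := fun f => ‖inner ℂ f (adjoint S (e 1))‖ ≤ ‖S (e 1)‖ * ‖f‖) hkey ?_ f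
    exact isClosed_le (by fun_prop) (by fun_prop)
  have := hkey2 (adjoint S (e 1))
  rw [inner_self_eq_norm_sq_to_K] at this
  simp at this
  rcases (norm_nonneg (adjoint S (e 1))).eq_or_lt with h0 | h0
  · rw [← h0]; exact norm_nonneg _
  · nlinarith

lemma comm_TS {Γ : Type*} [Group Γ] (e : Γ → ℋ) (htot : Dense (Submodule.span ℂ (Set.range e) : Set ℋ))
    (L Rr : Γ → (ℋ →L[ℂ] ℋ)) (hL : ∀ k g, L k (e g) = e (k * g)) (hR : ∀ k g, Rr k (e g) = e (g * k))
    (hLa : ∀ k x y, inner ℂ (L k x) y = inner ℂ x (L k⁻¹ y))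
    (hRa : ∀ k x y, inner ℂ (Rr k x) y = inner ℂ x (Rr k⁻¹ y))
    (T S : ℋ →L[ℂ] ℋ) (hT : ∀ k x, T (Rr k x) = Rr k (T x)) (hS : ∀ k x, S (L k x) = L k (S x)) :
    T * S = S * T := by
  have hLR : ∀ k l x, L k (Rr l x) = Rr l (L k x) := by
    intro k l x
    refine htot.induction (P := fun x => L k (Rr l x) = Rr l (L k x)) ?_ (isClosed_eq (by fun_prop) (by fun_prop)) x
    intro x hx
    induction hx using Submodule.span_induction with
    | mem x hx => obtain ⟨g, rfl⟩ := hx; simp only [hL, hR, mul_assoc]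
    | zero => simp
    | add x y _ _ h1 h2 => simp only [map_add, h1, h2]
    | smul c x _ h1 => simp only [map_smul, h1]
  have key : ∀ T : ℋ →L[ℂ] ℋ, (∀ k x, T (Rr k x) = Rr k (T x)) →
      inner ℂ (e 1) (T (S (e 1))) = inner ℂ (e 1) (S (T (e 1))) := by
    intro T hT
    rw [← sub_eq_zero, ← norm_eq_zero]
    refine le_antisymm (le_of_forall_pos_le_add fun δ hδ => ?_) (norm_nonneg _)
    rw [zero_add]
    set M := ‖adjoint T (e 1)‖ + ‖T (e 1)‖ + 1 with hM
    have hM0 : 0 < M := by positivity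
    obtain ⟨f, hf, hfd⟩ := Metric.mem_closure_iff.1 (htot.closure_eq ▸ Set.mem_univ (S (e 1))) (δ / M) (by positivity)
    obtain ⟨c, rfl⟩ := Finsupp.mem_span_range_iff_exists_finsupp.1 hf
    set S' : ℋ →L[ℂ] ℋ := S - ∑ i ∈ c.support, c i • Rr i with hS'
    have hS'c : ∀ k x, S' (L k x) = L k (S' x) := by
      intro k x
      simp only [hS', sub_apply, sum_apply, smul_apply, map_sub, map_sum, map_smul, hS, hLR]
    have h1 : S' (e 1) = S (e 1) - c.sum fun i a => a • e i := by
      simp [hS', hR, Finsupp.sum]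
    have h2 : ‖S' (e 1)‖ ≤ δ / M := by rw [h1, ← dist_eq_norm]; exact hfd.le
    have h3 := (comm_S_bound e htot L Rr hL hR hLa hRa S' hS'c).trans h2
    have h4 : inner ℂ (e 1) (T (S (e 1))) - inner ℂ (e 1) (S (T (e 1)))
        = inner ℂ (adjoint T (e 1)) (S' (e 1)) - inner ℂ (adjoint S' (e 1)) (T (e 1)) := by
      rw [adjoint_inner_left, adjoint_inner_left, ← inner_sub_right, ← inner_sub_right]
      congr 1
      simp only [hS', sub_apply, sum_apply, smul_apply, map_sub, map_sum, map_smul, hT]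
      abel
    rw [h4]
    refine (norm_sub_le _ _).trans ?_
    have h5 := norm_inner_le_norm (𝕜 := ℂ) (adjoint T (e 1)) (S' (e 1))
    have h6 := norm_inner_le_norm (𝕜 := ℂ) (adjoint S' (e 1)) (T (e 1))
    have h7 : ‖adjoint T (e 1)‖ * ‖S' (e 1)‖ ≤ ‖adjoint T (e 1)‖ * (δ / M) := by gcongr
    have h8 : ‖adjoint S' (e 1)‖ * ‖T (e 1)‖ ≤ (δ / M) * ‖T (e 1)‖ := by gcongr
    have h9 : M * (δ / M) = δ := by field_simp
    have h10 : 0 < δ / M := by positivity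
    rw [hM] at h9
    linarith
  have hfull : ∀ g h, inner ℂ (e g) (T (S (e h))) = inner ℂ (e g) (S (T (e h))) := by
    intro g h
    have := key (L g⁻¹ * T * L h) (by
      intro k x; simp only [hmulA, hLR, hT])
    simp only [hmulA] at this
    rw [hS, ← hS h, hL, mul_one, ← inv_inv g⁻¹, ← hLa, ← hLa, hL, mul_one, inv_inv] at this
    exact this
  have hext : ∀ z : ℋ, (∀ g, inner ℂ (e g) z = 0) → z = 0 := by
    intro z hz
    have : ∀ x, inner ℂ x z = 0 := by
      intro x
      refine htot.induction (P := fun x => inner ℂ x z = 0) ?_ (isClosed_eq (by fun_prop) (by fun_prop)) x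
      intro x hx
      induction hx using Submodule.span_induction with
      | mem x hx => obtain ⟨g, rfl⟩ := hx; exact hz g
      | zero => simp
      | add x y _ _ h1 h2 => rw [inner_add_left, h1, h2, add_zero]
      | smul c x _ h1 => rw [inner_smul_left, h1, mul_zero]
    exact inner_self_eq_zero.1 (this z)
  ext x
  refine htot.induction (P := fun x => (T * S) x = (S * T) x) ?_ (isClosed_eq (by fun_prop) (by fun_prop)) x
  intro x hx
  induction hx using Submodule.span_induction with
  | mem x hx =>
    obtain ⟨h, rfl⟩ := hx
    rw [← sub_eq_zero]
    refine hext _ fun g => ?_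
    rw [inner_sub_right, hmulA, hmulA, hfull, sub_self]
  | zero => simp
  | add x y _ _ h1 h2 => simp only [map_add, h1, h2]
  | smul c x _ h1 => simp only [map_smul, h1]

variable {K K' : Type*} [NormedAddCommGroup K] [InnerProductSpace ℂ K] [CompleteSpace K]
  [NormedAddCommGroup K'] [InnerProductSpace ℂ K'] [CompleteSpace K']

lemma comm_pos {m : ℕ} (a : Fin m → (ℋ →L[ℂ] K)) (b : Fin m → (ℋ →L[ℂ] K'))
    (hc : ∀ i j k l, (adjoint (a i) ∘L a j) * (adjoint (b k) ∘L b l) = (adjoint (b k) ∘L b l) * (adjoint (a i) ∘L a j))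
    (w : ℋ) : 0 ≤ ∑ i, ∑ j, inner ℂ w (((adjoint (a i) ∘L a j) * (adjoint (b i) ∘L b j)) w) := by
  classical
  let E := PiLp 2 (fun _ : Fin m => ℋ)
  let pr : Fin m → (E →L[ℂ] ℋ) := fun i => PiLp.proj 2 (fun _ : Fin m => ℋ) i
  have hpr : ∀ i (z : E), pr i z = z i := fun _ _ => rfl
  let ι : Fin m → (ℋ →L[ℂ] E) := fun i => adjoint (pr i)
  have hι : ∀ i x, ι i x = PiLp.single 2 i x := by
    intro i x
    refine ext_inner_right ℂ fun z => ?_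
    rw [adjoint_inner_left, PiLp.inner_apply, Finset.sum_eq_single i]
    · simp [hpr]
    · intro j _ hj; simp [hj]
    · simp
  have hprι : ∀ i j x, pr i (ι j x) = if i = j then x else 0 := by
    intro i j x
    rw [hι]
    by_cases h : i = j
    · subst h; simp [hpr]
    · simp [hpr, h]
  let D : E →L[ℂ] K' := ∑ j, b j ∘L pr j
  let St : E →L[ℂ] E := adjoint D ∘L D
  have hSt0 : 0 ≤ St := (nonneg_iff_isPositive _).2 (isPositive_adjoint_comp_self D)
  have hStx : ∀ x, St x = ∑ k, ι k (adjoint (b k) (∑ l, b l (pr l x))) := by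
    intro x
    simp only [St, D, comp_apply, map_sum, adjoint_comp, sum_apply]
    rw [Finset.sum_comm]
  let Tt : (ℋ →L[ℂ] ℋ) → (E →L[ℂ] E) := fun T => ∑ k, ι k ∘L T ∘L pr k
  have hTtx : ∀ T x, Tt T x = ∑ k, ι k (T (pr k x)) := by
    intro T x; simp [Tt]
  have hprsum : ∀ (i : Fin m) (y : Fin m → ℋ), pr i (∑ k, ι k (y k)) = y i := by
    intro i y
    simp [map_sum, hprι]
  have hcomm : ∀ i j, Commute St (Tt (adjoint (a i) ∘L a j)) := by
    intro i j
    ext1 x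
    rw [hmulA, hmulA, hStx, hTtx (adjoint (a i) ∘L a j) (St x), hStx]
    refine Finset.sum_congr rfl fun k _ => ?_
    rw [hprsum, hTtx]
    congr 1
    simp only [hprsum, map_sum]
    refine Finset.sum_congr rfl fun l _ => ?_
    have := congrArg (fun f : ℋ →L[ℂ] ℋ => f (pr l x)) (hc i j k l)
    simpa using this.symm
  set C := CFC.sqrt St with hC
  have hCC : C * C = St := CFC.sqrt_mul_sqrt_self St hSt0
  have hCs : IsSelfAdjoint C := IsSelfAdjoint.of_nonneg (CFC.sqrt_nonneg St)
  have hCT : ∀ i j, Commute C (Tt (adjoint (a i) ∘L a j)) := fun i j => by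
    rw [hC, CFC.sqrt]; exact (hcomm i j).cfcₙ_nnreal _
  have hterm : ∀ i j, inner ℂ w (((adjoint (a i) ∘L a j) * (adjoint (b i) ∘L b j)) w) =
      ∑ k, inner ℂ (a i (pr k (C (ι i w)))) (a j (pr k (C (ι j w)))) := by
    intro i j
    have h1 : (adjoint (b i) ∘L b j) w = pr i (St (ι j w)) := by
      rw [hStx, hprsum, Finset.sum_eq_single j]
      · simp [hprι]
      · intro l _ hl; simp [hprι, hl]
      · simp
    have h2 : ∀ (T : ℋ →L[ℂ] ℋ) x, T (pr i x) = pr i (Tt T x) := by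
      intro T x; rw [hTtx, hprsum]
    have h3 : Tt (adjoint (a i) ∘L a j) (St (ι j w)) = C (Tt (adjoint (a i) ∘L a j) (C (ι j w))) := by
      rw [← hCC, ← hmulA, ← hmulA, ← hmulA, ← mul_assoc, (hCT i j).eq, mul_assoc]
    rw [hmulA, h1, h2, h3, ← adjoint_inner_left, ← adjoint_inner_left]
    rw [show adjoint C = C from hCs]
    rw [PiLp.inner_apply]
    refine Finset.sum_congr rfl fun k _ => ?_
    have h4 : (Tt (adjoint (a i) ∘L a j) (C (ι j w))) k = (adjoint (a i) ∘L a j) (pr k (C (ι j w))) := by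
      show pr k _ = _
      rw [hTtx, hprsum]
    rw [h4, comp_apply, adjoint_inner_right]
    rfl
  have : ∑ i, ∑ j, inner ℂ w (((adjoint (a i) ∘L a j) * (adjoint (b i) ∘L b j)) w) =
      ∑ k, inner ℂ (∑ i, a i (pr k (C (ι i w)))) (∑ i, a i (pr k (C (ι i w)))) := by
    simp only [hterm]
    simp_rw [sum_inner]
    conv_rhs => rw [Finset.sum_comm]
    simp_rw [inner_sum]
    refine Finset.sum_congr rfl fun i _ => ?_
    rw [Finset.sum_comm]
  rw [this]
  refine Finset.sum_nonneg fun k _ => ?_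
  rw [inner_self_eq_norm_sq_to_K]
  positivity

end comm
end CN

namespace CN

section setup
open ComplexOrder ContinuousLinearMap

lemma exists_gns {A : Type u} [CStarAlgebra A] (ψ : A →ₗ[ℂ] ℂ) (hψ : PosF ψ) :
    ∃ (K : Type u) (_ : NormedAddCommGroup K) (_ : InnerProductSpace ℂ K) (_ : CompleteSpace K)
      (π : A →⋆ₐ[ℂ] (K →L[ℂ] K)) (ξ : K), ∀ a, inner ℂ ξ (π a ξ) = ψ a := by
  letI := CStarAlgebra.spectralOrder A
  haveI := CStarAlgebra.spectralOrderedRing A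
  let f : A →ₚ[ℂ] ℂ := PositiveLinearMap.mk₀ ψ (fun x hx => by
    obtain ⟨y, rfl⟩ := CStarAlgebra.nonneg_iff_eq_star_mul_self.1 hx
    exact hψ y)
  refine ⟨f.GNS, inferInstance, inferInstance, inferInstance, f.gnsStarAlgHom, ((f.toPreGNS 1 : f.PreGNS) : f.GNS), fun a => ?_⟩
  have h1 : f.gnsStarAlgHom a ((f.toPreGNS 1 : f.PreGNS) : f.GNS) = ((f.leftMulMapPreGNS a (f.toPreGNS 1) : f.PreGNS) : f.GNS) :=
    PositiveLinearMap.gnsNonUnitalStarAlgHom_apply_coe f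
  rw [h1, UniformSpace.Completion.inner_coe, PositiveLinearMap.preGNS_inner_def]
  simp
  rfl

variable {K : Type u} {K' : Type v} [NormedAddCommGroup K] [InnerProductSpace ℂ K] [CompleteSpace K]
  [NormedAddCommGroup K'] [InnerProductSpace ℂ K'] [CompleteSpace K']

lemma dense_setup {Γ : Type*} [Countable Γ] (p : Γ → K) (q : Γ → K')
    (hpq : ∀ g h, inner ℂ (p g) (p h) = (inner ℂ (q g) (q h) : ℂ)) :
    ∃ (ℋ : Type (max u v)) (_ : NormedAddCommGroup ℋ) (_ : InnerProductSpace ℂ ℋ) (_ : CompleteSpace ℋ)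
      (_ : TopologicalSpace.SeparableSpace ℋ) (V : ℋ →L[ℂ] K) (V' : ℋ →L[ℂ] K') (e : Γ → ℋ),
      Dense (Submodule.span ℂ (Set.range e) : Set ℋ) ∧ (∀ g, V (e g) = p g) ∧ (∀ g, V' (e g) = q g) ∧
      (∀ x, adjoint V (V x) = (1/2 : ℂ) • x) ∧ (∀ x, adjoint V' (V' x) = (1/2 : ℂ) • x) := by
  let E := WithLp 2 (K × K')
  let e0 : Γ → E := fun g => WithLp.toLp 2 (p g, q g)
  let S : Submodule ℂ E := (Submodule.span ℂ (Set.range e0)).topologicalClosure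
  have hmem : ∀ g, e0 g ∈ S := fun g => Submodule.le_topologicalClosure _ (Submodule.subset_span ⟨g, rfl⟩)
  let e : Γ → S := fun g => ⟨e0 g, hmem g⟩
  haveI : CompleteSpace S := (Submodule.isClosed_topologicalClosure _).completeSpace_coe
  have hsep : TopologicalSpace.SeparableSpace S := by
    have h1 : TopologicalSpace.IsSeparable (S : Set E) := by
      show TopologicalSpace.IsSeparable (closure (Submodule.span ℂ (Set.range e0) : Set E))
      exact ((Set.countable_range e0).isSeparable.span).closure
    exact h1.separableSpace
  let V : S →L[ℂ] K := WithLp.fstL 2 ℂ K K' ∘L S.subtypeL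
  let V' : S →L[ℂ] K' := WithLp.sndL 2 ℂ K K' ∘L S.subtypeL
  have hdense : Dense (Submodule.span ℂ (Set.range e) : Set S) := by
    intro x
    rw [closure_subtype]
    have h2 : (Subtype.val '' (Submodule.span ℂ (Set.range e) : Set S)) = (Submodule.span ℂ (Set.range e0) : Set E) := by
      have : (Submodule.span ℂ (Set.range e)).map S.subtype = Submodule.span ℂ (Set.range e0) := by
        rw [Submodule.map_span, ← Set.range_comp]; rfl
      rw [← this]; rfl
    rw [h2]
    exact x.2
  have hV : ∀ g, V (e g) = p g := fun g => rfl
  have hV' : ∀ g, V' (e g) = q g := fun g => rfl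
  have hin : ∀ x y : S, inner ℂ x y = inner ℂ (V x) (V y) + (inner ℂ (V' x) (V' y) : ℂ) := by
    intro x y
    exact WithLp.prod_inner_apply _ _
  have heq : ∀ x y : S, inner ℂ (V x) (V y) = (inner ℂ (V' x) (V' y) : ℂ) := by
    intro x y
    refine hdense.induction (P := fun x => inner ℂ (V x) (V y) = (inner ℂ (V' x) (V' y) : ℂ)) ?_ (isClosed_eq (by fun_prop) (by fun_prop)) x
    intro x hx
    refine hdense.induction (P := fun y => inner ℂ (V x) (V y) = (inner ℂ (V' x) (V' y) : ℂ)) ?_ (isClosed_eq (by fun_prop) (by fun_prop)) y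
    intro y hy
    induction hx using Submodule.span_induction with
    | mem x hx =>
      obtain ⟨g, rfl⟩ := hx
      induction hy using Submodule.span_induction with
      | mem x hx => obtain ⟨h, rfl⟩ := hx; rw [hV, hV, hV', hV', hpq]
      | zero => simp
      | add x y _ _ h1 h2 => simp only [map_add, inner_add_right, h1, h2]
      | smul c x _ h1 => simp only [map_smul, inner_smul_right, h1]
    | zero => simp
    | add x y _ _ h1 h2 => simp only [map_add, inner_add_left, h1, h2]
    | smul c x _ h1 => simp only [map_smul, inner_smul_left, h1]
  refine ⟨S, inferInstance, inferInstance, inferInstance, hsep, V, V', e, hdense, hV, hV', fun x => ?_, fun x => ?_⟩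
  · refine ext_inner_left ℂ fun y => ?_
    rw [adjoint_inner_right, inner_smul_right, hin y x, ← heq]; ring
  · refine ext_inner_left ℂ fun y => ?_
    rw [adjoint_inner_right, inner_smul_right, hin y x, heq]; ring

lemma exists_phi {A : Type u} {B : Type v} [CStarAlgebra A] [CStarAlgebra B] {Γ : Type*} [Group Γ] [Countable Γ]
    (u : Γ → A) (v : Γ → B) (hu : ∀ g h, u g * u h = u (g * h)) (hus : ∀ g, star (u g) = u g⁻¹)
    (hv : ∀ g h, v g * v h = v (g * h)) (hvs : ∀ g, star (v g) = v g⁻¹)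
    (ψ : A →ₗ[ℂ] ℂ) (ψ' : B →ₗ[ℂ] ℂ) (hψ : PosF ψ) (hψ' : PosF ψ')
    (hψi : ∀ h y, ψ (star (u h) * y * u h) = ψ y) (hψi' : ∀ h y, ψ' (star (v h) * y * v h) = ψ' y)
    (hψ1 : ψ 1 = 1) (hψ1' : ψ' 1 = 1) (hψψ : ∀ g, ψ' (v g) = ψ (u g⁻¹)) :
    ∃ (ℋ : Type (max u v)) (_ : NormedAddCommGroup ℋ) (_ : InnerProductSpace ℂ ℋ)
      (_ : CompleteSpace ℋ) (_ : TopologicalSpace.SeparableSpace ℋ)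
      (P : A → ℋ) (Q : B → ℋ) (φ : A ⊗[ℂ] B →ₗ[ℂ] ℂ),
      (∀ x y, φ (x ⊗ₜ y) = inner ℂ (P x) (Q y)) ∧ PosF φ ∧ φ 1 = 1 ∧ ∀ g, φ (u g ⊗ₜ v g) = 1 := by
  obtain ⟨K, _, _, _, π, ξ, hπ⟩ := exists_gns ψ hψ
  obtain ⟨K', _, _, _, π', η, hπ'⟩ := exists_gns ψ' hψ'
  have hin : ∀ a b x, inner ℂ (π a ξ) (π x (π b ξ)) = ψ (star a * x * b) := by
    intro a b x
    rw [← hπ, map_mul, map_mul, map_star, hmulA, hmulA]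
    exact (adjoint_inner_right _ _ _).symm
  have hin' : ∀ a b x, inner ℂ (π' a η) (π' x (π' b η)) = ψ' (star a * x * b) := by
    intro a b x
    rw [← hπ', map_mul, map_mul, map_star, hmulA, hmulA]
    exact (adjoint_inner_right _ _ _).symm
  have hin0 : ∀ a b, inner ℂ (π a ξ) (π b ξ) = ψ (star a * b) := by
    intro a b
    have := hin a b 1
    rwa [mul_one, map_one] at this
  have hin0' : ∀ a b, inner ℂ (π' a η) (π' b η) = ψ' (star a * b) := by
    intro a b
    have := hin' a b 1
    rwa [mul_one, map_one] at this
  have hcl : ∀ g h, ψ (u (g * h)) = ψ (u (h * g)) := by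
    intro g h
    rw [← hψi g (u (g * h)), hus, hu, hu]; congr 2; group
  obtain ⟨ℋ, _, _, _, hsep, V, V', e, hd, hV, hV', hVV, hVV'⟩ := dense_setup (fun g => π (u g) ξ) (fun g => π' (v g⁻¹) η) (by
    intro g h
    rw [hin0, hin0', hus, hvs, hu, hv, hψψ, mul_inv_rev, inv_inv, inv_inv, hcl])
  let T : A → (ℋ →L[ℂ] ℋ) := fun x => adjoint V ∘L π x ∘L V
  let S : B → (ℋ →L[ℂ] ℋ) := fun y => adjoint V' ∘L π' y ∘L V'
  have hTx : ∀ x z, T x z = adjoint V (π x (V z)) := fun _ _ => rfl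
  have hSx : ∀ x z, S x z = adjoint V' (π' x (V' z)) := fun _ _ => rfl
  have hTa : ∀ x y z, inner ℂ (T x y) z = inner ℂ y (T (star x) z) := by
    intro x y z
    rw [hTx, hTx, adjoint_inner_left, adjoint_inner_right, map_star]
    exact (adjoint_inner_right _ _ _).symm
  have hSa : ∀ x y z, inner ℂ (S x y) z = inner ℂ y (S (star x) z) := by
    intro x y z
    rw [hSx, hSx, adjoint_inner_left, adjoint_inner_right, map_star]
    exact (adjoint_inner_right _ _ _).symm
  have hTe : ∀ x g h, inner ℂ (e g) (T x (e h)) = ψ (star (u g) * x * u h) := by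
    intro x g h
    rw [hTx, adjoint_inner_right, hV, hV, hin]
  have hSe : ∀ x g h, inner ℂ (e g) (S x (e h)) = ψ' (star (v g⁻¹) * x * v h⁻¹) := by
    intro x g h
    rw [hSx, adjoint_inner_right, hV', hV', hin']
  let L : Γ → (ℋ →L[ℂ] ℋ) := fun k => (2 : ℂ) • T (u k)
  let Rr : Γ → (ℋ →L[ℂ] ℋ) := fun k => (2 : ℂ) • S (v k⁻¹)
  have hLx : ∀ k z, L k z = (2 : ℂ) • T (u k) z := fun _ _ => rfl
  have hRx : ∀ k z, Rr k z = (2 : ℂ) • S (v k⁻¹) z := fun _ _ => rfl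
  have hLe : ∀ k g, L k (e g) = e (k * g) := by
    intro k g
    rw [hLx, hTx, hV, ← hmulA, ← map_mul, hu, ← hV, hVV, smul_smul]; norm_num
  have hRe : ∀ k g, Rr k (e g) = e (g * k) := by
    intro k g
    rw [hRx, hSx, hV', ← hmulA, ← map_mul, hv, ← mul_inv_rev, ← hV', hVV', smul_smul]; norm_num
  have hLa : ∀ k x y, inner ℂ (L k x) y = inner ℂ x (L k⁻¹ y) := by
    intro k x y
    rw [hLx, hLx, inner_smul_left, inner_smul_right, hTa, hus, show (starRingEnd ℂ) 2 = 2 from map_ofNat _ 2]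
  have hRa : ∀ k x y, inner ℂ (Rr k x) y = inner ℂ x (Rr k⁻¹ y) := by
    intro k x y
    rw [hRx, hRx, inner_smul_left, inner_smul_right, hSa, hvs, show (starRingEnd ℂ) 2 = 2 from map_ofNat _ 2]
  have hext : ∀ f g : ℋ →L[ℂ] ℋ, (∀ a b, inner ℂ (e a) (f (e b)) = inner ℂ (e a) (g (e b))) → ∀ z, f z = g z := by
    intro f g hfg z
    refine hd.induction (P := fun x => f x = g x) ?_ (isClosed_eq (by fun_prop) (by fun_prop)) z
    intro x hx
    induction hx using Submodule.span_induction with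
    | mem x hx =>
      obtain ⟨h, rfl⟩ := hx
      refine ext_inner_left ℂ fun y => ?_
      refine hd.induction (P := fun y => inner ℂ y (f (e h)) = inner ℂ y (g (e h))) ?_ (isClosed_eq (by fun_prop) (by fun_prop)) y
      intro x hx
      induction hx using Submodule.span_induction with
      | mem x hx => obtain ⟨g, rfl⟩ := hx; exact hfg g h
      | zero => simp
      | add x y _ _ h1 h2 => rw [inner_add_left, h1, h2, inner_add_left]
      | smul c x _ h1 => rw [inner_smul_left, h1, inner_smul_left]
    | zero => simp
    | add x y _ _ h1 h2 => simp only [map_add, h1, h2]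
    | smul c x _ h1 => simp only [map_smul, h1]
  have hTR : ∀ x k z, T x (Rr k z) = Rr k (T x z) := by
    intro x k
    refine hext (T x ∘L Rr k) (Rr k ∘L T x) fun a b => ?_
    show inner ℂ (e a) (T x (Rr k (e b))) = inner ℂ (e a) (Rr k (T x (e b)))
    rw [hRe, hTe, ← inv_inv k, ← hRa, hRe, hTe, ← hψi k (star (u (a * k⁻¹)) * x * u b)]
    simp only [hus, mul_assoc, hu, inv_inv]
    simp only [← mul_assoc, hu]
    congr 2 <;> simp [mul_inv_rev]
  have hSL : ∀ x k z, S x (L k z) = L k (S x z) := by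
    intro x k
    refine hext (S x ∘L L k) (L k ∘L S x) fun a b => ?_
    show inner ℂ (e a) (S x (L k (e b))) = inner ℂ (e a) (L k (S x (e b)))
    rw [hLe, hSe, ← inv_inv k, ← hLa, hLe, hSe, ← hψi' k⁻¹ (star (v (k⁻¹ * a)⁻¹) * x * v b⁻¹)]
    simp only [hvs, mul_assoc, hv, inv_inv]
    simp only [← mul_assoc, hv]
    congr 2 <;> simp [mul_inv_rev]
  have hcomm : ∀ x y, T x * S y = S y * T x := fun x y =>
    comm_TS e hd L Rr hLe hRe hLa hRa (T x) (S y) (hTR x) (hSL y)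
  let φ0 : A →ₗ[ℂ] B →ₗ[ℂ] ℂ := LinearMap.mk₂ ℂ (fun x y => 2 * inner ℂ (e 1) (T x (S y (e 1))))
    (fun a b y => by simp only [hTx, map_add, add_apply, inner_add_right, mul_add])
    (fun c a y => by simp only [hTx, map_smul, smul_apply, inner_smul_right, smul_eq_mul]; ring)
    (fun a b y => by simp only [hSx, map_add, add_apply, inner_add_right, mul_add])
    (fun c a y => by simp only [hSx, map_smul, smul_apply, inner_smul_right, smul_eq_mul]; ring)
  let φ : A ⊗[ℂ] B →ₗ[ℂ] ℂ := TensorProduct.lift φ0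
  have hφ : ∀ x y, φ (x ⊗ₜ y) = 2 * inner ℂ (e 1) (T x (S y (e 1))) := by
    intro x y; simp [φ, φ0]
  have h11 : inner ℂ (e 1) (e 1) = (2 : ℂ) := by
    have := hVV (e 1)
    have h2 : inner ℂ (e 1) (adjoint V (V (e 1))) = (1 : ℂ) := by
      rw [adjoint_inner_right, hV, hin0, ← hψ1, ← hψi 1 1, mul_one]
    rw [this, inner_smul_right] at h2
    linear_combination 2 * h2
  refine ⟨ℋ, inferInstance, inferInstance, inferInstance, hsep, fun x => T (star x) (e 1), fun y => (2 : ℂ) • S y (e 1), φ, ?_, ?_, ?_, ?_⟩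
  · intro x y
    rw [hφ, hTa, star_star, map_smul, inner_smul_right]
  · intro b
    obtain ⟨m, α, β, rfl⟩ := exists_fin_sum b
    have h1 := comm_pos (fun i => π (α i) ∘L V) (fun i => π' (β i) ∘L V') (w := e 1) (by
      intro i j k l
      have := hcomm (star (α i) * α j) (star (β k) * β l)
      convert this using 2 <;>
      · simp only [adjoint_comp, T, S, map_mul, map_star]; rfl)
    have h2 : φ (star (∑ k, α k ⊗ₜ β k) * ∑ k, α k ⊗ₜ β k) = 2 * ∑ i, ∑ j, inner ℂ (e 1)
        (((adjoint (π (α i) ∘L V) ∘L (π (α j) ∘L V)) * (adjoint (π' (β i) ∘L V') ∘L (π' (β j) ∘L V'))) (e 1)) := by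
      rw [star_sum, Finset.sum_mul_sum]
      simp only [map_sum, pstar_tmul, Algebra.TensorProduct.tmul_mul_tmul, hφ, Finset.mul_sum]
      refine Finset.sum_congr rfl fun i _ => Finset.sum_congr rfl fun j _ => ?_
      congr 2
      simp only [adjoint_comp, hTx, hSx, map_mul, map_star]; rfl
    rw [h2]
    exact mul_nonneg (by norm_num) h1
  · rw [Algebra.TensorProduct.one_def, hφ, hTx, hSx, map_one, map_one]
    show 2 * inner ℂ (e 1) (adjoint V (V (adjoint V' (V' (e 1))))) = _
    rw [hVV', map_smul, map_smul, hVV, smul_smul, inner_smul_right, h11]; norm_num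
  · intro g
    have h3 : ∀ z, T (u g) z = (1/2 : ℂ) • L g z := by intro z; rw [hLx, smul_smul]; norm_num
    have h4 : ∀ z, S (v g) z = (1/2 : ℂ) • Rr g⁻¹ z := by intro z; rw [hRx, smul_smul, inv_inv]; norm_num
    rw [hφ, h4, h3, map_smul, hRe, hLe, smul_smul, inner_smul_right, one_mul, mul_inv_cancel, h11]
    norm_num

end setup
end CN

namespace CN

section mincount
open ComplexOrder ContinuousLinearMap

/-- positive functionals separate points -/
def SepF (A : Type*) [Ring A] [StarRing A] [Algebra ℂ A] : Prop :=
  ∀ a : A, (∀ f : A →ₗ[ℂ] ℂ, PosF f → f a = 0) → a = 0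

variable {A : Type u} {B : Type v} [CStarAlgebra A] [CStarAlgebra B]

/-- product functional -/
noncomputable def prodF (f : A →ₗ[ℂ] ℂ) (g : B →ₗ[ℂ] ℂ) : A ⊗[ℂ] B →ₗ[ℂ] ℂ :=
  LinearMap.mul' ℂ ℂ ∘ₗ TensorProduct.map f g

lemma prodF_tmul (f : A →ₗ[ℂ] ℂ) (g : B →ₗ[ℂ] ℂ) (x : A) (y : B) : prodF f g (x ⊗ₜ y) = f x * g y := by
  simp [prodF]

lemma prodF_pos {f : A →ₗ[ℂ] ℂ} {g : B →ₗ[ℂ] ℂ} (hf : PosF f) (hg : PosF g) : PosF (prodF f g) := by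
  obtain ⟨K, _, _, _, π, ξ, hπ⟩ := exists_gns f hf
  obtain ⟨K', _, _, _, π', η, hπ'⟩ := exists_gns g hg
  intro b
  obtain ⟨m, α, β, rfl⟩ := exists_fin_sum b
  have h1 : prodF f g (star (∑ k, α k ⊗ₜ β k) * ∑ k, α k ⊗ₜ β k) =
      inner ℂ (∑ k, (π (α k) ξ) ⊗ₜ[ℂ] (π' (β k) η)) (∑ k, (π (α k) ξ) ⊗ₜ[ℂ] (π' (β k) η)) := by
    rw [star_sum, Finset.sum_mul_sum]
    simp only [map_sum, pstar_tmul, Algebra.TensorProduct.tmul_mul_tmul, prodF_tmul]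
    rw [sum_inner]
    refine Finset.sum_congr rfl fun i _ => ?_
    rw [inner_sum]
    refine Finset.sum_congr rfl fun j _ => ?_
    rw [TensorProduct.inner_tmul, ← hπ, ← hπ', map_mul, map_mul, map_star, map_star, hmulA, hmulA]
    congr 1
    · exact adjoint_inner_right _ _ _
    · exact adjoint_inner_right _ _ _
  rw [h1]
  have h2 := inner_self_eq_norm_sq_to_K (𝕜 := ℂ) (∑ k, (π (α k) ξ) ⊗ₜ[ℂ] (π' (β k) η))
  refine le_of_le_of_eq ?_ h2.symm
  positivity

lemma prodF_sep (hA : SepF A) (hB : SepF B) (X : A ⊗[ℂ] B)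
    (h : ∀ f g, PosF f → PosF g → prodF f g X = 0) : X = 0 := by
  let ℬ := Module.Basis.ofVectorSpace ℂ A
  obtain ⟨c, rfl⟩ := TensorProduct.eq_repr_basis_left ℬ X
  have h1 : ∀ g, PosF g → ∀ i, g (c i) = 0 := by
    intro g hg
    have h2 : c.sum (fun i n => g n • ℬ i) = 0 := by
      apply hA
      intro f hf
      have := h f g hf hg
      rw [Finsupp.sum, map_sum] at this
      rw [Finsupp.sum, map_sum, ← this]
      refine Finset.sum_congr rfl fun i _ => ?_
      rw [prodF_tmul, map_smul, smul_eq_mul, mul_comm]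
    intro i
    by_cases hi : i ∈ c.support
    · exact linearIndependent_iff'.1 ℬ.linearIndependent c.support (fun i => g (c i)) h2 i hi
    · rw [Finsupp.notMem_support_iff.1 hi, map_zero]
  have h3 : c = 0 := by
    ext i
    exact hB _ fun g hg => h1 g hg i
  rw [h3, Finsupp.sum_zero_index]

lemma vn_SepF {H : Type*} [NormedAddCommGroup H] [InnerProductSpace ℂ H] [CompleteSpace H]
    (M : VonNeumannAlgebra H) : SepF ↥M.toStarSubalgebra := by
  intro a ha
  have h1 : ((a : H →L[ℂ] H) : H →ₗ[ℂ] H) = 0 := by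
    rw [← inner_map_self_eq_zero]
    intro ξ
    let f : ↥M.toStarSubalgebra →ₗ[ℂ] ℂ :=
      { toFun := fun x => inner ℂ ξ ((x : H →L[ℂ] H) ξ)
        map_add' := fun x y => by
          show inner ℂ ξ (((x : H →L[ℂ] H) + (y : H →L[ℂ] H)) ξ) = _
          rw [add_apply, inner_add_right]
        map_smul' := fun c x => by
          show inner ℂ ξ ((c • (x : H →L[ℂ] H)) ξ) = _
          rw [smul_apply, inner_smul_right]; rfl }
    have hf : PosF f := by
      intro X
      show 0 ≤ inner ℂ ξ ((adjoint (X : H →L[ℂ] H)) ((X : H →L[ℂ] H) ξ))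
      rw [adjoint_inner_right, inner_self_eq_norm_sq_to_K]
      positivity
    have := ha f hf
    rw [← inner_conj_symm]
    show starRingEnd ℂ (f a) = 0
    rw [this, map_zero]
  apply Subtype.ext
  ext x
  exact congrArg (fun f : H →ₗ[ℂ] H => f x) h1

lemma card_fibre {J : Type} {Y : Type*} (f : J → Y) (hJ : Cardinal.mk J = Cardinal.continuum)
    (hf : ∀ i, {j | f j = f i}.Countable) : Cardinal.continuum ≤ Cardinal.mk Y := by
  by_contra hlt
  rw [not_le] at hlt
  have hc : ∀ y : Set.range f, ∃ n : {j // f j = y} → ℕ, Function.Injective n := by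
    rintro ⟨_, i, rfl⟩
    exact (Set.countable_iff_exists_injective.1 (hf i))
  choose n hn using hc
  let F : J → Set.range f × ℕ := fun j => (⟨f j, j, rfl⟩, n ⟨f j, j, rfl⟩ ⟨j, rfl⟩)
  have hF : Function.Injective F := by
    intro a b hab
    simp only [F, Prod.mk.injEq, Subtype.mk.injEq] at hab
    obtain ⟨h1, h2⟩ := hab
    have key : ∀ (y y' : Set.range f) (hy : y = y') (p : f a = y) (q : f b = y'), n y ⟨a, p⟩ = n y' ⟨b, q⟩ → a = b := by
      intro y y' hy p q hpq
      subst hy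
      have := hn y hpq
      exact congrArg Subtype.val this
    exact key _ _ h1 _ _ h2
  have h1 := Cardinal.lift_mk_le_lift_mk_of_injective hF
  rw [Cardinal.mk_prod, hJ] at h1
  simp only [Cardinal.lift_continuum, Cardinal.lift_uzero, Cardinal.mk_nat, Cardinal.lift_aleph0, Cardinal.lift_mul] at h1
  have h2 : Cardinal.lift.{0} (Cardinal.mk (Set.range f)) < Cardinal.continuum := by
    rw [Cardinal.lift_uzero]
    exact (Cardinal.mk_subtype_le _).trans_lt hlt
  rw [Cardinal.lift_uzero] at h2
  exact absurd h1 (not_le.2 (Cardinal.mul_lt_of_lt Cardinal.aleph0_le_continuum h2 Cardinal.aleph0_lt_continuum))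

lemma conjF_one (φ : A ⊗[ℂ] B →ₗ[ℂ] ℂ) : conjF φ 1 = φ := by
  ext x; simp [conjF_apply]

lemma conjF_conjF (φ : A ⊗[ℂ] B →ₗ[ℂ] ℂ) (b c : A ⊗[ℂ] B) : conjF (conjF φ b) c = conjF φ (c * b) := by
  apply LinearMap.ext; intro x; simp only [conjF_apply, star_mul, mul_assoc]

theorem count_main (hA : SepF A) (hB : SepF B) {J : Type} (hJ : Cardinal.mk J = Cardinal.continuum)
    {Γ : Type*} [Group Γ] [Countable Γ] (u : J → Γ → A) (v : J → Γ → B)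
    (hu : ∀ j g h, u j g * u j h = u j (g * h)) (hus : ∀ j g, star (u j g) = u j g⁻¹)
    (hv : ∀ j g h, v j g * v j h = v j (g * h)) (hvs : ∀ j g, star (v j g) = v j g⁻¹)
    (ψ : J → A →ₗ[ℂ] ℂ) (ψ' : J → B →ₗ[ℂ] ℂ) (hψ : ∀ j, PosF (ψ j)) (hψ' : ∀ j, PosF (ψ' j))
    (hψi : ∀ j h y, ψ j (star (u j h) * y * u j h) = ψ j y) (hψi' : ∀ j h y, ψ' j (star (v j h) * y * v j h) = ψ' j y)
    (hψ1 : ∀ j, ψ j 1 = 1) (hψ1' : ∀ j, ψ' j 1 = 1) (hψψ : ∀ j g, ψ' j (v j g) = ψ j (u j g⁻¹))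
    (s : Fin 8 → Γ) (δ : ℝ) (hδ : 0 < δ) (hδ1 : δ ≤ 64)
    (hsep : ∀ i j, i ≠ j → ∀ Φ : A ⊗[ℂ] B →ₗ[ℂ] ℂ, PosF Φ →
      nrm Φ (∑ t, u i (s t) ⊗ₜ v j (s t)) ^ 2 ≤ (64 - δ) * nrm Φ 1 ^ 2) :
    Cardinal.continuum ≤ Cardinal.mk {f : A ⊗[ℂ] B → ℝ // IsCstarNorm f} := by
  choose ℋ i1 i2 i3 i4 P Q φ hφ hpos hφ1 hφg using fun j => exists_phi (u j) (v j) (hu j) (hus j) (hv j) (hvs j)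
    (ψ j) (ψ' j) (hψ j) (hψ' j) (hψi j) (hψi' j) (hψ1 j) (hψ1' j) (hψψ j)
  let x : J → A ⊗[ℂ] B := fun j => ∑ t, u j (s t) ⊗ₜ v j (s t)
  let F0 : Set (A ⊗[ℂ] B →ₗ[ℂ] ℂ) := {Ψ | ∃ (f : {f : A →ₗ[ℂ] ℂ // PosF f}) (g : {g : B →ₗ[ℂ] ℂ // PosF g}) (b : A ⊗[ℂ] B), Ψ = conjF (prodF f.1 g.1) b}
  let F : J → Set (A ⊗[ℂ] B →ₗ[ℂ] ℂ) := fun j => {Ψ | ∃ (_ _ : Unit) (b : A ⊗[ℂ] B), Ψ = conjF (φ j) b}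
  have hF0 : ∀ Φ ∈ F0, PosF Φ := by
    rintro _ ⟨f, g, b, rfl⟩; exact (prodF_pos f.2 g.2).conjF b
  have hF : ∀ j, ∀ Φ ∈ F j, PosF Φ := by
    rintro j _ ⟨_, _, b, rfl⟩; exact (hpos j).conjF b
  have hc0 : ∀ Φ ∈ F0, ∀ b, conjF Φ b ∈ F0 := by
    rintro _ ⟨f, g, b, rfl⟩ c; exact ⟨f, g, c * b, conjF_conjF _ _ _⟩
  have hc : ∀ j, ∀ Φ ∈ F j, ∀ b, conjF Φ b ∈ F j := by
    rintro j _ ⟨_, _, b, rfl⟩ c; exact ⟨(), (), c * b, conjF_conjF _ _ _⟩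
  have hs0 := NF_seminorm pbdd_tensor hF0 hc0
  have hs := fun j => NF_seminorm pbdd_tensor (hF j) (hc j)
  have hn0 : ∀ X, NF F0 X = 0 → X = 0 := by
    intro X hX
    apply prodF_sep hA hB
    intro f g hf hg
    have h1 := nrm_le_NF pbdd_tensor hF0 hc0 (Φ := prodF f g) ⟨⟨f, hf⟩, ⟨g, hg⟩, 1, (conjF_one _).symm⟩ X
    rw [hX, zero_mul] at h1
    have h2 := posF_cs1 (prodF_pos hf hg) X
    have h3 : nrm (prodF f g) X = 0 := le_antisymm h1 (nrm_nonneg _)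
    rw [h3, mul_zero] at h2
    exact norm_le_zero_iff.1 h2
  let α : J → {f : A ⊗[ℂ] B → ℝ // IsCstarNorm f} := fun j => ⟨fun X => max (NF F0 X) (NF (F j) X),
    max_seminorm hs0 (hs j), fun X hX => hn0 X (le_antisymm (hX ▸ le_max_left _ _) (NF_nonneg _))⟩
  have hge : ∀ j, 8 ≤ NF (F j) (x j) := by
    intro j
    have h1 : nrm (φ j) 1 = 1 := by
      have := nrm_sq (hpos j) 1
      rw [star_one, one_mul, hφ1, Complex.one_re] at this
      have h0 := nrm_nonneg (Φ := φ j) 1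
      nlinarith
    have h2 := le_NF pbdd_tensor (hF j) (Φ := φ j) ⟨(), (), 1, (conjF_one _).symm⟩ h1.le (x j)
    have h3 := posF_cs1 (hpos j) (x j)
    have h4 : φ j (x j) = 8 := by
      simp only [x, map_sum, hφg]; simp
    rw [h1, h4, one_mul] at h3
    have : ‖(8 : ℂ)‖ = 8 := by simp
    linarith
  have hcount0 := counting (fun (f : {f : A →ₗ[ℂ] ℂ // PosF f}) (a : A) => (star (f.1 a) : ℂ))
    (fun (g : {g : B →ₗ[ℂ] ℂ // PosF g}) (b : B) => (g.1 b : ℂ)) (fun f g => prodF f.1 g.1)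
    (fun f g a b => by rw [prodF_tmul]; simp [mul_comm]) (fun f g => prodF_pos f.2 g.2) (fun j t => u j (s t)) (fun j t => v j (s t)) 64 δ hδ hδ1 hsep
  have hcount : ∀ j, _ := fun j => counting (fun _ : Unit => P j) (fun _ : Unit => Q j) (fun _ _ => φ j)
    (fun _ _ => hφ j) (fun _ _ => hpos j) (fun j t => u j (s t)) (fun j t => v j (s t)) 64 δ hδ hδ1 hsep
  refine card_fibre α hJ fun i => (hcount0.union (hcount i)).mono ?_
  intro j hj
  have h1 : max (NF F0 (x j)) (NF (F j) (x j)) = max (NF F0 (x j)) (NF (F i) (x j)) :=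
    congrFun (congrArg Subtype.val hj) (x j)
  have h2 : 8 ≤ max (NF F0 (x j)) (NF (F i) (x j)) := h1 ▸ (hge j).trans (le_max_right _ _)
  rcases le_max_iff.1 h2 with h3 | h3
  · left; show 64 ≤ NF F0 (x j) ^ 2; nlinarith
  · right; show 64 ≤ NF (F i) (x j) ^ 2; nlinarith

end mincount
end CN

namespace CN

section oneblock
open ComplexOrder

variable {A : Type*} [Ring A] [StarRing A] [Algebra ℂ A] [StarModule ℂ A]
variable {G : Type*} [Group G] [Fintype G]

/-- regular representation on a block -/
def lamB (v : G → A) (g : G) : A := ∑ x, v (g * x) * star (v x)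

/-- number of nonzero values of a sign function -/
noncomputable def cB (w : G → ℂ) : ℂ := ∑ h, w h ^ 2

/-- the spectral projection on a block -/
noncomputable def qB (v : G → A) (w : G → ℂ) : A := (cB w)⁻¹ • ∑ h, w h • lamB v h

/-- sign functions supported on subgroups -/
structure SgnF (w : G → ℂ) : Prop where
  one : w 1 = 1
  val : ∀ g, w g = 0 ∨ w g = 1 ∨ w g = -1
  mul : ∀ h g, w h ≠ 0 → w (h * g) = w h * w g

lemma SgnF.sq {w : G → ℂ} (hw : SgnF w) {g : G} (hg : w g ≠ 0) : w g * w g = 1 := by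
  rcases hw.val g with h | h | h
  · exact absurd h hg
  · rw [h]; norm_num
  · rw [h]; norm_num

lemma SgnF.inv {w : G → ℂ} (hw : SgnF w) (g : G) : w g⁻¹ = w g := by
  by_cases hg : w g = 0
  · by_contra h
    rw [hg] at h
    have := hw.mul g⁻¹ g h
    rw [inv_mul_cancel, hw.one, hg, mul_zero] at this
    exact one_ne_zero this
  · have := hw.mul g g⁻¹ hg
    rw [mul_inv_cancel, hw.one] at this
    have h2 := hw.sq hg
    exact mul_left_cancel₀ hg (this.symm.trans h2.symm)

lemma SgnF.star {w : G → ℂ} (hw : SgnF w) (g : G) : star (w g) = w g := by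
  rcases hw.val g with h | h | h <;> simp [h]

lemma SgnF.c_real {w : G → ℂ} (hw : SgnF w) : ∃ r : ℝ, 0 < r ∧ cB w = r := by
  refine ⟨∑ h, ‖w h‖ ^ 2, ?_, ?_⟩
  · refine Finset.sum_pos' (fun _ _ => by positivity) ⟨1, Finset.mem_univ _, by rw [hw.one]; simp⟩
  · rw [cB]; push_cast
    refine Finset.sum_congr rfl fun g _ => ?_
    rcases hw.val g with h | h | h <;> simp [h]

lemma SgnF.c_ne {w : G → ℂ} (hw : SgnF w) : cB w ≠ 0 := by
  obtain ⟨r, hr, h⟩ := hw.c_real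
  rw [h]; exact_mod_cast hr.ne'

lemma SgnF.conv {w : G → ℂ} (hw : SgnF w) (g : G) : ∑ h, w h * w (h⁻¹ * g) = cB w * w g := by
  rw [cB, Finset.sum_mul]
  refine Finset.sum_congr rfl fun h _ => ?_
  by_cases hh : w h = 0
  · rw [hh]; simp
  · rw [hw.mul h⁻¹ g (by rwa [hw.inv]), hw.inv]; ring

variable {v : G → A} {e : A} {w : G → ℂ}

lemma lamB_v [DecidableEq G] (hv : ∀ g h, star (v g) * v h = if g = h then e else 0) (hve : ∀ g, v g * e = v g) (g x : G) :
    lamB v g * v x = v (g * x) := by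
  rw [lamB, Finset.sum_mul, Finset.sum_eq_single x]
  · rw [mul_assoc, hv, if_pos rfl, hve]
  · intro y _ hy; rw [mul_assoc, hv, if_neg hy, mul_zero]
  · simp

lemma lamB_mul [DecidableEq G] (hv : ∀ g h, star (v g) * v h = if g = h then e else 0) (hve : ∀ g, v g * e = v g) (g h : G) :
    lamB v g * lamB v h = lamB v (g * h) := by
  rw [lamB.eq_1 v h, Finset.mul_sum, lamB.eq_1 v (g * h)]
  refine Finset.sum_congr rfl fun x _ => ?_
  rw [← mul_assoc, lamB_v hv hve, mul_assoc]

lemma lamB_star (g : G) : star (lamB v g) = lamB v g⁻¹ := by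
  rw [lamB, lamB, star_sum]
  refine Fintype.sum_equiv (Equiv.mulLeft g) _ _ fun x => ?_
  simp

lemma qB_star (hw : SgnF w) : star (qB v w) = qB v w := by
  obtain ⟨r, hr, h⟩ := hw.c_real
  rw [qB, star_smul, star_sum, h]
  congr 1
  · simp
  · refine Fintype.sum_equiv (Equiv.inv G) _ _ fun x => ?_
    rw [star_smul, lamB_star, hw.star, Equiv.inv_apply, hw.inv]

lemma qB_mul [DecidableEq G] (hv : ∀ g h, star (v g) * v h = if g = h then e else 0) (hve : ∀ g, v g * e = v g) (hw : SgnF w) :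
    qB v w * qB v w = qB v w := by
  have h1 : (∑ h, w h • lamB v h) * (∑ h, w h • lamB v h) = cB w • ∑ h, w h • lamB v h := by
    rw [Finset.sum_mul, Finset.smul_sum]
    have : ∀ h, (w h • lamB v h) * (∑ h, w h • lamB v h) = ∑ g, (w h * w (h⁻¹ * g)) • lamB v g := by
      intro h
      rw [Finset.mul_sum]
      refine Fintype.sum_equiv (Equiv.mulLeft h) _ _ fun x => ?_
      rw [smul_mul_smul_comm, lamB_mul hv hve]; simp
    simp_rw [this]
    rw [Finset.sum_comm]
    refine Finset.sum_congr rfl fun g _ => ?_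
    rw [← Finset.sum_smul, hw.conv, mul_smul]
  rw [qB, smul_mul_smul_comm, h1, smul_smul, mul_assoc, inv_mul_cancel₀ hw.c_ne, mul_one]

lemma lamB_qB [DecidableEq G] (hv : ∀ g h, star (v g) * v h = if g = h then e else 0) (hve : ∀ g, v g * e = v g) (θ : G) :
    lamB v θ * qB v w = (cB w)⁻¹ • ∑ h, w (θ⁻¹ * h) • lamB v h := by
  rw [qB, mul_smul_comm, Finset.mul_sum]
  congr 1
  refine Fintype.sum_equiv (Equiv.mulLeft θ) _ _ fun x => ?_
  rw [mul_smul_comm, lamB_mul hv hve]; simp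

lemma lamB_comm [DecidableEq G] (hv : ∀ g h, star (v g) * v h = if g = h then e else 0) (hve : ∀ g, v g * e = v g) (θ : G)
    (hθ : ∀ g, w (θ⁻¹ * g) = w (g * θ⁻¹)) : lamB v θ * qB v w = qB v w * lamB v θ := by
  rw [lamB_qB hv hve, qB, smul_mul_assoc, Finset.sum_mul]
  congr 1
  symm
  refine Fintype.sum_equiv (Equiv.mulRight θ) _ _ fun x => ?_
  rw [smul_mul_assoc, lamB_mul hv hve, hθ]; simp

lemma lamB_char [DecidableEq G] (hv : ∀ g h, star (v g) * v h = if g = h then e else 0) (hve : ∀ g, v g * e = v g) (hw : SgnF w) (θ : G)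
    (hθ : w θ ≠ 0) : lamB v θ * qB v w = w θ • qB v w := by
  rw [lamB_qB hv hve, qB, smul_comm (w θ)]
  congr 1
  rw [Finset.smul_sum]
  refine Finset.sum_congr rfl fun x _ => ?_
  rw [hw.mul _ _ (by rwa [hw.inv]), hw.inv, smul_smul]

lemma lamB_trace [DecidableEq G] (hv : ∀ g h, star (v g) * v h = if g = h then e else 0) (hve : ∀ g, v g * e = v g) (hw : SgnF w) (θ x : G) :
    star (v x) * (lamB v θ * qB v w) * v x = ((cB w)⁻¹ * w θ) • e := by
  rw [lamB_qB hv hve, mul_smul_comm, smul_mul_assoc, mul_smul]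
  congr 1
  rw [mul_assoc, Finset.sum_mul, Finset.mul_sum, Finset.sum_eq_single 1]
  · rw [smul_mul_assoc, lamB_v hv hve, mul_smul_comm, hv, one_mul, if_pos rfl, mul_one, hw.inv]
  · intro g _ hg
    rw [smul_mul_assoc, lamB_v hv hve, mul_smul_comm, hv, if_neg, smul_zero]
    intro h
    exact hg (by simpa using h.symm)
  · simp

end oneblock
end CN

namespace CN

section blockrep
open ComplexOrder Filter Topology

variable {A : Type*} [CStarAlgebra A]

lemma bs_rep (hBS : BS A) (f : ℕ → A) (hf : ∀ k, IsStarProjection (f k)) (hff : ∀ k l, k ≠ l → f k * f l = 0)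
    {Γ : Type*} [Group Γ] (T : ℕ → Γ → A) (hTl : ∀ k γ, f k * T k γ = T k γ) (hTr : ∀ k γ, T k γ * f k = T k γ)
    (hTm : ∀ k γ γ', T k γ * T k γ' = T k (γ * γ')) (hTs : ∀ k γ, star (T k γ) = T k γ⁻¹) :
    ∃ u : Γ → A, (∀ γ γ', u γ * u γ' = u (γ * γ')) ∧ (∀ γ, star (u γ) = u γ⁻¹) ∧ (∀ k γ, u γ * f k = T k γ) ∧
      (∀ k γ, f k * u γ = T k γ) ∧
      ∀ (ι : Type) (s : Finset ι) (z : ι → Γ) (β : ι → ℂ), (∀ k, ∑ i ∈ s, β i • T k (z i) = 0) → ∑ i ∈ s, β i • u (z i) = 0 := by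
  obtain ⟨F, hF, hFf, hF0, hFT⟩ := hBS f hf hff
  have hn : ∀ k γ, ‖T k γ‖ ≤ 1 := by
    intro k γ
    have h1 : star (T k γ) * T k γ = T k 1 := by rw [hTs, hTm]; simp
    have h2 : IsStarProjection (T k 1) := ⟨by rw [IsIdempotentElem, hTm]; simp, by rw [IsSelfAdjoint, hTs]; simp⟩
    have h3 := CStarRing.norm_star_mul_self (x := T k γ)
    have h4 := h2.norm_le
    rw [h1] at h3
    have h5 := norm_nonneg (T k γ)
    nlinarith
  choose u huF huf using fun γ => hFT (fun k => T k γ) (fun k => hTl k γ) (fun k => hTr k γ) (fun k => hn k γ)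
  have hfF : ∀ k, f k * F = f k := by
    intro k
    have := congrArg star (hFf k)
    rwa [star_mul, hF.isSelfAdjoint.star_eq, (hf k).isSelfAdjoint.star_eq] at this
  have huniq : ∀ y z, y * F = y → z * F = z → (∀ k, y * f k = z * f k) → y = z := by
    intro y z hy hz h
    have := hF0 (y - z) (fun k => by rw [sub_mul, h, sub_self])
    rw [sub_mul, hy, hz] at this
    exact sub_eq_zero.1 this
  have hTF : ∀ k γ, T k γ * F = T k γ := fun k γ => by rw [← hTr, mul_assoc, hfF]
  have hfu : ∀ k γ, f k * u γ = T k γ := by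
    intro k γ
    apply huniq
    · rw [mul_assoc, huF]
    · exact hTF _ _
    · intro l
      rw [mul_assoc, huf]
      by_cases hkl : k = l
      · subst hkl; rw [hTl, hTr]
      · rw [← hTl l, ← mul_assoc, hff k l hkl, zero_mul, ← hTr k, mul_assoc, hff k l hkl, mul_zero]
  have hFu : ∀ γ, F * u γ = u γ := by
    intro γ
    apply huniq
    · rw [mul_assoc, huF]
    · exact huF _
    · intro l; rw [mul_assoc, huf, ← hTl, ← mul_assoc, hFf]
  refine ⟨u, ?_, ?_, fun k γ => huf γ k, hfu, ?_⟩
  · intro γ γ'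
    apply huniq
    · rw [mul_assoc, huF]
    · exact huF _
    · intro l; rw [mul_assoc, huf, ← hTl, ← mul_assoc, huf, hTm, huf]
  · intro γ
    apply huniq
    · conv_rhs => rw [← hFu, star_mul, hF.isSelfAdjoint.star_eq]
    · exact huF _
    · intro l
      have := congrArg star (hfu l γ)
      rw [star_mul, (hf l).isSelfAdjoint.star_eq, hTs] at this
      rw [this, huf]
  · intro ι s z β h
    apply huniq
    · rw [Finset.sum_mul]; exact Finset.sum_congr rfl fun z _ => by rw [smul_mul_assoc, huF]
    · rw [zero_mul]
    · intro k
      rw [zero_mul, Finset.sum_mul, ← h k]; exact Finset.sum_congr rfl fun z _ => by rw [smul_mul_assoc, huf]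

lemma posF_bdd {ψ : A →ₗ[ℂ] ℂ} (h : PosF ψ) (h1 : ψ 1 = 1) (y : A) : ‖ψ y‖ ≤ ‖y‖ := by
  have hn1 : nrm ψ 1 = 1 := by
    have h2 := nrm_one_sq h
    rw [h1, Complex.one_re] at h2
    have h0 := nrm_nonneg (Φ := ψ) 1
    nlinarith
  have h2 : nrm ψ y ≤ ‖y‖ := by
    letI := CStarAlgebra.spectralOrder A
    haveI := CStarAlgebra.spectralOrderedRing A
    have h3 : star y * y ≤ algebraMap ℝ A (‖y‖ ^ 2) := CStarAlgebra.star_mul_le_algebraMap_norm_sq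
    obtain ⟨z, hz⟩ := CStarAlgebra.nonneg_iff_eq_star_mul_self.1 (sub_nonneg.2 h3)
    have h4 := h z
    rw [← hz, map_sub, Algebra.algebraMap_eq_smul_one, ← Complex.coe_smul, map_smul, h1] at h4
    have h5 := (Complex.le_def.1 h4).1
    have h6 := nrm_sq h y
    simp at h5
    have h7 := norm_nonneg y
    refine abs_le_of_sq_le_sq' ?_ h7 |>.2
    rw [h6]
    have : (((‖y‖ : ℂ) ^ 2)).re = ‖y‖ ^ 2 := by rw [← Complex.ofReal_pow, Complex.ofReal_re]
    linarith
  have := posF_cs1 h y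
  rw [hn1, one_mul] at this
  exact this.trans h2

lemma lim_state (ψ : ℕ → A →ₗ[ℂ] ℂ) (hp : ∀ k, PosF (ψ k)) (h1 : ∀ k, ψ k 1 = 1) :
    ∃ φ : A →ₗ[ℂ] ℂ, PosF φ ∧ φ 1 = 1 ∧ (∀ y y', (∀ k, ψ k y = ψ k y') → φ y = φ y') ∧
      ∀ y L, (∀ᶠ k in atTop, ψ k y = L) → φ y = L := by
  have hex : ∀ y, ∃ L, Tendsto (fun k => ψ k y) (hyperfilter ℕ : Filter ℕ) (𝓝 L) := by
    intro y
    have hc := isCompact_closedBall (0 : ℂ) ‖y‖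
    obtain ⟨L, _, hL⟩ := hc.ultrafilter_le_nhds ((hyperfilter ℕ).map fun k => ψ k y) (by
      rw [le_principal_iff, Ultrafilter.coe_map, Filter.mem_map]
      refine Filter.univ_mem' fun k => ?_
      simpa using posF_bdd (hp k) (h1 k) y)
    exact ⟨L, hL⟩
  choose φ hφ using hex
  refine ⟨{ toFun := φ, map_add' := ?_, map_smul' := ?_ }, ?_, ?_, ?_, ?_⟩
  · intro x y
    refine tendsto_nhds_unique (hφ _) ?_
    simpa only [map_add] using (hφ x).add (hφ y)
  · intro c x
    refine tendsto_nhds_unique (hφ _) ?_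
    simp only [map_smul, smul_eq_mul, RingHom.id_apply]
    exact (hφ x).const_mul c
  · intro X
    exact ge_of_tendsto' (hφ _) (fun k => hp k X)
  · refine tendsto_nhds_unique (hφ _) ?_
    simp only [h1]; exact tendsto_const_nhds
  · intro y y' h
    refine tendsto_nhds_unique (hφ _) ?_
    simp only [h]; exact hφ _
  · intro y L h
    refine tendsto_nhds_unique (hφ _) ?_
    refine (tendsto_congr' ?_).2 tendsto_const_nhds
    exact Nat.hyperfilter_le_atTop h

lemma block_state {G : Type*} [Group G] [Fintype G] [DecidableEq G] {v : G → A} {e : A} {w : G → ℂ}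
    (hv : ∀ g h, star (v g) * v h = if g = h then e else 0) (hve : ∀ g, v g * e = v g) (hw : SgnF w)
    {ω : A →ₗ[ℂ] ℂ} (hω : PosF ω) (hωe : ω e = 1) {Γ : Type*} [Group Γ] (θ : Γ → G) (u : Γ → A)
    (hθ : ∀ γ g, w ((θ γ)⁻¹ * g) = w (g * (θ γ)⁻¹))
    (huf : ∀ γ, u γ * lamB v 1 = lamB v (θ γ) * qB v w) :
    ∃ ψ : A →ₗ[ℂ] ℂ, PosF ψ ∧ ψ 1 = 1 ∧ (∀ γ y, ψ (star (u γ) * y * u γ) = ψ y) ∧ ∀ γ, ψ (u γ) = w (θ γ) := by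
  obtain ⟨r, hr, hc⟩ := hw.c_real
  have hG : (0 : ℝ) < Fintype.card G := by exact_mod_cast Fintype.card_pos
  have hfq : lamB v 1 * qB v w = qB v w := by
    rw [lamB_char hv hve hw 1 (by rw [hw.one]; exact one_ne_zero), hw.one, one_smul]
  have hqq := qB_mul hv hve hw
  have huq : ∀ γ g, u γ * (qB v w * v g) = qB v w * v (θ γ * g) := by
    intro γ g
    rw [← hfq, mul_assoc, ← mul_assoc (u γ), huf, ← lamB_v hv hve, ← mul_assoc, mul_assoc (lamB v (θ γ)), hqq,
      lamB_comm hv hve _ (hθ γ), mul_assoc, hfq]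
  let ψ : A →ₗ[ℂ] ℂ := ((r / Fintype.card G : ℝ) : ℂ) • ∑ g, conjF ω (qB v w * v g)
  have hψ : ∀ y, ψ y = ((r / Fintype.card G : ℝ) : ℂ) * ∑ g, ω (star (qB v w * v g) * (y * (qB v w * v g))) := by
    intro y; simp [ψ, conjF_apply]
  have hval : ∀ γ : G, ((r / Fintype.card G : ℝ) : ℂ) * ∑ g, ω (star (v g) * (lamB v γ * qB v w) * v g) = w γ := by
    intro γ
    simp only [lamB_trace hv hve hw, map_smul, hωe, hc, smul_eq_mul, mul_one, Finset.sum_const, Finset.card_univ, nsmul_eq_mul]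
    push_cast
    have : (r : ℂ) ≠ 0 := by exact_mod_cast hr.ne'
    have : (Fintype.card G : ℂ) ≠ 0 := by exact_mod_cast hG.ne'
    field_simp
  refine ⟨ψ, ?_, ?_, ?_, ?_⟩
  · intro X
    have : 0 ≤ ∑ g, conjF ω (qB v w * v g) (star X * X) := Finset.sum_nonneg fun g _ => hω.conjF _ X
    have h2 : (0 : ℂ) ≤ ((r / Fintype.card G : ℝ) : ℂ) := by
      rw [Complex.zero_le_real]; positivity
    simp only [ψ, LinearMap.smul_apply, LinearMap.sum_apply, smul_eq_mul]
    exact mul_nonneg h2 this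
  · rw [hψ, ← hw.one, ← hval]
    congr 1
    refine Finset.sum_congr rfl fun g _ => ?_
    rw [star_mul, qB_star hw, one_mul, hfq, mul_assoc, ← mul_assoc (qB v w), hqq, mul_assoc]
  · intro γ y
    rw [hψ, hψ]
    congr 1
    refine Fintype.sum_equiv (Equiv.mulLeft (θ γ)) _ _ fun g => ?_
    rw [Equiv.coe_mulLeft, ← huq, star_mul (u γ)]
    simp only [mul_assoc]
  · intro γ
    rw [hψ, ← hval]
    congr 1
    refine Finset.sum_congr rfl fun g _ => ?_
    rw [huq, star_mul, qB_star hw, lamB_comm hv hve _ (hθ γ), mul_assoc, ← mul_assoc (qB v w), hqq, mul_assoc, mul_assoc, lamB_v hv hve]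

lemma exists_state (hS : SepF A) {e : A} (he : IsStarProjection e) (he0 : e ≠ 0) :
    ∃ ω : A →ₗ[ℂ] ℂ, PosF ω ∧ ω e = 1 := by
  by_contra hcon
  apply he0
  apply hS
  intro f hf
  by_contra h0
  apply hcon
  have h1 := hf e
  rw [he.isSelfAdjoint.star_eq, he.isIdempotentElem.eq] at h1
  refine ⟨(f e)⁻¹ • f, fun X => ?_, ?_⟩
  · rw [LinearMap.smul_apply, smul_eq_mul]
    refine mul_nonneg ?_ (hf X)
    exact inv_nonneg.2 h1
  · rw [LinearMap.smul_apply, smul_eq_mul, inv_mul_cancel₀ h0]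

theorem block_rep (hRP : RP A) (hCH : CHab A) (hBS : BS A) (hS : SepF A) (hFA : ¬ FAOne A)
    {Γ : Type*} [Group Γ] (G : ℕ → Type*) [∀ k, Group (G k)] [∀ k, Finite (G k)] (θ : ∀ k, Γ →* G k)
    (w : ∀ k, G k → ℂ) (hw : ∀ k, SgnF (w k)) (hθ : ∀ k γ g, w k (θ k γ * g) = w k (g * θ k γ)) :
    ∃ (u : Γ → A) (ψ : A →ₗ[ℂ] ℂ), (∀ γ γ', u γ * u γ' = u (γ * γ')) ∧ (∀ γ, star (u γ) = u γ⁻¹) ∧ PosF ψ ∧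
      ψ 1 = 1 ∧ (∀ γ y, ψ (star (u γ) * y * u γ) = ψ y) ∧
      (∀ γ L, (∀ᶠ k in atTop, w k (θ k γ) = L) → ψ (u γ) = L) ∧
      ∀ (ι : Type) (s : Finset ι) (z : ι → Γ) (β : ι → ℂ), (∀ k, ∀ i ∈ s, w k (θ k (z i)) ≠ 0) →
        (∀ k, ∑ i ∈ s, β i * w k (θ k (z i)) = 0) → ∑ i ∈ s, β i • u (z i) = 0 := by
  classical
  haveI := fun k => Fintype.ofFinite (G k)
  have hcard : ∀ k, Fintype.card (G k) = (Fintype.card (G k) - 1) + 1 := fun k => by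
    have : 0 < Fintype.card (G k) := Fintype.card_pos
    omega
  obtain ⟨e, v0, he, he0, hvv0, hvo0, hve0⟩ := blocks_of_not_FA hRP hCH hFA (fun k => Fintype.card (G k) - 1)
  let ι : ∀ k, G k ≃ Fin ((Fintype.card (G k) - 1) + 1) := fun k => Fintype.equivFinOfCardEq (hcard k)
  let v : ∀ k, G k → A := fun k g => v0 k (ι k g)
  have hv : ∀ k g h, star (v k g) * v k h = if g = h then e k else 0 := by
    intro k g h
    rw [hvv0]; simp only [(ι k).injective.eq_iff]
  have hvo : ∀ k l g h, k ≠ l → star (v k g) * v l h = 0 := fun k l g h hkl => hvo0 k l _ _ hkl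
  have hve : ∀ k g, v k g * e k = v k g := fun k g => hve0 k _
  choose ω hω hωe using fun k => exists_state hS (he k) (he0 k)
  have hθ' : ∀ k γ g, w k ((θ k γ)⁻¹ * g) = w k (g * (θ k γ)⁻¹) := by
    intro k γ g; rw [← map_inv, hθ]
  have hq1 : ∀ k, lamB (v k) 1 * qB (v k) (w k) = qB (v k) (w k) := by
    intro k
    rw [lamB_char (hv k) (hve k) (hw k) 1 (by rw [(hw k).one]; exact one_ne_zero), (hw k).one, one_smul]
  have h11 : ∀ k, lamB (v k) 1 * lamB (v k) 1 = lamB (v k) 1 := fun k => by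
    rw [lamB_mul (hv k) (hve k), one_mul]
  have hcomm : ∀ k γ, lamB (v k) (θ k γ) * qB (v k) (w k) = qB (v k) (w k) * lamB (v k) (θ k γ) :=
    fun k γ => lamB_comm (hv k) (hve k) _ (hθ' k γ)
  obtain ⟨u, hu, hus, huf, hfu, hlin⟩ := bs_rep hBS (fun k => lamB (v k) 1)
    (fun k => ⟨h11 k, by rw [IsSelfAdjoint, lamB_star, inv_one]⟩)
    (by
      intro k l hkl
      simp only [lamB, Finset.sum_mul, Finset.mul_sum]
      refine Finset.sum_eq_zero fun x _ => Finset.sum_eq_zero fun y _ => ?_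
      rw [mul_assoc, ← mul_assoc (star _), hvo k l _ _ hkl, zero_mul, mul_zero])
    (fun k γ => lamB (v k) (θ k γ) * qB (v k) (w k))
    (fun k γ => by rw [← mul_assoc, lamB_mul (hv k) (hve k), one_mul])
    (fun k γ => by rw [hcomm, mul_assoc, lamB_mul (hv k) (hve k), mul_one])
    (fun k γ γ' => by
      rw [hcomm k γ, mul_assoc, ← mul_assoc (lamB (v k) (θ k γ)), lamB_mul (hv k) (hve k), ← map_mul, hcomm,
        ← mul_assoc, qB_mul (hv k) (hve k) (hw k)])
    (fun k γ => by
                       rw [star_mul, lamB_star, qB_star (hw k), map_inv, lamB_comm (hv k) (hve k)]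
                       intro g; rw [inv_inv, hθ])
  choose ψ hψ hψ1 hψi hψu using fun k => block_state (hv k) (hve k) (hw k) (hω k) (hωe k) (θ k) u (hθ' k) (huf k)
  obtain ⟨φ, hφ, hφ1, hφe, hφl⟩ := lim_state ψ hψ hψ1
  refine ⟨u, φ, hu, hus, hφ, hφ1, fun γ y => hφe _ _ fun k => hψi k γ y, fun γ L h => hφl _ _ ?_, ?_⟩
  · filter_upwards [h] with k hk
    rw [hψu, hk]
  · intro κ s z β h0 hs
    apply hlin
    intro k
    have : ∀ i ∈ s, β i • (lamB (v k) (θ k (z i)) * qB (v k) (w k)) = (β i * w k (θ k (z i))) • qB (v k) (w k) := by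
      intro i hi
      rw [lamB_char (hv k) (hve k) (hw k) _ (h0 k i hi), smul_smul]
    rw [Finset.sum_congr rfl this, ← Finset.sum_smul, hs, zero_smul]

lemma tensor_vanish {B : Type*} [CStarAlgebra B] {Γ : Type*} (u : Γ → A) (v : Γ → B)
    (a b : ℕ → Γ → ℂ) (s : Finset Γ)
    (hA : ∀ β : Γ → ℂ, (∀ k, ∑ z ∈ s, β z * a k z = 0) → ∑ z ∈ s, β z • u z = 0)
    (hB : ∀ β : Γ → ℂ, (∀ k, ∑ z ∈ s, β z * b k z = 0) → ∑ z ∈ s, β z • v z = 0)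
    (hab : ∀ k l, ∑ z ∈ s, a k z * b l z = 0) : ∑ z ∈ s, u z ⊗ₜ[ℂ] v z = 0 := by
  classical
  have h1 : ∀ k, ∑ z ∈ s, a k z • v z = 0 := fun k => hB _ fun l => hab k l
  let ℬ := Module.Basis.ofVectorSpace ℂ B
  apply (TensorProduct.equivFinsuppOfBasisRight ℬ (M := A)).injective
  rw [map_zero, map_sum]
  ext j
  rw [Finsupp.finset_sum_apply]
  simp only [TensorProduct.equivFinsuppOfBasisRight_apply_tmul_apply, Finsupp.zero_apply]
  apply hA
  intro k
  have h2 := congrArg (fun x => ℬ.repr x j) (h1 k)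
  simp only [map_sum, map_smul, map_zero, Finsupp.zero_apply, Finsupp.finset_sum_apply, Finsupp.smul_apply, smul_eq_mul] at h2
  rw [← h2]
  exact Finset.sum_congr rfl fun _ _ => mul_comm _ _

end blockrep
end CN

namespace CN

section concrete
open Polynomial Filter

abbrev M4 (R : Type) := Matrix (Fin 4) (Fin 4) R

/-- the central elements -/
noncomputable def cM (R : Type) [CommRing R] (r : R) : M4 R := !![1,0,0,r;0,1,0,0;0,0,1,0;0,0,0,1]

/-- the abelian part -/
noncomputable def aM (x y : F2) : M4 F2 := !![1,x,y,0;0,1,0,0;0,0,1,0;0,0,0,1]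

/-- lower block elements -/
noncomputable def bM (x y z : F2) : M4 F2 := !![1,0,0,0;0,1,x,z;0,y,1,0;0,0,0,1]

lemma cM_mul (r s : F2) : cM F2 r * cM F2 s = cM F2 (r + s) := by
  ext i j; fin_cases i <;> fin_cases j <;> simp [cM, Matrix.mul_apply, Fin.sum_univ_four, add_comm]

lemma cM_zero : cM F2 0 = 1 := by
  ext i j; fin_cases i <;> fin_cases j <;> simp [cM]

lemma aM_mul (x y x' y' : F2) : aM x y * aM x' y' = aM (x + x') (y + y') := by
  ext i j; fin_cases i <;> fin_cases j <;> simp [aM, Matrix.mul_apply, Fin.sum_univ_four, add_comm]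

lemma aM_zero : aM 0 0 = 1 := by
  ext i j; fin_cases i <;> fin_cases j <;> simp [aM]

lemma aM_c (x y r : F2) : aM x y * cM F2 r = cM F2 r * aM x y := by
  ext i j; fin_cases i <;> fin_cases j <;> simp [aM, cM, Matrix.mul_apply, Fin.sum_univ_four]

lemma bM_c (x y z r : F2) : bM x y z * cM F2 r = cM F2 r * bM x y z := by
  ext i j; fin_cases i <;> fin_cases j <;> simp [bM, cM, Matrix.mul_apply, Fin.sum_univ_four]

lemma bM_x (x : F2) : bM x 0 0 * bM x 0 0 = 1 := by
  ext i j; fin_cases i <;> fin_cases j <;> simp [bM, Matrix.mul_apply, Fin.sum_univ_four, f2_add_self]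

lemma bM_y (x : F2) : bM 0 x 0 * bM 0 x 0 = 1 := by
  ext i j; fin_cases i <;> fin_cases j <;> simp [bM, Matrix.mul_apply, Fin.sum_univ_four, f2_add_self]

lemma bM_z (x : F2) : bM 0 0 x * bM 0 0 x = 1 := by
  ext i j; fin_cases i <;> fin_cases j <;> simp [bM, Matrix.mul_apply, Fin.sum_univ_four, f2_add_self]

lemma aM_bx (x y t : F2) : aM x y * bM t 0 0 = bM t 0 0 * aM x (t * x + y) := by
  ext i j; fin_cases i <;> fin_cases j <;> simp [aM, bM, Matrix.mul_apply, Fin.sum_univ_four, mul_comm]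

lemma aM_by (x y t : F2) : aM x y * bM 0 t 0 = bM 0 t 0 * aM (x + t * y) y := by
  ext i j; fin_cases i <;> fin_cases j <;> simp [aM, bM, Matrix.mul_apply, Fin.sum_univ_four, mul_comm]

lemma aM_bz (r : F2) : cM F2 r * bM 0 0 1 * aM r 0 = aM r 0 * bM 0 0 1 := by
  ext i j; fin_cases i <;> fin_cases j <;>
    simp [cM, aM, bM, Matrix.mul_apply, Fin.sum_univ_four, f2_add_self]

/-- the central homomorphism -/
noncomputable def cU : Multiplicative F2 →* (M4 F2)ˣ where
  toFun r := ⟨cM F2 r.toAdd, cM F2 r.toAdd, by rw [cM_mul, f2_add_self, cM_zero], by rw [cM_mul, f2_add_self, cM_zero]⟩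
  map_one' := Units.ext cM_zero
  map_mul' r s := Units.ext (cM_mul _ _).symm

/-- the group -/
noncomputable abbrev Gam : Subgroup (M4 F2)ˣ := Subgroup.centralizer (Set.range cU)

lemma mem_Gam {g : (M4 F2)ˣ} (h : ∀ r, (g : M4 F2) * cM F2 r = cM F2 r * g) : g ∈ Gam := by
  rw [Subgroup.mem_centralizer_iff]
  rintro _ ⟨r, rfl⟩
  exact Units.ext (h r.toAdd).symm

/-- involutions in the group -/
noncomputable def invG (x : M4 F2) (hx : x * x = 1) (h : ∀ r, x * cM F2 r = cM F2 r * x) : Gam :=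
  ⟨⟨x, x, hx, hx⟩, mem_Gam h⟩

/-- the central homomorphism -/
noncomputable def cG : Multiplicative F2 →* Gam :=
  cU.codRestrict Gam fun r => mem_Gam fun s => by
    change cM F2 _ * cM F2 _ = cM F2 _ * cM F2 _
    rw [cM_mul, cM_mul, add_comm]

/-- the abelian part -/
noncomputable def aU : Multiplicative (F2 × F2) →* (M4 F2)ˣ where
  toFun r := ⟨aM r.toAdd.1 r.toAdd.2, aM r.toAdd.1 r.toAdd.2, by rw [aM_mul, f2_add_self, f2_add_self, aM_zero],
    by rw [aM_mul, f2_add_self, f2_add_self, aM_zero]⟩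
  map_one' := Units.ext aM_zero
  map_mul' r s := Units.ext (aM_mul _ _ _ _).symm

/-- the abelian part -/
noncomputable def aG : Multiplicative (F2 × F2) →* Gam := aU.codRestrict Gam fun r => mem_Gam fun s => aM_c _ _ _

noncomputable abbrev Ik (k : ℕ) : Ideal F2 := Ideal.span {(X : F2) ^ (2 * k + 2)}

noncomputable abbrev Gk (k : ℕ) : Type := (M4 (F2 ⧸ Ik k))ˣ

/-- reduction -/
noncomputable def thk (k : ℕ) : Gam →* Gk k :=
  (Units.map ((Ideal.Quotient.mk (Ik k)).mapMatrix (m := Fin 4)).toMonoidHom).comp Gam.subtype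

lemma fin_Gk (k : ℕ) : Finite (Gk k) := by
  have h1 : ((X : F2) ^ (2 * k + 2)).Monic := monic_X_pow _
  haveI : Module.Finite (ZMod 2) (F2 ⧸ Ik k) := h1.finite_quotient
  haveI : Finite (F2 ⧸ Ik k) := Module.finite_of_finite (ZMod 2)
  haveI : Finite (M4 (F2 ⧸ Ik k)) := inferInstanceAs (Finite (Fin 4 → Fin 4 → F2 ⧸ Ik k))
  infer_instance

lemma count_Gam : Countable Gam := by
  haveI : Countable F2 := by
    rw [← Cardinal.mk_le_aleph0_iff]
    refine Polynomial.cardinalMk_le_max.trans ?_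
    simp
  haveI : Countable (M4 F2) := inferInstanceAs (Countable (Fin 4 → Fin 4 → F2))
  haveI : Countable (M4 F2)ˣ := Function.Injective.countable (f := Units.val) (fun _ _ h => Units.ext h)
  infer_instance

lemma thk_apply (k : ℕ) (g : Gam) (i j : Fin 4) :
    ((thk k g : Gk k) : M4 (F2 ⧸ Ik k)) i j = Ideal.Quotient.mk (Ik k) (((g : (M4 F2)ˣ) : M4 F2) i j) := rfl

theorem exists_group : ∃ (Γ : Type) (_ : Group Γ) (_ : Countable Γ) (G : ℕ → Type) (_ : ∀ k, Group (G k))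
    (_ : ∀ k, Finite (G k)) (θ : ∀ k, Γ →* G k) (α : Multiplicative (F2 × F2) →* Γ) (w1 w2 w3 w4 b : Γ)
    (c : Multiplicative F2 →* Γ),
    (∀ x y, α (.ofAdd (x, y)) * w1 = w1 * α (.ofAdd (x, x + y))) ∧
    (∀ x y, α (.ofAdd (x, y)) * w2 = w2 * α (.ofAdd (x, X * x + y))) ∧
    (∀ x y, α (.ofAdd (x, y)) * w3 = w3 * α (.ofAdd (x + y, y))) ∧
    (∀ x y, α (.ofAdd (x, y)) * w4 = w4 * α (.ofAdd (x + X * y, y))) ∧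
    (∀ r, c (.ofAdd r) = α (.ofAdd (r, 0)) * b * (α (.ofAdd (r, 0)))⁻¹ * b⁻¹) ∧
    (∀ γ r, γ * c r = c r * γ) ∧
    (∀ k r, θ k (c (.ofAdd r)) = 1 → X ^ (2 * k + 2) ∣ r) ∧
    (∀ γ, (∀ r, γ ≠ c r) → ∀ᶠ k in atTop, ∀ r, θ k γ ≠ θ k (c r)) := by
  refine ⟨Gam, inferInstance, count_Gam, Gk, fun k => inferInstance, fin_Gk, thk, aG,
    invG (bM 1 0 0) (bM_x 1) (bM_c _ _ _), invG (bM X 0 0) (bM_x X) (bM_c _ _ _),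
    invG (bM 0 1 0) (bM_y 1) (bM_c _ _ _), invG (bM 0 X 0) (bM_y X) (bM_c _ _ _),
    invG (bM 0 0 1) (bM_z 1) (bM_c _ _ _), cG, ?_, ?_, ?_, ?_, ?_, ?_, ?_, ?_⟩
  · intro x y
    apply Subtype.ext; apply Units.ext
    change aM x y * bM 1 0 0 = bM 1 0 0 * aM x (x + y)
    rw [aM_bx, one_mul]
  · intro x y
    apply Subtype.ext; apply Units.ext
    exact aM_bx x y X
  · intro x y
    apply Subtype.ext; apply Units.ext
    change aM x y * bM 0 1 0 = bM 0 1 0 * aM (x + y) y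
    rw [aM_by, one_mul]
  · intro x y
    apply Subtype.ext; apply Units.ext
    exact aM_by x y X
  · intro r
    rw [eq_mul_inv_iff_mul_eq, eq_mul_inv_iff_mul_eq]
    apply Subtype.ext; apply Units.ext
    exact aM_bz r
  · rintro ⟨γ, hγ⟩ r
    apply Subtype.ext
    exact ((Subgroup.mem_centralizer_iff.1 hγ) _ ⟨r, rfl⟩).symm
  · intro k r h
    have h1 := congrArg (fun g : Gk k => (g : M4 (F2 ⧸ Ik k)) 0 3) h
    simp only [thk_apply] at h1
    change Ideal.Quotient.mk (Ik k) r = 0 at h1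
    rwa [Ideal.Quotient.eq_zero_iff_mem, Ideal.mem_span_singleton] at h1
  · intro γ h
    have h1 := h (.ofAdd (((γ : (M4 F2)ˣ) : M4 F2) 0 3))
    have h2 : ∃ i j, ((γ : (M4 F2)ˣ) : M4 F2) i j ≠ cM F2 (((γ : (M4 F2)ˣ) : M4 F2) 0 3) i j := by
      by_contra hcon
      push Not at hcon
      apply h1
      apply Subtype.ext; apply Units.ext
      refine Matrix.ext fun i j => ?_
      exact hcon i j
    obtain ⟨i, j, hij⟩ := h2
    have h3 : ¬ (i = 0 ∧ j = 3) := by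
      rintro ⟨rfl, rfl⟩; exact hij rfl
    have h4 : ∀ r s, cM F2 r i j = cM F2 s i j := by
      intro r s
      revert h3
      clear hij
      fin_cases i <;> fin_cases j <;> simp [cM]
    filter_upwards [eventually_ge_atTop ((((γ : (M4 F2)ˣ) : M4 F2) i j - cM F2 0 i j).natDegree)] with k hk r hr
    have h5 := congrArg (fun g : Gk k => (g : M4 (F2 ⧸ Ik k)) i j) hr
    simp only [thk_apply] at h5
    change Ideal.Quotient.mk (Ik k) _ = Ideal.Quotient.mk (Ik k) (cM F2 r.toAdd i j) at h5
    rw [Ideal.Quotient.eq, Ideal.mem_span_singleton, h4 _ 0] at h5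
    have h6 := Polynomial.eq_zero_of_dvd_of_natDegree_lt h5 (by rw [natDegree_X_pow]; omega)
    exact hij ((sub_eq_zero.1 h6).trans (h4 _ _))

end concrete
end CN

namespace CN

section chars
open Polynomial Filter Cardinal

/-- the sign character of `ZMod 2` -/
noncomputable def eS (a : ZMod 2) : ℂ := if a = 0 then 1 else -1

lemma eS_add (a b : ZMod 2) : eS (a + b) = eS a * eS b := by
  have h01 : ∀ a : ZMod 2, a = 0 ∨ a = 1 := by decide
  have h11 : (1 : ZMod 2) + 1 = 0 := by decide
  rcases h01 a with rfl | rfl <;> rcases h01 b with rfl | rfl <;> simp [eS, h11]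

lemma eS_zero : eS 0 = 1 := by simp [eS]

lemma eS_val (a : ZMod 2) : eS a = 1 ∨ eS a = -1 := by
  unfold eS; split_ifs <;> simp

lemma eS_ne_zero (a : ZMod 2) : eS a ≠ 0 := by
  rcases eS_val a with h | h <;> rw [h] <;> norm_num

lemma eS_ne {a b : ZMod 2} (h : a ≠ b) : 1 + eS a * eS b = 0 := by
  have h01 : ∀ a : ZMod 2, a = 0 ∨ a = 1 := by decide
  rcases h01 a with rfl | rfl <;> rcases h01 b with rfl | rfl <;> simp_all [eS]

/-- the functional given by a coefficient sequence -/
noncomputable def sS (σ : ℕ → ZMod 2) (r : F2) : ZMod 2 := r.sum fun n a => a * σ n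

lemma sS_add (σ : ℕ → ZMod 2) (r s : F2) : sS σ (r + s) = sS σ r + sS σ s := by
  unfold sS
  exact Polynomial.sum_add_index r s _ (by simp) (by intros; ring)

lemma sS_zero (σ : ℕ → ZMod 2) : sS σ 0 = 0 := by simp [sS]

lemma sS_X (σ : ℕ → ZMod 2) (n : ℕ) : sS σ (X ^ n) = σ n := by
  unfold sS
  rw [← Polynomial.monomial_one_right_eq_X_pow, Polynomial.sum_monomial_index] <;> simp

lemma sS_congr {σ τ : ℕ → ZMod 2} {r : F2} (h : ∀ n ≤ r.natDegree, σ n = τ n) : sS σ r = sS τ r := by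
  unfold sS Polynomial.sum
  refine Finset.sum_congr rfl fun n hn => ?_
  simp only [h n (le_natDegree_of_mem_supp n hn)]

lemma sS_dvd {σ : ℕ → ZMod 2} {r : F2} {N : ℕ} (h : ∀ n ≥ N, σ n = 0) (hr : X ^ N ∣ r) : sS σ r = 0 := by
  unfold sS Polynomial.sum
  refine Finset.sum_eq_zero fun n hn => ?_
  change r.coeff n * σ n = 0
  by_cases hN : N ≤ n
  · rw [h n hN, mul_zero]
  · rw [Polynomial.X_pow_dvd_iff.1 hr n (by omega), zero_mul]

lemma eS_sum (σ : ℕ → ZMod 2) (T : Finset ℕ) : eS (sS σ (∑ n ∈ T, X ^ n)) = ∏ n ∈ T, eS (σ n) := by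
  classical
  induction T using Finset.induction_on with
  | empty => simp [sS_zero, eS_zero]
  | insert a T ha ih => rw [Finset.sum_insert ha, sS_add, eS_add, sS_X, ih, Finset.prod_insert ha]

lemma eS_cancel (σ τ : ℕ → ZMod 2) (m : ℕ) (h : ∃ n < m, σ n ≠ τ n) :
    ∑ T ∈ (Finset.range m).powerset, eS (sS σ (∑ n ∈ T, X ^ n)) * eS (sS τ (∑ n ∈ T, X ^ n)) = 0 := by
  simp only [eS_sum, ← Finset.prod_mul_distrib]
  rw [← Finset.prod_one_add]
  obtain ⟨n, hn, hne⟩ := h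
  exact Finset.prod_eq_zero (Finset.mem_range.2 hn) (eS_ne hne)

/-- the main index sequence -/
def iS (x : ℕ → Bool) (n : ℕ) : ZMod 2 := if n % 2 = 0 then 1 else if x (n / 2) then 1 else 0

/-- truncations, even version -/
def sA (x : ℕ → Bool) (k n : ℕ) : ZMod 2 := if n ≤ 2 * k then iS x n else 0

/-- truncations, odd version -/
def sB (x : ℕ → Bool) (k n : ℕ) : ZMod 2 := if n ≤ 2 * k then iS x n else if n = 2 * k + 1 then 1 else 0

lemma iS_even (x : ℕ → Bool) (n : ℕ) : iS x (2 * n) = 1 := by simp [iS]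

lemma sAB_ne {x y : ℕ → Bool} {n : ℕ} (h : x n ≠ y n) (k l : ℕ) : ∃ p < 2 * n + 4, sA x k p ≠ sB y l p := by
  have h10 : (1 : ZMod 2) ≠ 0 := by decide
  have hxy : iS x (2 * n + 1) ≠ iS y (2 * n + 1) := by
    have h1 : (2 * n + 1) % 2 ≠ 0 := by omega
    have h2 : (2 * n + 1) / 2 = n := by omega
    simp only [iS, if_neg h1, h2]
    cases hx : x n <;> cases hy : y n <;> simp_all
  by_cases h1 : 2 * n + 1 ≤ 2 * k
  · by_cases h2 : 2 * n + 1 ≤ 2 * l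
    · refine ⟨2 * n + 1, by omega, ?_⟩
      rwa [sA, sB, if_pos h1, if_pos h2]
    · refine ⟨2 * (l + 1), by omega, ?_⟩
      rw [sA, sB, if_pos (by omega), if_neg (by omega), if_neg (by omega), iS_even]
      exact h10
  · by_cases h2 : l < k
    · refine ⟨2 * k, by omega, ?_⟩
      rw [sA, sB, if_pos le_rfl, if_neg (by omega), if_neg (by omega), iS_even]
      exact h10
    · by_cases h3 : k = l
      · refine ⟨2 * k + 1, by omega, ?_⟩
        rw [sA, sB, if_neg (by omega), if_neg (by omega), if_pos (by omega)]
        exact h10.symm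
      · refine ⟨2 * (k + 1), by omega, ?_⟩
        rw [sA, sB, if_neg (by omega), if_pos (by omega), iS_even]
        exact h10.symm

open Classical in
/-- sign functions from characters -/
noncomputable def wF {Γ G : Type} [Group Γ] [Group G] (θ : Γ →* G) (c : Multiplicative F2 →* Γ) (σ : ℕ → ZMod 2)
    (g : G) : ℂ := if h : ∃ r, g = θ (c r) then eS (sS σ h.choose.toAdd) else 0

variable {Γ G : Type} [Group Γ] [Group G] {θ : Γ →* G} {c : Multiplicative F2 →* Γ} {σ : ℕ → ZMod 2}

lemma wF_c (h0 : ∀ r, θ (c (.ofAdd r)) = 1 → sS σ r = 0) (r : F2) : wF θ c σ (θ (c (.ofAdd r))) = eS (sS σ r) := by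
  have h : ∃ s, θ (c (.ofAdd r)) = θ (c s) := ⟨_, rfl⟩
  rw [wF, dif_pos h]
  have h1 := h.choose_spec
  set s := h.choose with hs
  have h2 : sS σ (r + s.toAdd) = 0 := by
    apply h0
    have h3 : (s : Multiplicative F2) * s = 1 := by
      apply Multiplicative.toAdd.injective
      exact f2_add_self _
    rw [ofAdd_add, map_mul, map_mul, h1, ofAdd_toAdd, ← map_mul, ← map_mul, h3, map_one, map_one]
  rw [sS_add] at h2
  have h4 : ∀ a b : ZMod 2, a + b = 0 → b = a := by decide
  rw [h4 _ _ h2]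

lemma wF_not {g : G} (h : ∀ r, g ≠ θ (c r)) : wF θ c σ g = 0 := by
  rw [wF, dif_neg]
  push Not
  exact h

lemma wF_sgn (h0 : ∀ r, θ (c (.ofAdd r)) = 1 → sS σ r = 0) : SgnF (wF θ c σ) := by
  have hne : ∀ g, wF θ c σ g ≠ 0 → ∃ r, g = θ (c r) := by
    intro g hg
    by_contra h
    push Not at h
    exact hg (wF_not h)
  refine ⟨?_, ?_, ?_⟩
  · have := wF_c h0 0
    rwa [ofAdd_zero, map_one, map_one, sS_zero, eS_zero] at this
  · intro g
    by_cases h : wF θ c σ g = 0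
    · exact Or.inl h
    · obtain ⟨r, rfl⟩ := hne g h
      right
      rw [← ofAdd_toAdd r, wF_c h0]
      exact eS_val _
  · intro h g hh
    obtain ⟨r, rfl⟩ := hne h hh
    by_cases hg : ∃ s, g = θ (c s)
    · obtain ⟨s, rfl⟩ := hg
      rw [← ofAdd_toAdd r, ← ofAdd_toAdd s, ← map_mul, ← map_mul, ← ofAdd_add, wF_c h0, wF_c h0, wF_c h0, sS_add, eS_add]
    · push Not at hg
      rw [wF_not hg, mul_zero, wF_not]
      intro s hs
      apply hg (r⁻¹ * s)
      rw [map_mul, map_mul, ← hs, map_inv, map_inv, inv_mul_cancel_left]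

lemma wF_comm (hc : ∀ γ r, γ * c r = c r * γ) (γ : Γ) (g : G) : wF θ c σ (θ γ * g) = wF θ c σ (g * θ γ) := by
  have : ∀ r, θ γ * g = θ (c r) ↔ g * θ γ = θ (c r) := by
    intro r
    have h := congrArg θ (hc γ r)
    rw [map_mul, map_mul] at h
    constructor
    · intro h1
      have h2 : θ γ * θ (c r) = θ γ * (g * θ γ) := by rw [h, ← h1, mul_assoc]
      exact (mul_left_cancel h2).symm
    · intro h1
      rw [← h1, ← mul_assoc] at h
      exact (mul_right_cancel h).trans h1
  classical
  have key : ∀ P Q : Multiplicative F2 → Prop, P = Q → (if h : ∃ r, P r then eS (sS σ h.choose.toAdd) else 0) =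
      (if h : ∃ r, Q r then eS (sS σ h.choose.toAdd) else 0) := by
    rintro P _ rfl; rfl
  unfold wF
  convert key _ _ (funext fun r => propext (this r))

end chars

section final
open Polynomial Filter Cardinal

theorem final_count {A : Type u} {B : Type v} [CStarAlgebra A] [CStarAlgebra B]
    (hRP : RP A) (hCH : CHab A) (hBS : BS A) (hS : SepF A) (hFA : ¬ FAOne A)
    (hRP' : RP B) (hCH' : CHab B) (hBS' : BS B) (hS' : SepF B) (hFA' : ¬ FAOne B) :
    continuum ≤ #{f : A ⊗[ℂ] B → ℝ // IsCstarNorm f} := by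
  obtain ⟨Γ, _, _, G, _, _, θ, α, w1, w2, w3, w4, b, c, r1, r2, r3, r4, hcb, hcc, hθ1, hθ2⟩ := exists_group
  have hA0 : ∀ x k r, θ k (c (.ofAdd r)) = 1 → sS (sA x k) r = 0 := by
    intro x k r h
    refine sS_dvd ?_ (hθ1 k r h)
    intro n hn; rw [sA, if_neg (by omega)]
  have hB0 : ∀ x k r, θ k (c (.ofAdd r)) = 1 → sS (sB x k) r = 0 := by
    intro x k r h
    refine sS_dvd ?_ (hθ1 k r h)
    intro n hn; rw [sB, if_neg (by omega), if_neg (by omega)]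
  choose u ψ hu hus hψ hψ1 hψi hψl hul using fun x : ℕ → Bool => block_rep hRP hCH hBS hS hFA G θ
    (fun k => wF (θ k) c (sA x k)) (fun k => wF_sgn (hA0 x k)) (fun k γ g => wF_comm hcc γ g)
  choose v ψ' hv hvs hψ' hψ1' hψi' hψl' hvl using fun x : ℕ → Bool => block_rep hRP' hCH' hBS' hS' hFA' G θ
    (fun k => wF (θ k) c (sB x k)) (fun k => wF_sgn (hB0 x k)) (fun k γ g => wF_comm hcc γ g)
  have hinv : ∀ r, (c r)⁻¹ = c r := by
    intro r
    rw [← map_inv]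
    congr 1
    rw [inv_eq_iff_mul_eq_one]
    apply Multiplicative.toAdd.injective
    exact f2_add_self _
  refine count_main hS hS' (J := ℕ → Bool) (by simp) u v hu hus hv hvs ψ ψ' hψ hψ' 
    (fun j h y => hψi j h y) (fun j h y => hψi' j h y) hψ1 hψ1' ?_
    (![1, α (.ofAdd (1, 0)), α (.ofAdd (0, 1)), b, w1, w2, w3, w4]) (1 / 10368) (by norm_num) (by norm_num) ?_
  · intro x g
    by_cases hg : ∃ r, g = c r
    · obtain ⟨r, rfl⟩ := hg
      rw [hinv, hψl x (c r) (eS (sS (iS x) r.toAdd)), hψl' x (c r) (eS (sS (iS x) r.toAdd))]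
      · filter_upwards [eventually_ge_atTop r.toAdd.natDegree] with k hk
        rw [← ofAdd_toAdd r, wF_c (hB0 x k), toAdd_ofAdd]
        congr 1
        refine sS_congr fun n hn => ?_
        rw [sB, if_pos (by omega)]
      · filter_upwards [eventually_ge_atTop r.toAdd.natDegree] with k hk
        rw [← ofAdd_toAdd r, wF_c (hA0 x k), toAdd_ofAdd]
        congr 1
        refine sS_congr fun n hn => ?_
        rw [sA, if_pos (by omega)]
    · push Not at hg
      have hg' : ∀ r, g⁻¹ ≠ c r := by
        intro r hr
        apply hg r
        rw [← hinv, ← hr, inv_inv]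
      rw [hψl x g⁻¹ 0, hψl' x g 0]
      · filter_upwards [hθ2 g hg] with k hk
        exact wF_not hk
      · filter_upwards [hθ2 _ hg'] with k hk
        exact wF_not hk
  · intro x y hxy Φ hΦ
    by_contra hgap
    push Not at hgap
    obtain ⟨n, hn⟩ := Function.ne_iff.1 hxy
    have hpos := relT_main hΦ (fun g => u x g ⊗ₜ[ℂ] v y g)
      (fun g k => by rw [Algebra.TensorProduct.tmul_mul_tmul, hu, hv])
      (fun g => by rw [pstar_tmul, hus, hvs]) α w1 w2 w3 w4 b (fun r => c (.ofAdd r)) r1 r2 r3 r4 hcb hgap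
    have hzero : ∑ T ∈ (Finset.range (2 * n + 4)).powerset,
        u x (c (.ofAdd (∑ n ∈ T, X ^ n))) ⊗ₜ[ℂ] v y (c (.ofAdd (∑ n ∈ T, X ^ n))) = 0 := by
      refine tensor_vanish (fun T : Finset ℕ => u x (c (.ofAdd (∑ n ∈ T, X ^ n)))) (fun T => v y (c (.ofAdd (∑ n ∈ T, X ^ n))))
        (fun k T => eS (sS (sA x k) (∑ n ∈ T, X ^ n))) (fun k T => eS (sS (sB y k) (∑ n ∈ T, X ^ n))) _ ?_ ?_ ?_
      · intro β hβ
        refine hul x _ _ (fun T : Finset ℕ => c (.ofAdd (∑ n ∈ T, X ^ n))) β ?_ ?_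
        · intro k T _
          rw [wF_c (hA0 x k)]; exact eS_ne_zero _
        · intro k
          simp only [wF_c (hA0 x k)]; exact hβ k
      · intro β hβ
        refine hvl y _ _ (fun T : Finset ℕ => c (.ofAdd (∑ n ∈ T, X ^ n))) β ?_ ?_
        · intro k T _
          rw [wF_c (hB0 y k)]; exact eS_ne_zero _
        · intro k
          simp only [wF_c (hB0 y k)]; exact hβ k
      · intro k l
        exact eS_cancel _ _ _ (sAB_ne hn k l)
    have h2 := congrArg (fun z => (Φ z).re) hzero
    simp only [map_sum, Complex.re_sum, map_zero, Complex.zero_re] at h2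
    have h3 : 0 < ∑ T ∈ (Finset.range (2 * n + 4)).powerset,
        (Φ (u x (c (.ofAdd (∑ n ∈ T, X ^ n))) ⊗ₜ[ℂ] v y (c (.ofAdd (∑ n ∈ T, X ^ n))))).re :=
      Finset.sum_pos (fun T _ => hpos _) ⟨∅, by simp⟩
    exact absurd h2 h3.ne'

end final
end CN

namespace CN
open Cardinal

lemma final_cstar {A : Type u} {B : Type v} [CStarAlgebra A] [CStarAlgebra B]
    (hR : RPF A) (hR' : RPF B) (hB : BS A) (hB' : BS B) (hS : SepF A) (hS' : SepF B)
    (h : ∃ f g : A ⊗[ℂ] B → ℝ, IsCstarNorm f ∧ IsCstarNorm g ∧ f ≠ g) :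
    continuum ≤ #{f : A ⊗[ℂ] B → ℝ // IsCstarNorm f} := by
  obtain ⟨f, g, hf, hg, hfg⟩ := h
  have h1 := RP_of_RPF hR
  have h2 := RP_of_RPF hR'
  by_cases hFA : FAOne A
  · exact absurd (cn_eq_of_FA (hspan_of_RP h1) hFA hf hg) hfg
  by_cases hFB : FAOne B
  · exact absurd (cn_eq_of_FA' (hspan_of_RP h2) hFB hf hg) hfg
  exact final_count h1 (CHab_of_RPF hR) hB hS hFA h2 (CHab_of_RPF hR') hB' hS' hFB

lemma final_vn {H₁ : Type u} {H₂ : Type v} [NormedAddCommGroup H₁] [InnerProductSpace ℂ H₁] [CompleteSpace H₁]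
    [NormedAddCommGroup H₂] [InnerProductSpace ℂ H₂] [CompleteSpace H₂]
    (M : VonNeumannAlgebra H₁) (N : VonNeumannAlgebra H₂)
    (h : ∃ f g : (↥M.toStarSubalgebra ⊗[ℂ] ↥N.toStarSubalgebra) → ℝ,
      IsCstarNorm f ∧ IsCstarNorm g ∧ f ≠ g) :
    continuum ≤ #{f : (↥M.toStarSubalgebra ⊗[ℂ] ↥N.toStarSubalgebra) → ℝ // IsCstarNorm f} :=
  final_cstar (vn_RPF M) (vn_RPF N) (vn_BS M) (vn_BS N) (vn_SepF M) (vn_SepF N) h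

end CN

/-- If the algebraic tensor product of two von Neumann algebras admits
at least two distinct C*-norms, then the set of C*-norms on it has cardinality at least
`2 ^ ℵ₀`, the cardinality of the continuum. -/
theorem continuum_le_card_cstarNorms_of_vonNeumannAlgebras
    {H₁ : Type u} {H₂ : Type v} [NormedAddCommGroup H₁] [InnerProductSpace ℂ H₁] [CompleteSpace H₁]
    [NormedAddCommGroup H₂] [InnerProductSpace ℂ H₂] [CompleteSpace H₂]
    (M : VonNeumannAlgebra H₁) (N : VonNeumannAlgebra H₂)
    (h : ∃ f g : (↥M.toStarSubalgebra ⊗[ℂ] ↥N.toStarSubalgebra) → ℝ,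
      IsCstarNorm f ∧ IsCstarNorm g ∧ f ≠ g) :
    Cardinal.continuum ≤
      Cardinal.mk {f : (↥M.toStarSubalgebra ⊗[ℂ] ↥N.toStarSubalgebra) → ℝ // IsCstarNorm f} := by
  exact CN.final_vn M N h
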